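/- LAN for fractional Gaussian noise with fixed sampling step Δ = 1: For each (H,σ) ∈ (0,1)×(0,∞) and n ≥ 1, let P^n_{(H,σ)} be the centered Gaussian measure on ℝ^n with covariance matrix σ² T_n(H). Then the family {P^n_{(H,σ)} : (H,σ) ∈ (0,1)×(0,∞)} is LAN at every (H,σ) with rate matrix φ_n(H,σ) = (1/√n)·I₂ (I₂ the 2×2 identity matrix) and Fisher matrix I(H,σ) = [[e_H, −j_H/σ], [−j_H/σ, 2/σ²]]. -/

import Mathlib

open MeasureTheory Filter Topology Matrix

noncomputable section

/-- Covariance matrix `T_n(H)` of a standard fractional Gaussian noise: its `(i,j)` entry is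
`(|i-j+1|^{2H} - 2|i-j|^{2H} + |i-j-1|^{2H})/2`. -/
def fgnT (n : ℕ) (H : ℝ) : Matrix (Fin n) (Fin n) ℝ := fun i j =>
  (|((i : ℕ) : ℝ) - ((j : ℕ) : ℝ) + 1| ^ (2 * H)
      - 2 * |((i : ℕ) : ℝ) - ((j : ℕ) : ℝ)| ^ (2 * H)
      + |((i : ℕ) : ℝ) - ((j : ℕ) : ℝ) - 1| ^ (2 * H)) / 2

/-- Quadratic form `⟨x, M x⟩`. -/
def qForm {n : ℕ} (M : Matrix (Fin n) (Fin n) ℝ) (x : Fin n → ℝ) : ℝ :=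
  ∑ i, ∑ j, x i * M i j * x j

/-- Centered Gaussian measure on `ℝⁿ` with nondegenerate covariance matrix `S`, given by its
density with respect to Lebesgue measure. -/
def gaussianPi (n : ℕ) (S : Matrix (Fin n) (Fin n) ℝ) : Measure (Fin n → ℝ) :=
  volume.withDensity fun x => ENNReal.ofReal
    ((2 * Real.pi) ^ (-(n : ℝ) / 2) * S.det ^ (-(1 : ℝ) / 2) *
      Real.exp (-(qForm S⁻¹ x) / 2))

/-- The law `Pⁿ_{(H,σ)}` of fractional Gaussian noise observed with time step `Δ`:
a centered Gaussian measure on `ℝⁿ` with covariance `σ² Δ^{2H} T_n(H)`. -/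
def fgnP (n : ℕ) (Δ H σ : ℝ) : Measure (Fin n → ℝ) :=
  gaussianPi n ((σ ^ 2 * Δ ^ (2 * H)) • fgnT n H)

/-- Spectral density `f_H` of the increments of fractional Brownian motion. -/
def fgnSpec (H l : ℝ) : ℝ :=
  (Real.Gamma (2 * H + 1) * Real.sin (Real.pi * H) / (2 * Real.pi)) *
    (2 * (1 - Real.cos l)) * ∑' k : ℤ, |l + 2 * (k : ℝ) * Real.pi| ^ (-2 * H - 1)

/-- `∂_H log f_H(λ)`. -/
def dlogSpec (H l : ℝ) : ℝ := deriv (fun h : ℝ => Real.log (fgnSpec h l)) H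

/-- `j_H = -(1/(2π)) ∫_{-π}^{π} ∂_H log f_H(λ) dλ`. -/
def jH (H : ℝ) : ℝ := -(1 / (2 * Real.pi)) * ∫ l in (-Real.pi)..Real.pi, dlogSpec H l

/-- `e_H = (1/(4π)) ∫_{-π}^{π} |∂_H log f_H(λ)|² dλ`. -/
def eH (H : ℝ) : ℝ := (1 / (4 * Real.pi)) * ∫ l in (-Real.pi)..Real.pi, (dlogSpec H l) ^ 2

/-- The limit covariance matrix `J(H)` of `(A_n, B_n)`. -/
def Jmat (H : ℝ) : Matrix (Fin 2) (Fin 2) ℝ := !![2, jH H; jH H, eH H]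

/-- Log-likelihood `ℓ_n(H,σ)` of the fGn sample. -/
def loglik (n : ℕ) (Δ H σ : ℝ) (x : Fin n → ℝ) : ℝ :=
  -(n : ℝ) / 2 * Real.log (2 * Real.pi) - (n : ℝ) * H * Real.log Δ - (n : ℝ) * Real.log σ
    - Real.log (fgnT n H).det / 2
    - qForm (fgnT n H)⁻¹ x / (2 * σ ^ 2 * Δ ^ (2 * H))

/-- `C_n = (1/(nσ²Δ^{2H})) ⟨x, T_n(H)⁻¹ x⟩`. -/
def Cstat (n : ℕ) (Δ H σ : ℝ) (x : Fin n → ℝ) : ℝ :=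
  qForm (fgnT n H)⁻¹ x / ((n : ℝ) * σ ^ 2 * Δ ^ (2 * H))

/-- `A_n = √n (C_n - 1)`. -/
def Astat (n : ℕ) (Δ H σ : ℝ) (x : Fin n → ℝ) : ℝ :=
  Real.sqrt n * (Cstat n Δ H σ x - 1)

/-- Entrywise derivative in `H` of `T_n(H)⁻¹`. -/
def dInvT (n : ℕ) (H : ℝ) : Matrix (Fin n) (Fin n) ℝ := fun i j =>
  deriv (fun h : ℝ => (fgnT n h)⁻¹ i j) H

/-- Entrywise second derivative in `H` of `T_n(H)⁻¹`. -/
def d2InvT (n : ℕ) (H : ℝ) : Matrix (Fin n) (Fin n) ℝ := fun i j =>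
  deriv (fun h : ℝ => deriv (fun h' : ℝ => (fgnT n h')⁻¹ i j) h) H

/-- Entrywise derivative in `H` of `T_n(H)`. -/
def dT (n : ℕ) (H : ℝ) : Matrix (Fin n) (Fin n) ℝ := fun i j =>
  deriv (fun h : ℝ => fgnT n h i j) H

/-- `B_n = (1/√n) ( (1/2) ∂_H log det T_n(H) + (1/(2σ²Δ^{2H})) ⟨x, ∂_H(T_n(H)⁻¹) x⟩ )`. -/
def Bstat (n : ℕ) (Δ H σ : ℝ) (x : Fin n → ℝ) : ℝ :=
  (1 / Real.sqrt n) *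
    (deriv (fun h : ℝ => Real.log (fgnT n h).det) H / 2
      + qForm (dInvT n H) x / (2 * σ ^ 2 * Δ ^ (2 * H)))

/-- `D_n = (1/(nσ²Δ^{2H})) ⟨x, ∂_H(T_n(H)⁻¹) x⟩`. -/
def Dstat (n : ℕ) (Δ H σ : ℝ) (x : Fin n → ℝ) : ℝ :=
  qForm (dInvT n H) x / ((n : ℝ) * σ ^ 2 * Δ ^ (2 * H))

/-- `E_n = (1/n) ( (1/2) ∂_H² log det T_n(H) + (1/(2σ²Δ^{2H})) ⟨x, ∂_H²(T_n(H)⁻¹) x⟩ )`. -/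
def Estat (n : ℕ) (Δ H σ : ℝ) (x : Fin n → ℝ) : ℝ :=
  (1 / (n : ℝ)) *
    (deriv (fun h : ℝ => deriv (fun h' : ℝ => Real.log (fgnT n h').det) h) H / 2
      + qForm (d2InvT n H) x / (2 * σ ^ 2 * Δ ^ (2 * H)))

/-- Convergence in law (weak convergence of the laws against bounded continuous functions). -/
def TendstoInLaw {E : Type*} [MeasurableSpace E] [TopologicalSpace E]
    (μ : ℕ → Measure E) (ν : Measure E) : Prop :=
  ∀ g : BoundedContinuousFunction E ℝ,
    Tendsto (fun n => ∫ x, g x ∂μ n) atTop (𝓝 (∫ x, g x ∂ν))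

/-- Convergence in law to the centered Gaussian distribution on `ℝᵈ` with covariance matrix `S`,
expressed through the Cramér–Wold device: every linear functional converges in law to the
corresponding one-dimensional centered Gaussian law. -/
def TendstoInLawGaussian {d : ℕ} (μ : ℕ → Measure (Fin d → ℝ))
    (S : Matrix (Fin d) (Fin d) ℝ) : Prop :=
  ∀ t : Fin d → ℝ,
    TendstoInLaw (fun n => (μ n).map fun z => ∑ i, t i * z i)
      (ProbabilityTheory.gaussianReal 0 (qForm S t).toNNReal)

/-- Convergence in probability to a constant, for statistics defined on varying sample spaces. -/
def TendstoInProb {X : ℕ → Type*} [∀ n, MeasurableSpace (X n)]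
    (μ : ∀ n, Measure (X n)) (f : ∀ n, X n → ℝ) (c : ℝ) : Prop :=
  ∀ ε > 0, Tendsto (fun n => μ n {x | ε ≤ |f n x - c|}) atTop (𝓝 0)

/-- The LAN expansion: the likelihood ratio of `P^n_{θ₀ + φ_n u}` with respect to `P^n_{θ₀}`
is `exp(⟨u, ζ_n⟩ - ½⟨I u, u⟩ + r_n(u))` with `ζ_n → N(0, I)` in law and `r_n(u) → 0` in
probability under `P^n_{θ₀}`. -/
def LANExpansion {X : ℕ → Type*} [∀ n, MeasurableSpace (X n)] {d : ℕ}
    (P : (n : ℕ) → (Fin d → ℝ) → Measure (X n)) (θ₀ : Fin d → ℝ)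
    (φ : ℕ → Matrix (Fin d) (Fin d) ℝ) (I : Matrix (Fin d) (Fin d) ℝ) : Prop :=
  ∃ (ζ : (n : ℕ) → X n → Fin d → ℝ) (r : (n : ℕ) → (Fin d → ℝ) → X n → ℝ),
    (∀ n, Measurable (ζ n)) ∧
    TendstoInLawGaussian (fun n => (P n θ₀).map (ζ n)) I ∧
    ∀ u : Fin d → ℝ,
      (∀ᶠ n in atTop,
        P n (θ₀ + (φ n).mulVec u) = (P n θ₀).withDensity fun x =>
          ENNReal.ofReal (Real.exp (∑ i, u i * ζ n x i - qForm I u / 2 + r n u x))) ∧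
      TendstoInProb (fun n => P n θ₀) (fun n => r n u) 0

/-- Local Asymptotic Normality at `θ₀` with nondegenerate rate matrices `φ_n`
and nondegenerate Fisher information matrix `I`. -/
def IsLAN {X : ℕ → Type*} [∀ n, MeasurableSpace (X n)] {d : ℕ}
    (P : (n : ℕ) → (Fin d → ℝ) → Measure (X n)) (θ₀ : Fin d → ℝ)
    (φ : ℕ → Matrix (Fin d) (Fin d) ℝ) (I : Matrix (Fin d) (Fin d) ℝ) : Prop :=
  (∀ᶠ n in atTop, (φ n).det ≠ 0) ∧ I.det ≠ 0 ∧ LANExpansion P θ₀ φ I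

/-! ### Gaussian quadratic forms -/

lemma exists_orthogonal_diagonalization {n : ℕ} {M : Matrix (Fin n) (Fin n) ℝ}
    (hM : M.IsHermitian) :
    ∃ (U : Matrix (Fin n) (Fin n) ℝ) (e : Fin n → ℝ), U * Uᵀ = 1 ∧ Uᵀ * U = 1 ∧
      M = U * diagonal e * Uᵀ := by
  refine ⟨hM.eigenvectorUnitary, hM.eigenvalues, ?_, ?_, ?_⟩
  · have := hM.eigenvectorUnitary.2.2
    simpa [star_eq_conjTranspose, conjTranspose_eq_transpose_of_trivial] using this
  · have := hM.eigenvectorUnitary.2.1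
    simpa [star_eq_conjTranspose, conjTranspose_eq_transpose_of_trivial] using this
  · have := hM.spectral_theorem
    simpa [Unitary.conjStarAlgAut_apply, star_eq_conjTranspose,
      conjTranspose_eq_transpose_of_trivial, Function.comp_def] using this

lemma exists_simultaneous_diagonalization {n : ℕ} {S M : Matrix (Fin n) (Fin n) ℝ}
    (hS : S.PosDef) (hM : M.IsHermitian) :
    ∃ (L : Matrix (Fin n) (Fin n) ℝ) (e : Fin n → ℝ), L.det ≠ 0 ∧ S = L * Lᵀ ∧
      Lᵀ * M * L = diagonal e := by
  obtain ⟨U, d, hU, hU', hSd⟩ := exists_orthogonal_diagonalization hS.1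
  have hd : ∀ i, 0 < d i := by
    have h1 : (diagonal d).PosDef := by
      have h2 : diagonal d = Uᵀ * S * U := by
        rw [hSd]
        calc diagonal d = (Uᵀ * U) * diagonal d * (Uᵀ * U) := by rw [hU']; simp
          _ = _ := by simp only [Matrix.mul_assoc]
      rw [h2]
      have := hS.conjTranspose_mul_mul_same (B := U) (by
        intro x y hxy
        have : Uᵀ *ᵥ (U *ᵥ x) = Uᵀ *ᵥ (U *ᵥ y) := by rw [hxy]
        simpa [Matrix.mulVec_mulVec, hU'] using this)
      simpa [conjTranspose_eq_transpose_of_trivial] using this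
    exact fun i => by simpa using (posDef_diagonal_iff.1 h1) i
  set L0 := U * diagonal (fun i => Real.sqrt (d i)) with hL0
  have hSL : S = L0 * L0ᵀ := by
    rw [hSd, hL0, transpose_mul, diagonal_transpose]
    rw [Matrix.mul_assoc, Matrix.mul_assoc U, ← Matrix.mul_assoc (diagonal _) (diagonal _),
      diagonal_mul_diagonal]
    congr 3
    ext i
    rw [Real.mul_self_sqrt (hd i).le]
  have hH : (L0ᵀ * M * L0).IsHermitian := by
    have := isHermitian_conjTranspose_mul_mul L0 hM
    simpa [conjTranspose_eq_transpose_of_trivial] using this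
  obtain ⟨V, e, hV, hV', hVe⟩ := exists_orthogonal_diagonalization hH
  have hSV : S = (L0 * V) * (L0 * V)ᵀ := by
    rw [transpose_mul, Matrix.mul_assoc, ← Matrix.mul_assoc V, hV, Matrix.one_mul, ← hSL]
  refine ⟨L0 * V, e, ?_, hSV, ?_⟩
  · intro h0
    have := hS.det_pos
    rw [hSV, det_mul, h0] at this
    simp at this
  · calc (L0 * V)ᵀ * M * (L0 * V) = Vᵀ * (L0ᵀ * M * L0) * V := by
          simp only [transpose_mul, Matrix.mul_assoc]
      _ = (Vᵀ * V) * diagonal e * (Vᵀ * V) := by rw [hVe]; simp only [Matrix.mul_assoc]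
      _ = _ := by rw [hV']; simp

lemma qForm_eq_dotProduct {n : ℕ} (M : Matrix (Fin n) (Fin n) ℝ) (x : Fin n → ℝ) :
    qForm M x = x ⬝ᵥ (M *ᵥ x) := by
  simp [qForm, dotProduct, mulVec, Finset.mul_sum, mul_assoc]

lemma qForm_mulVec {n : ℕ} (M L : Matrix (Fin n) (Fin n) ℝ) (x : Fin n → ℝ) :
    qForm M (L *ᵥ x) = qForm (Lᵀ * M * L) x := by
  simp only [qForm_eq_dotProduct, ← Matrix.mulVec_mulVec]
  rw [Matrix.dotProduct_mulVec x Lᵀ, Matrix.vecMul_transpose]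

lemma qForm_diagonal {n : ℕ} (e x : Fin n → ℝ) :
    qForm (diagonal e) x = ∑ i, e i * x i ^ 2 := by
  rw [qForm_eq_dotProduct]
  simp only [dotProduct, mulVec_diagonal]
  exact Finset.sum_congr rfl fun i _ => by ring

lemma continuous_qForm {n : ℕ} (M : Matrix (Fin n) (Fin n) ℝ) : Continuous (qForm M) := by
  unfold qForm; fun_prop

lemma measurable_qForm {n : ℕ} (M : Matrix (Fin n) (Fin n) ℝ) : Measurable (qForm M) :=
  (continuous_qForm M).measurable

/-- The standard Gaussian measure on `ℝⁿ` as a product measure. -/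
def stdGaussianPi (n : ℕ) : Measure (Fin n → ℝ) :=
  Measure.pi fun _ => ProbabilityTheory.gaussianReal 0 1

instance (n : ℕ) : IsProbabilityMeasure (stdGaussianPi n) := by
  unfold stdGaussianPi; infer_instance

lemma stdGaussianPi_eq_withDensity (n : ℕ) :
    stdGaussianPi n = volume.withDensity fun x : Fin n → ℝ =>
      ENNReal.ofReal (∏ i, ProbabilityTheory.gaussianPDFReal 0 1 (x i)) := by
  unfold stdGaussianPi
  refine Measure.pi_eq fun s hs => ?_
  rw [withDensity_apply _ (MeasurableSet.univ_pi hs)]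
  set g := ProbabilityTheory.gaussianPDFReal 0 1 with hg
  have hgi : Integrable g := ProbabilityTheory.integrable_gaussianPDFReal 0 1
  have hg0 : ∀ x, 0 ≤ g x := ProbabilityTheory.gaussianPDFReal_nonneg 0 1
  have hi : ∀ i, Integrable ((s i).indicator g) := fun i => hgi.indicator (hs i)
  rw [← lintegral_indicator (MeasurableSet.univ_pi hs)]
  have h1 : ∀ x : Fin n → ℝ, (Set.univ.pi s).indicator
      (fun x => ENNReal.ofReal (∏ i, g (x i))) x
      = ENNReal.ofReal (∏ i, (s i).indicator g (x i)) := by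
    intro x
    by_cases hx : x ∈ Set.univ.pi s
    · rw [Set.indicator_of_mem hx]
      congr 1
      exact Finset.prod_congr rfl fun i _ => (Set.indicator_of_mem (hx i trivial) g).symm
    · rw [Set.indicator_of_notMem hx]
      simp only [Set.mem_pi, Set.mem_univ, true_imp_iff, not_forall] at hx
      obtain ⟨i, hxi⟩ := hx
      rw [Finset.prod_eq_zero (Finset.mem_univ i) (Set.indicator_of_notMem hxi g)]
      simp
  simp_rw [h1]
  rw [← ofReal_integral_eq_lintegral_ofReal]
  · rw [integral_fintype_prod_volume_eq_prod, ENNReal.ofReal_prod_of_nonneg]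
    · refine Finset.prod_congr rfl fun i _ => ?_
      rw [integral_indicator (hs i), ofReal_integral_eq_lintegral_ofReal hgi.restrict
        (ae_of_all _ hg0), ProbabilityTheory.gaussianReal_of_var_ne_zero _ one_ne_zero,
        withDensity_apply _ (hs i)]
      rfl
    · exact fun i _ => integral_nonneg fun x => Set.indicator_nonneg (fun y _ => hg0 y) x
  · exact Integrable.fintype_prod hi
  · exact ae_of_all _ fun x => Finset.prod_nonneg fun i _ =>
      Set.indicator_nonneg (fun y _ => hg0 y) _

lemma map_stdGaussianPi {n : ℕ} {S L : Matrix (Fin n) (Fin n) ℝ} (hL : L.det ≠ 0)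
    (hS : S = L * Lᵀ) :
    (stdGaussianPi n).map (L *ᵥ ·) = gaussianPi n S := by
  have hm : Measurable (fun x : Fin n → ℝ => L *ᵥ x) := by
    have : Continuous (fun x : Fin n → ℝ => L *ᵥ x) := by fun_prop
    exact this.measurable
  have hu : IsUnit L.det := isUnit_iff_ne_zero.2 hL
  have hvol := Real.map_matrix_volume_pi_eq_smul_volume_pi hL
  have hvol' : (volume : Measure (Fin n → ℝ)) =
      ENNReal.ofReal |L.det| • (volume.map (L *ᵥ ·)) := by
    have : (volume : Measure (Fin n → ℝ)).map (L *ᵥ ·) = ENNReal.ofReal |L.det⁻¹| • volume := by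
      rw [← hvol]; rfl
    rw [this, smul_smul, ← ENNReal.ofReal_mul (abs_nonneg _), ← abs_mul, mul_inv_cancel₀ hL]
    simp
  ext s hs
  rw [Measure.map_apply hm hs, stdGaussianPi_eq_withDensity, withDensity_apply _ (hm hs)]
  unfold gaussianPi
  rw [withDensity_apply _ hs]
  conv_rhs => rw [hvol', Measure.restrict_smul, lintegral_smul_measure,
    setLIntegral_map hs (by
      refine ENNReal.measurable_ofReal.comp ?_
      have := measurable_qForm S⁻¹
      fun_prop) hm]
  rw [smul_eq_mul, ← lintegral_const_mul _ (by
      refine ENNReal.measurable_ofReal.comp ?_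
      have := (measurable_qForm S⁻¹).comp hm
      simp only [Function.comp_def] at this
      fun_prop)]
  refine lintegral_congr fun x => ?_
  rw [← ENNReal.ofReal_mul (abs_nonneg _)]
  congr 1
  have hq : qForm S⁻¹ (L *ᵥ x) = ∑ i, x i ^ 2 := by
    rw [qForm_mulVec, hS, Matrix.mul_inv_rev]
    have : Lᵀ * ((Lᵀ)⁻¹ * L⁻¹) * L = 1 := by
      rw [← Matrix.mul_assoc, Matrix.mul_nonsing_inv _ (by simpa using hu), Matrix.one_mul,
        Matrix.nonsing_inv_mul _ hu]
    rw [this, ← diagonal_one, qForm_diagonal]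
    simp
  have hdet : |L.det| * S.det ^ (-(1 : ℝ) / 2) = 1 := by
    have h0 : 0 < |L.det| := abs_pos.2 hL
    rw [hS, det_mul, det_transpose, ← abs_mul_abs_self, ← pow_two, ← Real.rpow_natCast,
      ← Real.rpow_mul h0.le]
    norm_num
    rw [Real.rpow_neg_one, mul_inv_cancel₀ h0.ne']
  rw [hq]
  simp only [ProbabilityTheory.gaussianPDFReal_def]
  rw [Finset.prod_mul_distrib, Finset.prod_const, ← Real.exp_sum]
  simp only [Finset.card_univ, Fintype.card_fin, sub_zero, NNReal.coe_one, mul_one]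
  have hpi : ((Real.sqrt (2 * Real.pi))⁻¹) ^ n = (2 * Real.pi) ^ (-(n : ℝ) / 2) := by
    rw [Real.sqrt_eq_rpow, ← Real.rpow_neg (by positivity), ← Real.rpow_natCast,
      ← Real.rpow_mul (by positivity)]
    congr 1; ring
  rw [hpi]
  have hs2 : ∑ i, -x i ^ 2 / 2 = -(∑ i, x i ^ 2) / 2 := by
    rw [← Finset.sum_div, Finset.sum_neg_distrib]
  rw [hs2]
  linear_combination -((2 * Real.pi) ^ (-(n : ℝ) / 2) * Real.exp (-(∑ i, x i ^ 2) / 2)) * hdet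

lemma isProbabilityMeasure_gaussianPi {n : ℕ} {S : Matrix (Fin n) (Fin n) ℝ} (hS : S.PosDef) :
    IsProbabilityMeasure (gaussianPi n S) := by
  obtain ⟨L, e, hL, hSL, -⟩ := exists_simultaneous_diagonalization hS
    (M := 0) (by simp [IsHermitian])
  rw [← map_stdGaussianPi hL hSL]
  have hm : Measurable (fun x : Fin n → ℝ => L *ᵥ x) := by
    have : Continuous (fun x : Fin n → ℝ => L *ᵥ x) := by fun_prop
    exact this.measurable
  exact Measure.isProbabilityMeasure_map hm.aemeasurable

lemma integral_sq_gaussianReal : ∫ x, x ^ 2 ∂(ProbabilityTheory.gaussianReal 0 1) = 1 := by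
  have h := ProbabilityTheory.variance_fun_id_gaussianReal (μ := 0) (v := 1)
  rw [ProbabilityTheory.variance_eq_integral (by fun_prop)] at h
  simpa [ProbabilityTheory.integral_id_gaussianReal] using h

lemma integral_pow_four_gaussianReal :
    ∫ x, x ^ 4 ∂(ProbabilityTheory.gaussianReal 0 1) = 3 := by
  rw [ProbabilityTheory.integral_gaussianReal_eq_integral_smul one_ne_zero]
  have h1 : ∀ x : ℝ, ProbabilityTheory.gaussianPDFReal 0 1 x • x ^ 4 =
      (fun y : ℝ => (Real.sqrt (2 * Real.pi))⁻¹ * (y ^ (4 : ℝ) *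
        Real.exp (-(1 / 2) * y ^ (2 : ℝ)))) |x| := by
    intro x
    simp only [ProbabilityTheory.gaussianPDFReal_def, smul_eq_mul]
    have h2 : |x| ^ (4 : ℝ) = x ^ 4 := by
      rw [show (4 : ℝ) = ((4 : ℕ) : ℝ) by norm_num, Real.rpow_natCast]
      exact Even.pow_abs (by decide) x
    have h3 : |x| ^ (2 : ℝ) = x ^ 2 := by
      rw [show (2 : ℝ) = ((2 : ℕ) : ℝ) by norm_num, Real.rpow_natCast]
      exact Even.pow_abs (by decide) x
    rw [h2, h3]
    simp only [NNReal.coe_one, mul_one, sub_zero]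
    rw [show -x ^ 2 / 2 = -(1 / 2) * x ^ 2 by ring]
    ring
  rw [integral_congr_ae (ae_of_all _ h1), integral_comp_abs
    (f := fun y : ℝ => (Real.sqrt (2 * Real.pi))⁻¹ * (y ^ (4 : ℝ) *
        Real.exp (-(1 / 2) * y ^ (2 : ℝ)))), integral_const_mul,
    integral_rpow_mul_exp_neg_mul_rpow (by norm_num) (by norm_num) (by norm_num)]
  have hG : Real.Gamma ((4 + 1) / 2) = 3 * Real.sqrt Real.pi / 4 := by
    have := Real.Gamma_nat_add_half 2
    rw [show ((4 : ℝ) + 1) / 2 = ((2 : ℕ) : ℝ) + 1 / 2 by norm_num, this]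
    norm_num [Nat.doubleFactorial]
  rw [hG]
  have hp : (1 / 2 : ℝ) ^ (-(4 + 1 : ℝ) / 2) = 4 * Real.sqrt 2 := by
    rw [one_div, Real.inv_rpow (by norm_num), ← Real.rpow_neg (by norm_num),
      show -(-(4 + 1 : ℝ) / 2) = 2 + 1 / 2 by norm_num, Real.rpow_add (by norm_num),
      ← Real.sqrt_eq_rpow]
    norm_num
  rw [hp, Real.sqrt_mul (by norm_num)]
  have h2 : Real.sqrt 2 ≠ 0 := by positivity
  have hpi : Real.sqrt Real.pi ≠ 0 := by positivity
  field_simp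

lemma memLp_pow_gaussianReal (k : ℕ) :
    MemLp (fun x : ℝ => x ^ k) 2 (ProbabilityTheory.gaussianReal 0 1) := by
  by_cases hk : k = 0
  · subst hk; simpa using memLp_const (1 : ℝ)
  have h := ProbabilityTheory.memLp_id_gaussianReal (μ := 0) (v := 1) (2 * k : ℕ)
  have h2 : MemLp (fun x : ℝ => ‖id x‖ ^ (k : ENNReal).toReal) ((2 * k : ℕ) / (k : ENNReal))
      (ProbabilityTheory.gaussianReal 0 1) := by
    refine MemLp.norm_rpow_div ?_ _
    simpa using h
  have h3 : (((2 * k : ℕ) : ENNReal) / (k : ENNReal)) = 2 := by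
    push_cast
    exact ENNReal.mul_div_cancel_right (by simpa using hk) (by simp)
  rw [h3] at h2
  rw [← memLp_norm_iff (by fun_prop)]
  refine h2.congr_norm (by fun_prop) (ae_of_all _ fun x => ?_)
  simp

/-- The characteristic function of the standardized square of a standard Gaussian variable. -/
def chiCharFun (t : ℝ) : ℂ :=
  charFun ((ProbabilityTheory.gaussianReal 0 1).map
    fun x => (x ^ 2 - 1) / Real.sqrt 2) t

lemma chiCharFun_taylor :
    (fun t ↦ chiCharFun t - (1 - t ^ 2 / 2)) =o[𝓝 0] fun t : ℝ ↦ t ^ 2 := by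
  have hi2 : Integrable (fun x : ℝ => x ^ 2) (ProbabilityTheory.gaussianReal 0 1) :=
    (memLp_pow_gaussianReal 2).integrable (by norm_num)
  have hi4 : Integrable (fun x : ℝ => x ^ 4) (ProbabilityTheory.gaussianReal 0 1) :=
    (memLp_pow_gaussianReal 4).integrable (by norm_num)
  refine taylor_charFun_two (by fun_prop) ?_ ?_
  · rw [integral_div, integral_sub hi2 (integrable_const _), integral_sq_gaussianReal]
    simp
  · have : ((fun x : ℝ => (x ^ 2 - 1) / Real.sqrt 2) ^ 2) =
        fun x : ℝ => (x ^ 4 - 2 * x ^ 2 + 1) / 2 := by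
      ext x
      simp only [Pi.pow_apply, div_pow]
      rw [Real.sq_sqrt (by norm_num)]
      ring
    have hi : Integrable (fun x : ℝ => x ^ 4 - 2 * x ^ 2)
        (ProbabilityTheory.gaussianReal 0 1) := hi4.sub (hi2.const_mul 2)
    rw [this, integral_div, integral_add hi (integrable_const _),
      integral_sub hi4 (hi2.const_mul 2), integral_const_mul, integral_sq_gaussianReal,
      integral_pow_four_gaussianReal]
    simp; norm_num

lemma norm_prod_sub_prod_le {ι : Type*} (s : Finset ι) (a b : ι → ℂ)
    (ha : ∀ i, ‖a i‖ ≤ 1) (hb : ∀ i, ‖b i‖ ≤ 1) :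
    ‖∏ i ∈ s, a i - ∏ i ∈ s, b i‖ ≤ ∑ i ∈ s, ‖a i - b i‖ := by
  classical
  induction s using Finset.induction_on with
  | empty => simp
  | insert j s hj ih =>
    rw [Finset.prod_insert hj, Finset.prod_insert hj, Finset.sum_insert hj]
    have hB : ‖∏ i ∈ s, b i‖ ≤ 1 := by
      rw [norm_prod]
      exact Finset.prod_le_one (fun i _ => norm_nonneg _) fun i _ => hb i
    calc ‖a j * ∏ i ∈ s, a i - b j * ∏ i ∈ s, b i‖
        = ‖a j * (∏ i ∈ s, a i - ∏ i ∈ s, b i) + (a j - b j) * ∏ i ∈ s, b i‖ := by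
          congr 1; ring
      _ ≤ ‖a j‖ * ‖∏ i ∈ s, a i - ∏ i ∈ s, b i‖ + ‖a j - b j‖ * ‖∏ i ∈ s, b i‖ := by
          rw [← norm_mul, ← norm_mul]; exact norm_add_le _ _
      _ ≤ 1 * ‖∏ i ∈ s, a i - ∏ i ∈ s, b i‖ + ‖a j - b j‖ * 1 := by
          gcongr; exact ha j
      _ ≤ _ := by linarith

/-- A triangular-array limit for products of values of `chiCharFun`. -/
lemma tendsto_prod_chiCharFun (s : (n : ℕ) → Fin n → ℝ) (κ : ℕ → ℝ) (v : ℝ)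
    (hκ : Tendsto κ atTop (𝓝 0)) (hs : ∀ᶠ n in atTop, ∀ i, |s n i| ≤ κ n)
    (hv : Tendsto (fun n => ∑ i, s n i ^ 2) atTop (𝓝 v)) :
    Tendsto (fun n => ∏ i, chiCharFun (s n i)) atTop (𝓝 (Complex.exp (-(v / 2 : ℝ)))) := by
  have hprob : IsProbabilityMeasure ((ProbabilityTheory.gaussianReal 0 1).map
    fun x => (x ^ 2 - 1) / Real.sqrt 2) := Measure.isProbabilityMeasure_map (by fun_prop)
  have h1 : Tendsto (fun n => ∏ i, Complex.exp (-(s n i ^ 2 / 2 : ℝ))) atTop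
      (𝓝 (Complex.exp (-(v / 2 : ℝ)))) := by
    have : ∀ n, ∏ i, Complex.exp (-(s n i ^ 2 / 2 : ℝ)) =
        Complex.exp (-((∑ i, s n i ^ 2) / 2 : ℝ)) := by
      intro n
      rw [← Complex.exp_sum]
      congr 1
      push_cast
      rw [Finset.sum_neg_distrib, Finset.sum_div]
    simp_rw [this]
    refine (Complex.continuous_exp.tendsto _).comp ?_
    exact ((Complex.continuous_ofReal.tendsto _).comp (hv.div_const 2)).neg
  have hexp : (fun t : ℝ => (1 - (t : ℂ) ^ 2 / 2) - Complex.exp (-(t ^ 2 / 2 : ℝ))) =o[𝓝 0]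
      fun t : ℝ => t ^ 2 := by
    have h0 : (fun x : ℝ => Complex.exp (-(x : ℂ)) - (1 - (x : ℂ))) =o[𝓝 0] fun x : ℝ => x := by
      have hd : HasDerivAt (fun x : ℝ => Complex.exp (-(x : ℂ))) (-1) 0 := by
        have := ((Complex.ofRealCLM.hasDerivAt (x := 0)).neg).cexp
        simpa using this
      have := hd.isLittleO
      refine this.congr_left (fun x => ?_) |>.congr_right (fun x => by simp)
      simp; ring
    have ht : Tendsto (fun t : ℝ => t ^ 2 / 2) (𝓝 0) (𝓝 0) := by
      have : Continuous (fun t : ℝ => t ^ 2 / 2) := by fun_prop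
      simpa using this.tendsto 0
    have h2 : (fun t : ℝ => -(Complex.exp (-((t ^ 2 / 2 : ℝ) : ℂ)) -
        (1 - ((t ^ 2 / 2 : ℝ) : ℂ)))) =o[𝓝 0] fun t : ℝ => t ^ 2 / 2 :=
      (h0.comp_tendsto ht).neg_left
    have h3 : (fun t : ℝ => t ^ 2 / 2) =O[𝓝 0] fun t : ℝ => t ^ 2 := by
      refine Asymptotics.IsBigO.of_bound 1 (Eventually.of_forall fun t => ?_)
      rw [Real.norm_of_nonneg (by positivity), Real.norm_of_nonneg (by positivity)]
      nlinarith [sq_nonneg t]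
    refine (h2.trans_isBigO h3).congr_left fun t => ?_
    push_cast; ring
  have hsum := chiCharFun_taylor.add hexp
  rw [tendsto_iff_norm_sub_tendsto_zero] at h1 ⊢
  have hdiff : Tendsto (fun n => ∑ i, ‖chiCharFun (s n i) - Complex.exp (-(s n i ^ 2 / 2 : ℝ))‖)
      atTop (𝓝 0) := by
    rw [Metric.tendsto_atTop']
    intro ε hε
    have hb : ∀ᶠ n in atTop, ∑ i, s n i ^ 2 < |v| + 1 :=
      hv.eventually (gt_mem_nhds (by linarith [le_abs_self v]))
    have hc := hsum.def (show 0 < ε / (2 * (|v| + 1)) by positivity)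
    obtain ⟨δ, hδ, hδ'⟩ := Metric.eventually_nhds_iff.1 hc
    have hκδ : ∀ᶠ n in atTop, κ n < δ := hκ.eventually (gt_mem_nhds hδ)
    obtain ⟨N, hN⟩ := eventually_atTop.1 (hb.and (hκδ.and hs))
    refine ⟨N, fun n hn => ?_⟩
    obtain ⟨hn1, hn2, hn3⟩ := hN n hn.le
    rw [Real.dist_eq, sub_zero, abs_of_nonneg (Finset.sum_nonneg fun i _ => norm_nonneg _)]
    have : ∀ i, ‖chiCharFun (s n i) - Complex.exp (-(s n i ^ 2 / 2 : ℝ))‖ ≤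
        ε / (2 * (|v| + 1)) * s n i ^ 2 := by
      intro i
      have := hδ' (y := s n i) (by
        rw [Real.dist_eq, sub_zero]; exact (hn3 i).trans_lt hn2)
      rw [Real.norm_of_nonneg (sq_nonneg _)] at this
      refine le_trans (le_of_eq ?_) this
      congr 1; ring
    calc _ ≤ ∑ i, ε / (2 * (|v| + 1)) * s n i ^ 2 := Finset.sum_le_sum fun i _ => this i
      _ = ε / (2 * (|v| + 1)) * ∑ i, s n i ^ 2 := by rw [Finset.mul_sum]
      _ ≤ ε / (2 * (|v| + 1)) * (|v| + 1) := by gcongr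
      _ = ε / 2 := by field_simp
      _ < ε := by linarith
  refine squeeze_zero (fun n => norm_nonneg _) (fun n => ?_)
    (by have := hdiff.add h1; rw [add_zero] at this; exact this)
  calc _ ≤ ‖∏ i, chiCharFun (s n i) - ∏ i, Complex.exp (-(s n i ^ 2 / 2 : ℝ))‖ +
        ‖∏ i, Complex.exp (-(s n i ^ 2 / 2 : ℝ)) - Complex.exp (-(v / 2 : ℝ))‖ :=
        norm_sub_le_norm_sub_add_norm_sub _ _ _
    _ ≤ _ := by
        gcongr
        refine norm_prod_sub_prod_le _ (fun i => chiCharFun (s n i))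
          (fun i => Complex.exp (-(s n i ^ 2 / 2 : ℝ))) (fun i => norm_charFun_le_one _) fun i => ?_
        rw [← Complex.ofReal_neg, Complex.norm_exp_ofReal]
        exact Real.exp_le_one_iff.2 (by have := sq_nonneg (s n i); linarith)

/-- The law of a quadratic form of a Gaussian vector. -/
lemma exists_qForm_gaussianPi_law {n : ℕ} {S M : Matrix (Fin n) (Fin n) ℝ}
    (hS : S.PosDef) (hM : M.IsHermitian) :
    ∃ e : Fin n → ℝ, ∑ i, e i = (M * S).trace ∧ ∑ i, e i ^ 2 = (M * S * M * S).trace ∧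
      (∀ κ : ℝ, (∀ x, |qForm (S * M * S) x| ≤ κ * qForm S x) → ∀ i, |e i| ≤ κ) ∧
      (gaussianPi n S).map (qForm M) =
        (stdGaussianPi n).map fun z => ∑ i, e i * z i ^ 2 := by
  obtain ⟨L, e, hL, hSL, hLM⟩ := exists_simultaneous_diagonalization hS hM
  have hu : IsUnit L.det := isUnit_iff_ne_zero.2 hL
  refine ⟨e, ?_, ?_, ?_, ?_⟩
  · rw [← trace_diagonal, ← hLM, hSL, ← Matrix.mul_assoc, Matrix.trace_mul_comm (M * L),
      Matrix.mul_assoc]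
  · have : (diagonal e * diagonal e).trace = ∑ i, e i ^ 2 := by
      rw [diagonal_mul_diagonal, trace_diagonal]
      exact Finset.sum_congr rfl fun i _ => by ring
    rw [← this, ← hLM, hSL]
    calc _ = (Lᵀ * (M * L * Lᵀ * M * L)).trace := by simp only [Matrix.mul_assoc]
      _ = ((M * L * Lᵀ * M * L) * Lᵀ).trace := Matrix.trace_mul_comm _ _
      _ = _ := by simp only [Matrix.mul_assoc]
  · intro κ hκ i
    have h := hκ ((Lᵀ)⁻¹ *ᵥ Pi.single i 1)
    have hLt : IsUnit Lᵀ.det := by simpa using hu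
    have e1 : ((Lᵀ)⁻¹)ᵀ * S * (Lᵀ)⁻¹ = diagonal fun _ => 1 := by
      rw [hSL, diagonal_one]
      have : ((Lᵀ)⁻¹)ᵀ * (L * Lᵀ) * (Lᵀ)⁻¹ = (((Lᵀ)⁻¹)ᵀ * L) * (Lᵀ * (Lᵀ)⁻¹) := by
        simp only [Matrix.mul_assoc]
      rw [this, Matrix.mul_nonsing_inv _ hLt, ← transpose_nonsing_inv, transpose_transpose,
        Matrix.nonsing_inv_mul _ hu, Matrix.mul_one]
    have e2 : ((Lᵀ)⁻¹)ᵀ * (S * M * S) * (Lᵀ)⁻¹ = diagonal e := by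
      rw [hSL, ← hLM]
      have : ((Lᵀ)⁻¹)ᵀ * (L * Lᵀ * M * (L * Lᵀ)) * (Lᵀ)⁻¹ =
          (((Lᵀ)⁻¹)ᵀ * L) * (Lᵀ * M * L) * (Lᵀ * (Lᵀ)⁻¹) := by
        simp only [Matrix.mul_assoc]
      rw [this, Matrix.mul_nonsing_inv _ hLt, ← transpose_nonsing_inv, transpose_transpose,
        Matrix.nonsing_inv_mul _ hu, Matrix.mul_one, Matrix.one_mul]
    rw [qForm_mulVec, qForm_mulVec, e1, e2, qForm_diagonal, qForm_diagonal] at h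
    simpa [Pi.single_apply] using h
  · have hm : Measurable (fun x : Fin n → ℝ => L *ᵥ x) := by
      have : Continuous (fun x : Fin n → ℝ => L *ᵥ x) := by fun_prop
      exact this.measurable
    rw [← map_stdGaussianPi hL hSL, Measure.map_map (measurable_qForm M) hm]
    congr 1
    ext z
    rw [Function.comp, qForm_mulVec, hLM, qForm_diagonal]

/-- Chebyshev's inequality for a quadratic form of a Gaussian vector. -/
lemma gaussianPi_qForm_chebyshev {n : ℕ} {S M : Matrix (Fin n) (Fin n) ℝ}
    (hS : S.PosDef) (hM : M.IsHermitian) {ε : ℝ} (hε : 0 < ε) :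
    gaussianPi n S {x | ε ≤ |qForm M x - (M * S).trace|} ≤
      ENNReal.ofReal (2 * (M * S * M * S).trace / ε ^ 2) := by
  obtain ⟨e, h1, h2, -, h4⟩ := exists_qForm_gaussianPi_law hS hM
  set X : Fin n → ℝ → ℝ := fun i z => e i * z ^ 2
  have hX : ∀ i, MemLp (X i) 2 (ProbabilityTheory.gaussianReal 0 1) :=
    fun i => (memLp_pow_gaussianReal 2).const_mul _
  have hi2 : Integrable (fun x : ℝ => x ^ 2) (ProbabilityTheory.gaussianReal 0 1) :=
    (memLp_pow_gaussianReal 2).integrable (by norm_num)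
  have hvar := ProbabilityTheory.variance_sum_pi hX
  have hXe : ∀ i, MemLp (fun ω : Fin n → ℝ => X i (ω i)) 2 (stdGaussianPi n) := fun i =>
    (hX i).comp_measurePreserving (measurePreserving_eval _ i)
  have hsum : MemLp (∑ i, fun ω : Fin n → ℝ => X i (ω i)) 2 (stdGaussianPi n) :=
    memLp_finsetSum' _ fun i _ => hXe i
  have hfun : (∑ i, fun ω : Fin n → ℝ => X i (ω i)) = fun z => ∑ i, e i * z i ^ 2 := by
    ext z; simp [X]
  have hmean : ∫ z, (∑ i, fun ω : Fin n → ℝ => X i (ω i)) z ∂(stdGaussianPi n) =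
      (M * S).trace := by
    rw [← h1, hfun, integral_finsetSum _ fun i _ => (hXe i).integrable (by norm_num)]
    refine Finset.sum_congr rfl fun i _ => ?_
    have := (measurePreserving_eval (fun _ : Fin n => ProbabilityTheory.gaussianReal 0 1) i).map_eq
    have h5 : ∫ z : Fin n → ℝ, X i (z i) ∂(stdGaussianPi n) =
        ∫ y, X i y ∂(ProbabilityTheory.gaussianReal 0 1) := by
      conv_rhs => rw [← this]
      rw [integral_map (measurable_pi_apply i).aemeasurable (by fun_prop)]
      rfl
    refine h5.trans ?_
    simp only [X]
    rw [integral_const_mul, integral_sq_gaussianReal, mul_one]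
  have hvar2 : ∀ i, ProbabilityTheory.variance (X i) (ProbabilityTheory.gaussianReal 0 1) =
      2 * e i ^ 2 := by
    intro i
    simp only [X]
    rw [ProbabilityTheory.variance_const_mul,
      ProbabilityTheory.variance_eq_sub (memLp_pow_gaussianReal 2)]
    have : ((fun x : ℝ => x ^ 2) ^ 2) = fun x : ℝ => x ^ 4 := by ext x; simp; ring
    rw [this, integral_sq_gaussianReal, integral_pow_four_gaussianReal]
    ring
  have hch := ProbabilityTheory.meas_ge_le_variance_div_sq hsum hε
  rw [hmean] at hch
  have hv : ProbabilityTheory.variance (∑ i, fun ω : Fin n → ℝ => X i (ω i)) (stdGaussianPi n)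
      = 2 * (M * S * M * S).trace := by
    rw [← h2, Finset.mul_sum]
    exact hvar.trans (Finset.sum_congr rfl fun i _ => hvar2 i)
  rw [hv] at hch
  have hms : MeasurableSet {y : ℝ | ε ≤ |y - (M * S).trace|} :=
    measurableSet_le measurable_const (by fun_prop)
  have e1 : gaussianPi n S {x | ε ≤ |qForm M x - (M * S).trace|} =
      (gaussianPi n S).map (qForm M) {y : ℝ | ε ≤ |y - (M * S).trace|} := by
    rw [Measure.map_apply (measurable_qForm M) hms]; rfl
  rw [e1, h4, Measure.map_apply (by fun_prop) hms]
  rw [hfun] at hch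
  exact hch

/-- A central limit theorem for quadratic forms of Gaussian vectors. -/
lemma tendstoInLaw_qForm_gaussianPi {S M : (n : ℕ) → Matrix (Fin n) (Fin n) ℝ}
    (hS : ∀ n, (S n).PosDef) (hM : ∀ n, (M n).IsHermitian) {κ : ℕ → ℝ} {v : ℝ} (hv0 : 0 ≤ v)
    (hκ : Tendsto κ atTop (𝓝 0))
    (hb : ∀ᶠ n in atTop, ∀ x, |qForm (S n * M n * S n) x| ≤ κ n * qForm (S n) x)
    (hv : Tendsto (fun n => 2 * (M n * S n * M n * S n).trace) atTop (𝓝 v)) :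
    TendstoInLaw (fun n => (gaussianPi n (S n)).map
      fun x => qForm (M n) x - (M n * S n).trace)
      (ProbabilityTheory.gaussianReal 0 v.toNNReal) := by
  choose e h1 h2 h3 h4 using fun n => exists_qForm_gaussianPi_law (hS n) (hM n)
  have hP : ∀ n, IsProbabilityMeasure (gaussianPi n (S n)) :=
    fun n => isProbabilityMeasure_gaussianPi (hS n)
  have hmq : ∀ n, Measurable fun x => qForm (M n) x - (M n * S n).trace := fun n =>
    (measurable_qForm _).sub_const _
  have hP' : ∀ n, IsProbabilityMeasure ((gaussianPi n (S n)).map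
      fun x => qForm (M n) x - (M n * S n).trace) :=
    fun n => Measure.isProbabilityMeasure_map (hmq n).aemeasurable
  let μ : ℕ → ProbabilityMeasure ℝ := fun n => ⟨_, hP' n⟩
  let ν : ProbabilityMeasure ℝ := ⟨ProbabilityTheory.gaussianReal 0 v.toNNReal, inferInstance⟩
  suffices h : Tendsto μ atTop (𝓝 ν) from
    fun g => (ProbabilityMeasure.tendsto_iff_forall_integral_tendsto.1 h) g
  refine ProbabilityMeasure.tendsto_of_tendsto_charFun fun t => ?_
  have hlaw : ∀ n, (gaussianPi n (S n)).map (fun x => qForm (M n) x - (M n * S n).trace) =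
      (Measure.pi fun i => (ProbabilityTheory.gaussianReal 0 1).map
        fun x => (Real.sqrt 2 * e n i) * ((x ^ 2 - 1) / Real.sqrt 2)).map fun p => ∑ i, p i := by
    intro n
    have hpr : ∀ i, IsProbabilityMeasure ((ProbabilityTheory.gaussianReal 0 1).map
        fun x => (Real.sqrt 2 * e n i) * ((x ^ 2 - 1) / Real.sqrt 2)) :=
      fun i => Measure.isProbabilityMeasure_map (by fun_prop)
    have : (fun x => qForm (M n) x - (M n * S n).trace) =
        (fun y => y - (M n * S n).trace) ∘ qForm (M n) := rfl
    rw [this, ← Measure.map_map (by fun_prop) (measurable_qForm _), h4,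
      ← Measure.pi_map_pi (by fun_prop), Measure.map_map (by fun_prop) (by fun_prop),
      Measure.map_map (by fun_prop) (by fun_prop)]
    unfold stdGaussianPi
    congr 1
    ext z
    simp only [Function.comp]
    rw [← h1, ← Finset.sum_sub_distrib]
    refine Finset.sum_congr rfl fun i _ => ?_
    have : Real.sqrt 2 ≠ 0 := by positivity
    field_simp
  have hcf : ∀ n, charFun (μ n : Measure ℝ) t = ∏ i, chiCharFun (Real.sqrt 2 * e n i * t) := by
    intro n
    have hpr : ∀ i, IsProbabilityMeasure ((ProbabilityTheory.gaussianReal 0 1).map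
        fun x => (Real.sqrt 2 * e n i) * ((x ^ 2 - 1) / Real.sqrt 2)) :=
      fun i => Measure.isProbabilityMeasure_map (by fun_prop)
    change charFun ((gaussianPi n (S n)).map
      (fun x => qForm (M n) x - (M n * S n).trace)) t = _
    rw [hlaw, ProbabilityTheory.charFun_map_sum_pi_eq_prod, Finset.prod_apply]
    refine Finset.prod_congr rfl fun i _ => ?_
    rw [charFun_map_mul_comp (by fun_prop)]
    rfl
  simp_rw [hcf]
  have hgoal : charFun (ν : Measure ℝ) t = Complex.exp (-((v * t ^ 2) / 2 : ℝ)) := by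
    change charFun (ProbabilityTheory.gaussianReal 0 v.toNNReal) t = _
    rw [ProbabilityTheory.charFun_gaussianReal]
    congr 1
    simp [Real.coe_toNNReal _ hv0]
  rw [hgoal]
  refine tendsto_prod_chiCharFun _ (fun n => Real.sqrt 2 * κ n * |t|) _ ?_ ?_ ?_
  · simpa using (hκ.const_mul (Real.sqrt 2)).mul_const |t|
  · filter_upwards [hb] with n hn i
    rw [abs_mul, abs_mul, abs_of_nonneg (Real.sqrt_nonneg 2)]
    gcongr
    exact h3 n _ hn i
  · refine (hv.mul_const (t ^ 2)).congr fun n => ?_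
    rw [← h2, Finset.mul_sum, Finset.sum_mul]
    refine Finset.sum_congr rfl fun i _ => ?_
    rw [mul_pow, mul_pow, Real.sq_sqrt (by norm_num)]

/-- The bilinear form `tr(S⁻¹ X S⁻¹ Y)`. -/
def covInner {n : ℕ} (S X Y : Matrix (Fin n) (Fin n) ℝ) : ℝ := (S⁻¹ * X * S⁻¹ * Y).trace

section covInner
variable {n : ℕ} {S X Y Z : Matrix (Fin n) (Fin n) ℝ}

lemma covInner_comm : covInner S X Y = covInner S Y X := by
  unfold covInner
  calc _ = ((S⁻¹ * X) * (S⁻¹ * Y)).trace := by simp only [Matrix.mul_assoc]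
    _ = ((S⁻¹ * Y) * (S⁻¹ * X)).trace := Matrix.trace_mul_comm _ _
    _ = _ := by simp only [Matrix.mul_assoc]

lemma covInner_add_left : covInner S (X + Y) Z = covInner S X Z + covInner S Y Z := by
  simp [covInner, Matrix.mul_add, Matrix.add_mul]

lemma covInner_add_right : covInner S Z (X + Y) = covInner S Z X + covInner S Z Y := by
  simp [covInner, Matrix.mul_add]

lemma covInner_smul_left (c : ℝ) : covInner S (c • X) Y = c * covInner S X Y := by
  simp [covInner]

lemma covInner_smul_right (c : ℝ) : covInner S X (c • Y) = c * covInner S X Y := by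
  simp [covInner]

lemma covInner_sum_left {ι : Type*} (s : Finset ι) (X : ι → Matrix (Fin n) (Fin n) ℝ) :
    covInner S (∑ i ∈ s, X i) Y = ∑ i ∈ s, covInner S (X i) Y := by
  simp [covInner, Finset.mul_sum, Finset.sum_mul, Matrix.trace_sum]

lemma covInner_sum_right {ι : Type*} (s : Finset ι) (Y : ι → Matrix (Fin n) (Fin n) ℝ) :
    covInner S X (∑ i ∈ s, Y i) = ∑ i ∈ s, covInner S X (Y i) := by
  simp [covInner, Finset.mul_sum, Matrix.trace_sum]

lemma covInner_congr {L A B : Matrix (Fin n) (Fin n) ℝ} (hL : L.det ≠ 0) :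
    covInner (L * Lᵀ) (L * A * Lᵀ) (L * B * Lᵀ) = (A * B).trace := by
  have hu : IsUnit L.det := isUnit_iff_ne_zero.2 hL
  have hut : IsUnit Lᵀ.det := by simpa using hu
  unfold covInner
  rw [Matrix.mul_inv_rev]
  have : Lᵀ⁻¹ * L⁻¹ * (L * A * Lᵀ) * (Lᵀ⁻¹ * L⁻¹) * (L * B * Lᵀ) =
      Lᵀ⁻¹ * ((L⁻¹ * L) * A * (Lᵀ * Lᵀ⁻¹) * (L⁻¹ * L) * B * Lᵀ) := by
    simp only [Matrix.mul_assoc]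
  rw [this, Matrix.nonsing_inv_mul _ hu, Matrix.mul_nonsing_inv _ hut, Matrix.trace_mul_comm]
  simp only [Matrix.one_mul, Matrix.mul_one, Matrix.mul_assoc]
  rw [Matrix.mul_nonsing_inv _ hut, Matrix.mul_one]

lemma exists_relative_diagonalization (hS : S.PosDef) (hX : X.IsHermitian) :
    ∃ (L : Matrix (Fin n) (Fin n) ℝ) (e : Fin n → ℝ), L.det ≠ 0 ∧ S = L * Lᵀ ∧
      X = L * diagonal e * Lᵀ ∧
      ∀ κ, (∀ x, |qForm X x| ≤ κ * qForm S x) → ∀ i, |e i| ≤ κ := by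
  have hSu : IsUnit S.det := isUnit_iff_ne_zero.2 hS.det_pos.ne'
  have hM : (S⁻¹ * X * S⁻¹).IsHermitian := by
    have := isHermitian_conjTranspose_mul_mul S⁻¹ hX
    rwa [hS.isHermitian.inv.eq] at this
  obtain ⟨L, e, hL, hSL, hLM⟩ := exists_simultaneous_diagonalization hS hM
  have hu : IsUnit L.det := isUnit_iff_ne_zero.2 hL
  have hut : IsUnit Lᵀ.det := by simpa using hu
  have hXe : X = L * diagonal e * Lᵀ := by
    rw [← hLM]
    have : L * (Lᵀ * (S⁻¹ * X * S⁻¹) * L) * Lᵀ = (L * Lᵀ) * S⁻¹ * X * (S⁻¹ * (L * Lᵀ)) := by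
      simp only [Matrix.mul_assoc]
    rw [this, ← hSL, Matrix.mul_nonsing_inv _ hSu, Matrix.nonsing_inv_mul _ hSu,
      Matrix.one_mul, Matrix.mul_one]
  refine ⟨L, e, hL, hSL, hXe, fun κ hκ i => ?_⟩
  have h := hκ ((Lᵀ)⁻¹ *ᵥ Pi.single i 1)
  have key : ∀ A : Matrix (Fin n) (Fin n) ℝ, ((Lᵀ)⁻¹)ᵀ * (L * A * Lᵀ) * (Lᵀ)⁻¹ = A := by
    intro A
    have : ((Lᵀ)⁻¹)ᵀ * (L * A * Lᵀ) * (Lᵀ)⁻¹ = (((Lᵀ)⁻¹)ᵀ * L) * A * (Lᵀ * (Lᵀ)⁻¹) := by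
      simp only [Matrix.mul_assoc]
    rw [this, Matrix.mul_nonsing_inv _ hut, ← transpose_nonsing_inv, transpose_transpose,
      Matrix.nonsing_inv_mul _ hu, Matrix.mul_one, Matrix.one_mul]
  rw [qForm_mulVec, qForm_mulVec, hXe, key, hSL, show L * Lᵀ = L * (diagonal fun _ => 1) * Lᵀ by
    rw [diagonal_one, Matrix.mul_one], key, qForm_diagonal, qForm_diagonal] at h
  simpa [Pi.single_apply] using h

lemma covInner_self_nonneg (hS : S.PosDef) (hX : X.IsHermitian) : 0 ≤ covInner S X X := by
  obtain ⟨L, e, hL, hSL, hXe, -⟩ := exists_relative_diagonalization hS hX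
  rw [hXe, hSL, covInner_congr hL, diagonal_mul_diagonal, trace_diagonal]
  exact Finset.sum_nonneg fun i _ => mul_self_nonneg _

lemma covInner_self_le (hS : S.PosDef) (hX : X.IsHermitian) {κ : ℝ}
    (h : ∀ x, |qForm X x| ≤ κ * qForm S x) : covInner S X X ≤ n * κ ^ 2 := by
  obtain ⟨L, e, hL, hSL, hXe, he⟩ := exists_relative_diagonalization hS hX
  have he := he κ h
  rw [hXe, hSL, covInner_congr hL, diagonal_mul_diagonal, trace_diagonal]
  calc ∑ i, e i * e i ≤ ∑ _i : Fin n, κ ^ 2 := Finset.sum_le_sum fun i _ => by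
        have := he i
        have h0 := abs_nonneg (e i)
        rw [← abs_mul_abs_self]; nlinarith
    _ = n * κ ^ 2 := by simp

lemma covInner_sq_le (hS : S.PosDef) (hX : X.IsHermitian) (hY : Y.IsHermitian) :
    covInner S X Y ^ 2 ≤ covInner S X X * covInner S Y Y := by
  have h : ∀ t : ℝ, 0 ≤ covInner S Y Y * (t * t) + 2 * covInner S X Y * t + covInner S X X := by
    intro t
    have hsm : (t • Y).IsHermitian := by
      have := hY.eq
      rw [Matrix.IsHermitian, Matrix.conjTranspose_smul, this]; simp
    have := covInner_self_nonneg hS (hX.add hsm)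
    rw [covInner_add_left, covInner_add_right, covInner_add_right, covInner_smul_left,
      covInner_smul_left, covInner_smul_right, covInner_smul_right,
      covInner_comm (X := Y) (Y := X)] at this
    linarith
  have := discrim_le_zero h
  unfold discrim at this
  linarith

lemma covInner_add_self_le (hS : S.PosDef) (hX : X.IsHermitian) (hY : Y.IsHermitian) {τ : ℝ}
    (hτ : 0 < τ) :
    covInner S (X + Y) (X + Y) ≤ (1 + τ) * covInner S X X + (1 + τ⁻¹) * covInner S Y Y := by
  have h := covInner_sq_le hS hX hY
  have hx := covInner_self_nonneg hS hX
  have hy := covInner_self_nonneg hS hY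
  rw [covInner_add_left, covInner_add_right, covInner_add_right,
    covInner_comm (X := Y) (Y := X)]
  have h2 : 2 * covInner S X Y ≤ τ * covInner S X X + τ⁻¹ * covInner S Y Y := by
    refine abs_le_of_sq_le_sq' ?_ (by positivity) |>.2
    have e : τ * τ⁻¹ = 1 := mul_inv_cancel₀ hτ.ne'
    have : (τ * covInner S X X + τ⁻¹ * covInner S Y Y) ^ 2 =
        (τ * covInner S X X - τ⁻¹ * covInner S Y Y) ^ 2 +
          4 * (τ * τ⁻¹) * (covInner S X X * covInner S Y Y) := by ring
    rw [this, e]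
    nlinarith [sq_nonneg (τ * covInner S X X - τ⁻¹ * covInner S Y Y)]
  linarith

end covInner

lemma abs_div_one_add_sub_log_le {δ η : ℝ} (h : |δ| ≤ η) (hη : η ≤ 1 / 2) :
    |δ / (1 + δ) - Real.log (1 + δ) + δ ^ 2 / 2| ≤ 4 * η * δ ^ 2 := by
  have hlt : |(-δ)| < 1 := by rw [abs_neg]; linarith
  have h1 := Real.abs_log_sub_add_sum_range_le hlt 2
  simp only [Finset.sum_range_succ, Finset.sum_range_zero, abs_neg] at h1
  norm_num at h1
  have hpos : 0 < 1 + δ := by have := neg_abs_le δ; linarith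
  have h2 : δ / (1 + δ) - δ + δ ^ 2 = δ ^ 3 / (1 + δ) := by field_simp; ring
  have h3 : |δ ^ 3 / (1 + δ)| ≤ 2 * |δ| ^ 3 := by
    rw [abs_div, abs_pow, abs_of_pos hpos, div_le_iff₀ hpos]
    have := pow_nonneg (abs_nonneg δ) 3
    have := neg_abs_le δ
    nlinarith
  have h4 : |δ| ^ 3 / (1 - |δ|) ≤ 2 * |δ| ^ 3 := by
    rw [div_le_iff₀ (by linarith)]
    have := pow_nonneg (abs_nonneg δ) 3
    nlinarith
  have h5 : |δ| ^ 3 ≤ η * δ ^ 2 := by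
    rw [show |δ| ^ 3 = |δ| * |δ| ^ 2 by ring, sq_abs]
    gcongr
  have h6 : δ / (1 + δ) - Real.log (1 + δ) + δ ^ 2 / 2 =
      δ ^ 3 / (1 + δ) - (-δ + δ ^ 2 / 2 + Real.log (1 + δ)) := by rw [← h2]; ring
  rw [h6]
  refine (abs_sub _ _).trans ?_
  linarith

/-- Deterministic expansion of the determinant and of the inverse of a perturbed covariance
matrix. -/
lemma covariance_perturbation {n : ℕ} {S S' C : Matrix (Fin n) (Fin n) ℝ} {η : ℝ}
    (hS : S.PosDef) (hS' : S'.IsHermitian) (hC : C.IsHermitian) (hη : η ≤ 1 / 2)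
    (h : ∀ x, |qForm (S' - S) x| ≤ η * qForm S x) :
    ∃ M : Matrix (Fin n) (Fin n) ℝ, M.IsHermitian ∧ 0 < S'.det ∧
      S⁻¹ - S'⁻¹ = S⁻¹ * C * S⁻¹ + M ∧
      (M * S * M * S).trace ≤ 2 * covInner S (S' - S - C) (S' - S - C) +
        8 * η ^ 2 * covInner S (S' - S) (S' - S) ∧
      |((S⁻¹ - S'⁻¹) * S).trace - (Real.log S'.det - Real.log S.det) +
        covInner S (S' - S) (S' - S) / 2| ≤ 4 * η * covInner S (S' - S) (S' - S) := by
  obtain ⟨L, δ, hL, hSL, hX, hδ⟩ := exists_relative_diagonalization hS (hS'.sub hS.isHermitian)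
  have hδ := hδ η h
  have hu : IsUnit L.det := isUnit_iff_ne_zero.2 hL
  have hut : IsUnit Lᵀ.det := by simpa using hu
  have hSu : IsUnit S.det := isUnit_iff_ne_zero.2 hS.det_pos.ne'
  have hpos : ∀ i, 0 < 1 + δ i := fun i => by
    have := neg_abs_le (δ i); have := hδ i; linarith
  have hS'L : S' = L * diagonal (fun i => 1 + δ i) * Lᵀ := by
    have : diagonal (fun i => 1 + δ i) = 1 + diagonal δ := by
      rw [← diagonal_one, diagonal_add]
    rw [this, Matrix.mul_add, Matrix.add_mul, Matrix.mul_one, ← hSL, ← hX]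
    abel
  have hdet : S'.det = S.det * ∏ i, (1 + δ i) := by
    rw [hS'L, hSL, det_mul, det_mul, det_mul, det_diagonal]; ring
  have hdet' : 0 < S'.det := by
    rw [hdet]; exact mul_pos hS.det_pos (Finset.prod_pos fun i _ => hpos i)
  have hS'u : IsUnit S'.det := isUnit_iff_ne_zero.2 hdet'.ne'
  have hD : S * (S⁻¹ - S'⁻¹) * S = L * diagonal (fun i => δ i / (1 + δ i)) * Lᵀ := by
    have hinv : S'⁻¹ = Lᵀ⁻¹ * diagonal (fun i => (1 + δ i)⁻¹) * L⁻¹ := by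
      refine Matrix.inv_eq_left_inv ?_
      rw [hS'L]
      have : Lᵀ⁻¹ * diagonal (fun i => (1 + δ i)⁻¹) * L⁻¹ *
          (L * diagonal (fun i => 1 + δ i) * Lᵀ) = Lᵀ⁻¹ * (diagonal (fun i => (1 + δ i)⁻¹) *
            ((L⁻¹ * L) * diagonal (fun i => 1 + δ i))) * Lᵀ := by
        simp only [Matrix.mul_assoc]
      rw [this, Matrix.nonsing_inv_mul _ hu, Matrix.one_mul, diagonal_mul_diagonal]
      have : (fun i => (1 + δ i)⁻¹ * (1 + δ i)) = fun _ => 1 := by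
        ext i; exact inv_mul_cancel₀ (hpos i).ne'
      rw [this, diagonal_one, Matrix.mul_one, Matrix.nonsing_inv_mul _ hut]
    have h1 : S * S'⁻¹ * S = L * diagonal (fun i => (1 + δ i)⁻¹) * Lᵀ := by
      rw [hinv, hSL]
      have : L * Lᵀ * (Lᵀ⁻¹ * diagonal (fun i => (1 + δ i)⁻¹) * L⁻¹) * (L * Lᵀ) =
          L * (Lᵀ * Lᵀ⁻¹) * diagonal (fun i => (1 + δ i)⁻¹) * (L⁻¹ * L) * Lᵀ := by
        simp only [Matrix.mul_assoc]
      rw [this, Matrix.nonsing_inv_mul _ hu, Matrix.mul_nonsing_inv _ hut, Matrix.mul_one,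
        Matrix.mul_one]
    have h2 : diagonal (fun i => δ i / (1 + δ i)) = 1 - diagonal (fun i => (1 + δ i)⁻¹) := by
      rw [← diagonal_one, diagonal_sub]
      congr 1; ext i
      have := (hpos i).ne'
      field_simp; ring
    rw [Matrix.mul_sub, Matrix.sub_mul, Matrix.mul_nonsing_inv _ hSu, Matrix.one_mul, h1, h2,
      Matrix.mul_sub, Matrix.sub_mul, Matrix.mul_one, ← hSL]
  have hqe : covInner S (S' - S) (S' - S) = ∑ i, δ i ^ 2 := by
    rw [hX, hSL, covInner_congr hL, diagonal_mul_diagonal, trace_diagonal]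
    exact Finset.sum_congr rfl fun i _ => (sq _).symm
  set M := S⁻¹ - S'⁻¹ - S⁻¹ * C * S⁻¹ with hMdef
  have hM : M.IsHermitian := by
    refine (hS.isHermitian.inv.sub hS'.inv).sub ?_
    have := isHermitian_conjTranspose_mul_mul S⁻¹ hC
    rwa [hS.isHermitian.inv.eq] at this
  refine ⟨M, hM, hdet', by rw [hMdef]; abel, ?_, ?_⟩
  · have e1 : (M * S * M * S).trace = covInner S (S * M * S) (S * M * S) := by
      unfold covInner
      have : S⁻¹ * (S * M * S) * S⁻¹ * (S * M * S) =
          (S⁻¹ * S) * M * (S * S⁻¹) * S * M * S := by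
        simp only [Matrix.mul_assoc]
      rw [this, Matrix.nonsing_inv_mul _ hSu, Matrix.mul_nonsing_inv _ hSu, Matrix.one_mul,
        Matrix.mul_one]
    have e2 : S * M * S = (S' - S - C) +
        L * diagonal (fun i => -(δ i ^ 2 / (1 + δ i))) * Lᵀ := by
      have e3 : S * (S⁻¹ * C * S⁻¹) * S = C := by
        have : S * (S⁻¹ * C * S⁻¹) * S = (S * S⁻¹) * C * (S⁻¹ * S) := by
          simp only [Matrix.mul_assoc]
        rw [this, Matrix.nonsing_inv_mul _ hSu, Matrix.mul_nonsing_inv _ hSu, Matrix.one_mul,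
          Matrix.mul_one]
      have e4 : diagonal (fun i => δ i / (1 + δ i)) =
          diagonal δ + diagonal (fun i => -(δ i ^ 2 / (1 + δ i))) := by
        rw [diagonal_add]
        congr 1; ext i
        have := (hpos i).ne'
        field_simp; ring
      rw [hMdef, Matrix.mul_sub, Matrix.sub_mul, hD, e3, e4, Matrix.mul_add, Matrix.add_mul, hX]
      abel
    have hH : (L * diagonal (fun i => -(δ i ^ 2 / (1 + δ i))) * Lᵀ).IsHermitian := by
      have := isHermitian_mul_mul_conjTranspose L
        (Matrix.isHermitian_diagonal (fun i => -(δ i ^ 2 / (1 + δ i))))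
      simpa [conjTranspose_eq_transpose_of_trivial] using this
    rw [e1, e2]
    refine (covInner_add_self_le hS ((hS'.sub hS.isHermitian).sub hC) hH one_pos).trans ?_
    have e5 : covInner S (L * diagonal (fun i => -(δ i ^ 2 / (1 + δ i))) * Lᵀ)
        (L * diagonal (fun i => -(δ i ^ 2 / (1 + δ i))) * Lᵀ) ≤
        4 * η ^ 2 * covInner S (S' - S) (S' - S) := by
      rw [hqe, Finset.mul_sum, hSL, covInner_congr hL, diagonal_mul_diagonal, trace_diagonal]
      refine Finset.sum_le_sum fun i _ => ?_
      have h1 := hδ i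
      have h2 : 1 / 2 ≤ 1 + δ i := by have := neg_abs_le (δ i); linarith
      have h3 : δ i ^ 2 / (1 + δ i) ≤ 2 * δ i ^ 2 := by
        rw [div_le_iff₀ (hpos i)]; nlinarith [sq_nonneg (δ i)]
      have h4 : 0 ≤ δ i ^ 2 / (1 + δ i) := div_nonneg (sq_nonneg _) (hpos i).le
      have h5 : δ i ^ 2 ≤ η ^ 2 := by
        rw [← sq_abs (δ i)]; gcongr
      calc _ = (δ i ^ 2 / (1 + δ i)) * (δ i ^ 2 / (1 + δ i)) := by ring
        _ ≤ (2 * δ i ^ 2) * (2 * δ i ^ 2) := by gcongr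
        _ = 4 * δ i ^ 2 * δ i ^ 2 := by ring
        _ ≤ _ := by gcongr
    linarith
  · have e1 : ((S⁻¹ - S'⁻¹) * S).trace = ∑ i, δ i / (1 + δ i) := by
      have : ((S⁻¹ - S'⁻¹) * S).trace = covInner S (S * (S⁻¹ - S'⁻¹) * S) S := by
        unfold covInner
        have : S⁻¹ * (S * (S⁻¹ - S'⁻¹) * S) * S⁻¹ * S =
          (S⁻¹ * S) * (S⁻¹ - S'⁻¹) * S * (S⁻¹ * S) := by
          simp only [Matrix.mul_assoc]
        rw [this, Matrix.nonsing_inv_mul _ hSu, Matrix.one_mul, Matrix.mul_one]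
      rw [this, hD]
      rw [hSL]
      have := covInner_congr (A := diagonal (fun i => δ i / (1 + δ i))) (B := 1) hL
      rw [Matrix.mul_one, Matrix.mul_one, trace_diagonal] at this
      exact this
    rw [e1, hdet, Real.log_mul hS.det_pos.ne' (Finset.prod_pos fun i _ => hpos i).ne',
      Real.log_prod fun i _ => (hpos i).ne', hqe]
    have : ∑ i, δ i / (1 + δ i) - (Real.log S.det + ∑ i, Real.log (1 + δ i) - Real.log S.det) +
        (∑ i, δ i ^ 2) / 2 = ∑ i, (δ i / (1 + δ i) - Real.log (1 + δ i) + δ i ^ 2 / 2) := by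
      rw [Finset.sum_add_distrib, Finset.sum_sub_distrib, Finset.sum_div]; ring
    rw [this, Finset.mul_sum]
    exact (Finset.abs_sum_le_sum_abs _ _).trans
      (Finset.sum_le_sum fun i _ => abs_div_one_add_sub_log_le (hδ i) hη)

lemma qForm_add {n : ℕ} (A B : Matrix (Fin n) (Fin n) ℝ) (x : Fin n → ℝ) :
    qForm (A + B) x = qForm A x + qForm B x := by
  simp [qForm, mul_add, add_mul, Finset.sum_add_distrib]

lemma qForm_smul {n : ℕ} (c : ℝ) (A : Matrix (Fin n) (Fin n) ℝ) (x : Fin n → ℝ) :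
    qForm (c • A) x = c * qForm A x := by
  simp only [qForm, Finset.mul_sum, Matrix.smul_apply, smul_eq_mul]
  exact Finset.sum_congr rfl fun i _ => Finset.sum_congr rfl fun j _ => by ring

lemma qForm_sub {n : ℕ} (A B : Matrix (Fin n) (Fin n) ℝ) (x : Fin n → ℝ) :
    qForm (A - B) x = qForm A x - qForm B x := by
  simp [qForm, mul_sub, sub_mul, Finset.sum_sub_distrib]

lemma qForm_sum {n : ℕ} {ι : Type*} (s : Finset ι) (A : ι → Matrix (Fin n) (Fin n) ℝ)
    (x : Fin n → ℝ) : qForm (∑ i ∈ s, A i) x = ∑ i ∈ s, qForm (A i) x := by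
  classical
  induction s using Finset.induction_on with
  | empty => simp [qForm]
  | insert j s hj ih => rw [Finset.sum_insert hj, Finset.sum_insert hj, qForm_add, ih]

lemma gaussianPi_eq_withDensity {n : ℕ} {S S' : Matrix (Fin n) (Fin n) ℝ} (hS : 0 < S.det)
    (hS' : 0 < S'.det) :
    gaussianPi n S' = (gaussianPi n S).withDensity fun x => ENNReal.ofReal (Real.exp
      ((qForm (S⁻¹ - S'⁻¹) x - (Real.log S'.det - Real.log S.det)) / 2)) := by
  unfold gaussianPi
  rw [← withDensity_mul]
  · congr 1
    ext x
    rw [Pi.mul_apply, ← ENNReal.ofReal_mul (by positivity)]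
    congr 1
    rw [qForm_sub, mul_assoc, mul_assoc, mul_assoc]
    congr 1
    rw [Real.rpow_def_of_pos hS, Real.rpow_def_of_pos hS', ← Real.exp_add, ← Real.exp_add,
      ← Real.exp_add]
    congr 1; ring
  · have := measurable_qForm S⁻¹
    fun_prop
  · have := measurable_qForm (S⁻¹ - S'⁻¹)
    fun_prop

/-- Local asymptotic normality of a Gaussian family from a first-order expansion of its
covariance matrices. -/
lemma lanExpansion_gaussianPi {d : ℕ} {P : (n : ℕ) → (Fin d → ℝ) → Measure (Fin n → ℝ)}
    {θ₀ : Fin d → ℝ} {φ : ℕ → Matrix (Fin d) (Fin d) ℝ} {I : Matrix (Fin d) (Fin d) ℝ}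
    {S : (n : ℕ) → Matrix (Fin n) (Fin n) ℝ} {G : (n : ℕ) → Fin d → Matrix (Fin n) (Fin n) ℝ}
    {S' : (n : ℕ) → (Fin d → ℝ) → Matrix (Fin n) (Fin n) ℝ} {κ : ℕ → ℝ}
    (hS : ∀ n, (S n).PosDef) (hG : ∀ n j, (G n j).IsHermitian)
    (hS' : ∀ n u, (S' n u).IsHermitian) (hP₀ : ∀ n, P n θ₀ = gaussianPi n (S n))
    (hP : ∀ u, ∀ᶠ n in atTop, P n (θ₀ + (φ n).mulVec u) = gaussianPi n (S' n u))
    (hκ : Tendsto (fun n => κ n / Real.sqrt n) atTop (𝓝 0))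
    (hGκ : ∀ᶠ n in atTop, ∀ j x, |qForm (G n j) x| ≤ κ n * qForm (S n) x)
    (hI : ∀ j k, Tendsto (fun n => covInner (S n) (G n j) (G n k) / (2 * n)) atTop (𝓝 (I j k)))
    (hR : ∀ u : Fin d → ℝ, ∃ ρ : ℕ → ℝ, Tendsto (fun n : ℕ => Real.sqrt n * ρ n) atTop (𝓝 0) ∧
      ∀ᶠ n in atTop, ∀ x, |qForm (S' n u - S n - (Real.sqrt n)⁻¹ • ∑ j, u j • G n j) x| ≤
        ρ n * qForm (S n) x) :
    LANExpansion P θ₀ φ I := by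
  have hGu : ∀ n (u : Fin d → ℝ), (∑ j, u j • G n j).IsHermitian := by
    intro n u
    rw [Matrix.IsHermitian, conjTranspose_sum]
    exact Finset.sum_congr rfl fun j _ => by
      rw [conjTranspose_smul, (hG n j).eq]; simp
  have hsmul : ∀ (n : ℕ) (c : ℝ) (X : Matrix (Fin n) (Fin n) ℝ), X.IsHermitian →
      (c • X).IsHermitian := by
    intro n c X hX
    rw [Matrix.IsHermitian, conjTranspose_smul, hX.eq]; simp
  have hconj : ∀ (n : ℕ) (X : Matrix (Fin n) (Fin n) ℝ), X.IsHermitian →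
      ((S n)⁻¹ * X * (S n)⁻¹).IsHermitian := by
    intro n X hX
    have := isHermitian_conjTranspose_mul_mul (S n)⁻¹ hX
    rwa [(hS n).isHermitian.inv.eq] at this
  have hSu : ∀ n, IsUnit (S n).det := fun n => isUnit_iff_ne_zero.2 (hS n).det_pos.ne'
  have hGub : ∀ u : Fin d → ℝ, ∀ᶠ n in atTop, ∀ x, |qForm (∑ j, u j • G n j) x| ≤
      (∑ j, |u j|) * κ n * qForm (S n) x := by
    intro u
    filter_upwards [hGκ] with n hn x
    rw [qForm_sum, mul_assoc, Finset.sum_mul]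
    refine (Finset.abs_sum_le_sum_abs _ _).trans (Finset.sum_le_sum fun j _ => ?_)
    rw [qForm_smul, abs_mul]
    gcongr
    exact hn j x
  have hIu : ∀ u : Fin d → ℝ, Tendsto (fun n => covInner (S n) (∑ j, u j • G n j)
      (∑ j, u j • G n j) / (2 * n)) atTop (𝓝 (qForm I u)) := by
    intro u
    have h : Tendsto (fun n : ℕ => ∑ j, ∑ k, u j * (covInner (S n) (G n j) (G n k) / (2 * n)) *
        u k) atTop (𝓝 (qForm I u)) :=
      tendsto_finsetSum _ fun j _ => tendsto_finsetSum _ fun k _ =>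
        ((hI j k).const_mul _).mul_const _
    refine h.congr fun n => ?_
    rw [covInner_sum_left, Finset.sum_div]
    refine Finset.sum_congr rfl fun j _ => ?_
    rw [covInner_sum_right, Finset.sum_div]
    refine Finset.sum_congr rfl fun k _ => ?_
    rw [covInner_smul_left, covInner_smul_right]
    ring
  set C : (n : ℕ) → (Fin d → ℝ) → Matrix (Fin n) (Fin n) ℝ :=
    fun n u => (Real.sqrt n)⁻¹ • ∑ j, u j • G n j with hCdef
  have hC : ∀ n u, (C n u).IsHermitian := fun n u => hsmul _ _ _ (hGu n u)
  have hCI : ∀ u, Tendsto (fun n => covInner (S n) (C n u) (C n u)) atTop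
      (𝓝 (2 * qForm I u)) := by
    intro u
    refine ((hIu u).const_mul 2).congr fun n => ?_
    simp only [hCdef]
    rw [covInner_smul_left, covInner_smul_right, ← mul_assoc, ← mul_inv,
      Real.mul_self_sqrt (Nat.cast_nonneg n)]
    ring
  let ζ : (n : ℕ) → (Fin n → ℝ) → Fin d → ℝ := fun n x j => (2 * Real.sqrt n)⁻¹ *
    (qForm ((S n)⁻¹ * G n j * (S n)⁻¹) x - ((S n)⁻¹ * G n j * (S n)⁻¹ * S n).trace)
  have hζ : ∀ n u x, ∑ j, u j * ζ n x j = (qForm ((S n)⁻¹ * C n u * (S n)⁻¹) x -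
      ((S n)⁻¹ * C n u * (S n)⁻¹ * S n).trace) / 2 := by
    intro n u x
    simp only [hCdef, ζ, Matrix.mul_smul, Matrix.smul_mul, Matrix.mul_sum, Matrix.sum_mul,
      qForm_smul, qForm_sum, Matrix.trace_smul, Matrix.trace_sum, smul_eq_mul]
    rw [← mul_sub, ← Finset.sum_sub_distrib, Finset.mul_sum, Finset.sum_div]
    refine Finset.sum_congr rfl fun j _ => ?_
    rw [mul_inv]; ring
  let r : (n : ℕ) → (Fin d → ℝ) → (Fin n → ℝ) → ℝ := fun n u x =>
    (qForm ((S n)⁻¹ - (S' n u)⁻¹) x - (Real.log (S' n u).det - Real.log (S n).det)) / 2 -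
      ∑ j, u j * ζ n x j + qForm I u / 2
  refine ⟨ζ, r, ?_, ?_, fun u => ?_⟩
  · intro n
    refine measurable_pi_lambda _ fun j => ?_
    exact ((measurable_qForm _).sub_const _).const_mul _
  · intro t
    have hv0 : 0 ≤ qForm I t := ge_of_tendsto' (hIu t) fun n =>
      div_nonneg (covInner_self_nonneg (hS n) (hGu n t)) (by positivity)
    have hm : ∀ n, Measurable (ζ n) := fun n => measurable_pi_lambda _ fun j =>
      ((measurable_qForm _).sub_const _).const_mul _
    have hlaw : ∀ n, ((P n θ₀).map (ζ n)).map (fun z => ∑ i, t i * z i) =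
        (gaussianPi n (S n)).map fun x => qForm ((1 / 2 : ℝ) • ((S n)⁻¹ * C n t * (S n)⁻¹)) x -
          (((1 / 2 : ℝ) • ((S n)⁻¹ * C n t * (S n)⁻¹)) * S n).trace := by
      intro n
      rw [hP₀, Measure.map_map (by fun_prop) (hm n)]
      congr 1
      ext x
      rw [Function.comp, hζ, qForm_smul, Matrix.smul_mul, Matrix.trace_smul, smul_eq_mul]
      ring
    simp only [hlaw]
    have hcanc : ∀ (n : ℕ) (c : ℝ) X, S n * (c • ((S n)⁻¹ * X * (S n)⁻¹)) * S n = c • X := by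
      intro n c X
      have : S n * ((S n)⁻¹ * X * (S n)⁻¹) * S n =
          (S n * (S n)⁻¹) * X * ((S n)⁻¹ * S n) := by
        simp only [Matrix.mul_assoc]
      rw [Matrix.mul_smul, Matrix.smul_mul, this, Matrix.nonsing_inv_mul _ (hSu n),
        Matrix.mul_nonsing_inv _ (hSu n), Matrix.one_mul, Matrix.mul_one]
    refine tendstoInLaw_qForm_gaussianPi hS (fun n => hsmul _ _ _ (hconj _ _ (hC n t))) hv0
      (κ := fun n => (∑ j, |t j|) / 2 * (κ n / Real.sqrt n)) ?_ ?_ ?_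
    · simpa using hκ.const_mul ((∑ j, |t j|) / 2)
    · filter_upwards [hGub t] with n hn x
      rw [hcanc, qForm_smul, qForm_smul, abs_mul, abs_mul,
        abs_of_nonneg (show (0 : ℝ) ≤ 1 / 2 by norm_num),
        abs_of_nonneg (show (0 : ℝ) ≤ (Real.sqrt n)⁻¹ by positivity)]
      calc _ ≤ 1 / 2 * ((Real.sqrt n)⁻¹ * ((∑ j, |t j|) * κ n * qForm (S n) x)) := by
            gcongr; exact hn x
        _ = _ := by ring
    · have h := (hCI t).div_const 2
      rw [mul_div_cancel_left₀ _ two_ne_zero] at h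
      refine h.congr fun n => ?_
      simp only [Matrix.mul_smul, Matrix.smul_mul, Matrix.trace_smul, smul_eq_mul, covInner]
      have : (S n)⁻¹ * C n t * (S n)⁻¹ * S n * ((S n)⁻¹ * C n t * (S n)⁻¹) * S n =
          (S n)⁻¹ * C n t * ((S n)⁻¹ * S n) * (S n)⁻¹ * C n t * ((S n)⁻¹ * S n) := by
        simp only [Matrix.mul_assoc]
      rw [this, Matrix.nonsing_inv_mul _ (hSu n), Matrix.mul_one, Matrix.mul_one]
      ring
  · obtain ⟨ρ, hρ, hρb⟩ := hR u
    set R : (n : ℕ) → Matrix (Fin n) (Fin n) ℝ := fun n => S' n u - S n - C n u with hRdef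
    have hRh : ∀ n, (R n).IsHermitian := fun n =>
      ((hS' n u).sub (hS n).isHermitian).sub (hC n u)
    have hρ0 : Tendsto ρ atTop (𝓝 0) := by
      refine squeeze_zero_norm' ?_ (by simpa using hρ.abs)
      filter_upwards [eventually_ge_atTop 1] with n hn
      rw [Real.norm_eq_abs, abs_of_nonneg (Real.sqrt_nonneg _)]
      have : 1 ≤ Real.sqrt n := Real.one_le_sqrt.2 (by exact_mod_cast hn)
      nlinarith [abs_nonneg (ρ n)]
    set η : ℕ → ℝ := fun n => (∑ j, |u j|) * (κ n / Real.sqrt n) + ρ n with hηdef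
    have hη : Tendsto η atTop (𝓝 0) := by simpa using (hκ.const_mul (∑ j, |u j|)).add hρ0
    have hηb : ∀ᶠ n in atTop, ∀ x, |qForm (S' n u - S n) x| ≤ η n * qForm (S n) x := by
      filter_upwards [hGub u, hρb] with n h1 h2 x
      have e : S' n u - S n = C n u + R n := by simp only [hRdef]; abel
      rw [e, qForm_add]
      refine (abs_add_le _ _).trans ?_
      rw [hηdef, add_mul]
      refine add_le_add ?_ (h2 x)
      simp only [hCdef]
      rw [qForm_smul, abs_mul, abs_of_nonneg (show (0 : ℝ) ≤ (Real.sqrt n)⁻¹ by positivity)]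
      calc _ ≤ (Real.sqrt n)⁻¹ * ((∑ j, |u j|) * κ n * qForm (S n) x) := by
            gcongr; exact h1 x
        _ = _ := by ring
    have hrr : Tendsto (fun n => covInner (S n) (R n) (R n)) atTop (𝓝 0) := by
      refine squeeze_zero' (Eventually.of_forall fun n => covInner_self_nonneg (hS n) (hRh n))
        (g := fun n : ℕ => (Real.sqrt n * ρ n) ^ 2) ?_ (by simpa using hρ.pow 2)
      filter_upwards [hρb] with n hn
      refine (covInner_self_le (hS n) (hRh n) hn).trans_eq ?_
      rw [mul_pow, Real.sq_sqrt (Nat.cast_nonneg n)]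
    have hcr : Tendsto (fun n => covInner (S n) (C n u) (R n)) atTop (𝓝 0) := by
      have h1 : Tendsto (fun n => Real.sqrt (covInner (S n) (C n u) (C n u) *
          covInner (S n) (R n) (R n))) atTop (𝓝 0) := by
        have := ((hCI u).mul hrr).sqrt
        simpa using this
      refine squeeze_zero_norm (fun n => ?_) h1
      exact Real.abs_le_sqrt (covInner_sq_le (hS n) (hC n u) (hRh n))
    have hq : Tendsto (fun n => covInner (S n) (S' n u - S n) (S' n u - S n)) atTop
        (𝓝 (2 * qForm I u)) := by
      have := (((hCI u).add hcr).add hcr).add hrr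
      simp only [add_zero] at this
      refine this.congr fun n => ?_
      have e : S' n u - S n = C n u + R n := by simp only [hRdef]; abel
      rw [e, covInner_add_left, covInner_add_right, covInner_add_right,
        covInner_comm (X := R n) (Y := C n u)]
      ring
    have hη2 : ∀ᶠ n in atTop, η n ≤ 1 / 2 :=
      hη.eventually (ge_mem_nhds (by norm_num))
    constructor
    · filter_upwards [hP u, hη2, hηb] with n h1 h2 h3
      obtain ⟨M, -, hdet, -, -, -⟩ := covariance_perturbation (hS n) (hS' n u) (hC n u) h2 h3
      rw [h1, hP₀, gaussianPi_eq_withDensity (hS n).det_pos hdet]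
      congr 1
      ext x
      congr 2
      simp only [r]
      ring
    · intro ε hε
      have hd : Tendsto (fun n => 4 * η n * covInner (S n) (S' n u - S n) (S' n u - S n) / 2 +
          |qForm I u / 2 - covInner (S n) (S' n u - S n) (S' n u - S n) / 4|) atTop (𝓝 0) := by
        have h1 := ((hη.const_mul 4).mul hq).div_const 2
        have h2 := (tendsto_const_nhds (x := qForm I u / 2)).sub (hq.div_const 4) |>.abs
        have := h1.add h2
        convert this using 2
        rw [show qForm I u / 2 - 2 * qForm I u / 4 = 0 by ring]
        simp
      have hlim : Tendsto (fun n => ENNReal.ofReal (2 * (2 * covInner (S n) (R n) (R n) +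
          8 * η n ^ 2 * covInner (S n) (S' n u - S n) (S' n u - S n)) / ε ^ 2)) atTop
          (𝓝 0) := by
        have h1 := (((hrr.const_mul 2).add (((hη.pow 2).const_mul 8).mul hq)).const_mul 2).div_const
          (ε ^ 2)
        have := ENNReal.tendsto_ofReal h1
        simpa using this
      refine tendsto_of_tendsto_of_tendsto_of_le_of_le' tendsto_const_nhds hlim
        (Eventually.of_forall fun n => zero_le) ?_
      filter_upwards [hη2, hηb, hd.eventually (gt_mem_nhds (half_pos hε))] with n h2 h3 h4
      obtain ⟨M, hM, hdet, hMD, htr, hlog⟩ :=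
        covariance_perturbation (hS n) (hS' n u) (hC n u) h2 h3
      calc P n θ₀ {x | ε ≤ |r n u x - 0|}
          ≤ gaussianPi n (S n) {x | ε ≤ |qForm M x - (M * S n).trace|} := by
            rw [hP₀]
            refine measure_mono fun x hx => ?_
            simp only [Set.mem_ofPred_eq, sub_zero] at hx ⊢
            have er : r n u x = (qForm M x - (M * S n).trace) / 2 +
                ((((S n)⁻¹ - (S' n u)⁻¹) * S n).trace -
                  (Real.log (S' n u).det - Real.log (S n).det) +
                  covInner (S n) (S' n u - S n) (S' n u - S n) / 2) / 2 +
                (qForm I u / 2 - covInner (S n) (S' n u - S n) (S' n u - S n) / 4) := by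
              simp only [r]
              rw [hζ, hMD, qForm_add, Matrix.add_mul, Matrix.trace_add]
              ring
            rw [er] at hx
            have := (hx.trans (abs_add_le _ _)).trans (add_le_add_left (abs_add_le _ _) _)
            rw [abs_div, abs_div, abs_two] at this
            linarith
        _ ≤ _ := gaussianPi_qForm_chebyshev (hS n) hM hε
        _ ≤ _ := by
            refine ENNReal.ofReal_le_ofReal ?_
            gcongr

/-- Lebesgue measure on `(0, π)`. -/
abbrev halfCircle : Measure ℝ := volume.restrict (Set.Ioo 0 Real.pi)

/-- The matrix with entries `cos ((i - j) l)`. -/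
def cosMat (n : ℕ) (l : ℝ) : Matrix (Fin n) (Fin n) ℝ := fun i j =>
  Real.cos ((((i : ℕ) : ℝ) - ((j : ℕ) : ℝ)) * l)

/-- The symmetric Toeplitz matrix with symbol `h`, regarded as an even function. -/
def toep (n : ℕ) (h : ℝ → ℝ) : Matrix (Fin n) (Fin n) ℝ := fun i j =>
  2 * ∫ l, h l * cosMat n l i j ∂halfCircle

lemma continuous_cosMat_apply {n : ℕ} (i j : Fin n) : Continuous fun l => cosMat n l i j := by
  unfold cosMat; fun_prop

lemma continuous_trace_mul_cosMat {n : ℕ} (A : Matrix (Fin n) (Fin n) ℝ) :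
    Continuous fun l => (A * cosMat n l).trace := by
  have := fun i j => continuous_cosMat_apply (n := n) i j
  simp only [Matrix.trace, Matrix.diag, Matrix.mul_apply]
  fun_prop

lemma continuous_qForm_cosMat {n : ℕ} (x : Fin n → ℝ) :
    Continuous fun l => qForm (cosMat n l) x := by
  have := fun i j => continuous_cosMat_apply (n := n) i j
  simp only [qForm]
  fun_prop

lemma isHermitian_cosMat (n : ℕ) (l : ℝ) : (cosMat n l).IsHermitian := by
  ext i j
  rw [conjTranspose_apply, star_trivial]
  unfold cosMat
  rw [← Real.cos_neg]
  congr 1; ring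

lemma qForm_cosMat {n : ℕ} (l : ℝ) (x : Fin n → ℝ) :
    qForm (cosMat n l) x = (∑ k, x k * Real.cos (((k : ℕ) : ℝ) * l)) ^ 2 +
      (∑ k, x k * Real.sin (((k : ℕ) : ℝ) * l)) ^ 2 := by
  rw [sq, sq, Finset.sum_mul_sum, Finset.sum_mul_sum, ← Finset.sum_add_distrib, qForm]
  refine Finset.sum_congr rfl fun i _ => ?_
  rw [← Finset.sum_add_distrib]
  refine Finset.sum_congr rfl fun j _ => ?_
  rw [cosMat, sub_mul, Real.cos_sub]
  ring

lemma qForm_cosMat_nonneg {n : ℕ} (l : ℝ) (x : Fin n → ℝ) : 0 ≤ qForm (cosMat n l) x := by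
  rw [qForm_cosMat]; positivity

lemma qForm_cosMat_le {n : ℕ} (l : ℝ) (x : Fin n → ℝ) :
    qForm (cosMat n l) x ≤ n * ∑ k, x k ^ 2 := by
  rw [qForm_cosMat]
  have h1 := Finset.sum_mul_sq_le_sq_mul_sq Finset.univ x
    fun k : Fin n => Real.cos (((k : ℕ) : ℝ) * l)
  have h2 := Finset.sum_mul_sq_le_sq_mul_sq Finset.univ x
    fun k : Fin n => Real.sin (((k : ℕ) : ℝ) * l)
  refine (add_le_add h1 h2).trans_eq ?_
  rw [← mul_add, ← Finset.sum_add_distrib]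
  simp [mul_comm]

lemma integrable_mul_of_continuous {h g : ℝ → ℝ} (hh : Integrable h halfCircle)
    (hg : Continuous g) : Integrable (fun l => h l * g l) halfCircle := by
  obtain ⟨C, hC⟩ := (isCompact_Icc (a := (0 : ℝ)) (b := Real.pi)).exists_bound_of_continuousOn
    hg.continuousOn
  refine hh.mul_bdd (c := C) hg.aestronglyMeasurable ?_
  filter_upwards [ae_restrict_mem measurableSet_Ioo] with l hl
  exact hC l (Set.Ioo_subset_Icc_self hl)

section toep
variable {n : ℕ} {h g : ℝ → ℝ}

lemma isHermitian_toep (n : ℕ) (h : ℝ → ℝ) : (toep n h).IsHermitian := by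
  ext i j
  rw [conjTranspose_apply, star_trivial]
  unfold toep
  congr 1
  refine integral_congr_ae (ae_of_all _ fun l => ?_)
  have := congrFun (congrFun (isHermitian_cosMat n l) i) j
  rw [conjTranspose_apply, star_trivial] at this
  simp only [this]

lemma toep_add (hg : Integrable g halfCircle) (hh : Integrable h halfCircle) :
    toep n (fun l => g l + h l) = toep n g + toep n h := by
  ext i j
  simp only [toep, Matrix.add_apply, add_mul]
  rw [integral_add (integrable_mul_of_continuous hg (continuous_cosMat_apply i j))
    (integrable_mul_of_continuous hh (continuous_cosMat_apply i j))]
  ring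

lemma toep_const_mul (c : ℝ) : toep n (fun l => c * h l) = c • toep n h := by
  ext i j
  simp only [toep, Matrix.smul_apply, mul_assoc, smul_eq_mul]
  rw [integral_const_mul]
  ring

lemma toep_sub (hg : Integrable g halfCircle) (hh : Integrable h halfCircle) :
    toep n (fun l => g l - h l) = toep n g - toep n h := by
  have h1 := toep_add (n := n) hg (hh.const_mul (-1))
  rw [toep_const_mul] at h1
  simpa [sub_eq_add_neg] using h1

lemma trace_mul_toep (hh : Integrable h halfCircle) (A : Matrix (Fin n) (Fin n) ℝ) :
    (A * toep n h).trace = 2 * ∫ l, h l * (A * cosMat n l).trace ∂halfCircle := by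
  have hint : ∀ i j, Integrable (fun l => A i j * (h l * cosMat n l j i)) halfCircle :=
    fun i j => (integrable_mul_of_continuous hh (continuous_cosMat_apply j i)).const_mul _
  simp only [Matrix.trace, Matrix.diag, Matrix.mul_apply, Finset.mul_sum]
  simp only [toep]
  have : ∀ l, ∑ i, ∑ j, h l * (A i j * cosMat n l j i) =
      ∑ i, ∑ j, A i j * (h l * cosMat n l j i) := fun l =>
    Finset.sum_congr rfl fun i _ => Finset.sum_congr rfl fun j _ => by ring
  simp only [this]
  rw [integral_finsetSum _ fun i _ => integrable_finsetSum _ fun j _ => hint i j,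
    Finset.mul_sum]
  refine Finset.sum_congr rfl fun i _ => ?_
  rw [integral_finsetSum _ fun j _ => hint i j, Finset.mul_sum]
  refine Finset.sum_congr rfl fun j _ => ?_
  rw [integral_const_mul]; ring

lemma qForm_eq_trace (M : Matrix (Fin n) (Fin n) ℝ) (x : Fin n → ℝ) :
    qForm M x = (Matrix.vecMulVec x x * M).trace := by
  simp only [qForm, Matrix.trace, Matrix.diag, Matrix.mul_apply, Matrix.vecMulVec_apply]
  rw [Finset.sum_comm]
  exact Finset.sum_congr rfl fun i _ => Finset.sum_congr rfl fun j _ => by ring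

lemma qForm_toep (hh : Integrable h halfCircle) (x : Fin n → ℝ) :
    qForm (toep n h) x = 2 * ∫ l, h l * qForm (cosMat n l) x ∂halfCircle := by
  simp only [qForm_eq_trace]
  exact trace_mul_toep hh _

lemma qForm_toep_mono (hg : Integrable g halfCircle) (hh : Integrable h halfCircle)
    (hgh : ∀ l ∈ Set.Ioo 0 Real.pi, g l ≤ h l) (x : Fin n → ℝ) :
    qForm (toep n g) x ≤ qForm (toep n h) x := by
  rw [qForm_toep hg, qForm_toep hh]
  refine mul_le_mul_of_nonneg_left ?_ zero_le_two
  refine setIntegral_mono_on (integrable_mul_of_continuous hg (continuous_qForm_cosMat x))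
    (integrable_mul_of_continuous hh (continuous_qForm_cosMat x)) measurableSet_Ioo fun l hl => ?_
  exact mul_le_mul_of_nonneg_right (hgh l hl) (qForm_cosMat_nonneg l x)

lemma abs_qForm_toep_le (hg : Integrable g halfCircle) (hh : Integrable h halfCircle)
    (hgh : ∀ l ∈ Set.Ioo 0 Real.pi, |g l| ≤ h l) (x : Fin n → ℝ) :
    |qForm (toep n g) x| ≤ qForm (toep n h) x := by
  rw [abs_le]
  constructor
  · have h1 := qForm_toep_mono (n := n) (hh.const_mul (-1)) hg
      (fun l hl => by have := neg_abs_le (g l); have := hgh l hl; linarith) x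
    rw [toep_const_mul, qForm_smul] at h1
    linarith
  · exact qForm_toep_mono hg hh (fun l hl => (le_abs_self _).trans (hgh l hl)) x

lemma integral_cos_int_mul (k : ℤ) (hk : k ≠ 0) :
    ∫ l, Real.cos ((k : ℝ) * l) ∂halfCircle = 0 := by
  have hk' : (k : ℝ) ≠ 0 := by exact_mod_cast hk
  rw [← integral_Ioc_eq_integral_Ioo, ← intervalIntegral.integral_of_le Real.pi_pos.le,
    intervalIntegral.integral_comp_mul_left (fun x => Real.cos x) hk']
  simp [integral_cos, Real.sin_int_mul_pi]

lemma toep_one : toep n (fun _ => 1) = (2 * Real.pi) • (1 : Matrix (Fin n) (Fin n) ℝ) := by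
  ext i j
  simp only [toep, one_mul, Matrix.smul_apply, Matrix.one_apply, smul_eq_mul, cosMat]
  split_ifs with hij
  · subst hij
    simp [Real.pi_pos.le]
  · have := integral_cos_int_mul ((i : ℕ) - (j : ℕ) : ℤ)
      (sub_ne_zero.2 (by exact_mod_cast fun h => hij (Fin.ext h)))
    push_cast at this
    rw [this]; ring

lemma qForm_one (x : Fin n → ℝ) : qForm (1 : Matrix (Fin n) (Fin n) ℝ) x = ∑ k, x k ^ 2 := by
  rw [← diagonal_one, qForm_diagonal]; simp

end toep

/-- A symbol on `(0, π)` that is continuous and comparable to the power `l ^ a`. -/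
structure PowerSymbol (a c C : ℝ) (f : ℝ → ℝ) : Prop where
  neg_one_lt : -1 < a
  lt_one : a < 1
  c_pos : 0 < c
  lower : ∀ l ∈ Set.Ioo 0 Real.pi, c * l ^ a ≤ f l
  upper : ∀ l ∈ Set.Ioo 0 Real.pi, f l ≤ C * l ^ a
  continuousOn : ContinuousOn f (Set.Ioo 0 Real.pi)

lemma integrable_rpow_halfCircle {r : ℝ} (hr : -1 < r) :
    Integrable (fun l : ℝ => l ^ r) halfCircle := by
  have h := intervalIntegral.intervalIntegrable_rpow' (a := 0) (b := Real.pi) hr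
  rw [intervalIntegrable_iff_integrableOn_Ioo_of_le Real.pi_pos.le] at h
  exact h

lemma integrable_of_le_rpow {g : ℝ → ℝ} {B r : ℝ} (hr : -1 < r)
    (hg : AEStronglyMeasurable g halfCircle)
    (hB : ∀ l ∈ Set.Ioo 0 Real.pi, |g l| ≤ B * l ^ r) : Integrable g halfCircle := by
  refine ((integrable_rpow_halfCircle hr).const_mul B).mono' hg ?_
  filter_upwards [ae_restrict_mem measurableSet_Ioo] with l hl using hB l hl

lemma aestronglyMeasurable_halfCircle {g : ℝ → ℝ} (hg : ContinuousOn g (Set.Ioo 0 Real.pi)) :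
    AEStronglyMeasurable g halfCircle := hg.aestronglyMeasurable measurableSet_Ioo

namespace PowerSymbol
variable {a c C : ℝ} {f : ℝ → ℝ}

lemma pos (hf : PowerSymbol a c C f) {l : ℝ} (hl : l ∈ Set.Ioo 0 Real.pi) : 0 < f l :=
  (mul_pos hf.c_pos (Real.rpow_pos_of_pos hl.1 a)).trans_le (hf.lower l hl)

lemma C_pos (hf : PowerSymbol a c C f) : 0 < C := by
  have hl : (1 : ℝ) ∈ Set.Ioo 0 Real.pi := ⟨one_pos, by linarith [Real.pi_gt_three]⟩
  have h := hf.lower 1 hl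
  have h' := hf.upper 1 hl
  simp only [Real.one_rpow, mul_one] at h h'
  linarith [hf.c_pos]

lemma integrable (hf : PowerSymbol a c C f) : Integrable f halfCircle :=
  integrable_of_le_rpow hf.neg_one_lt (aestronglyMeasurable_halfCircle hf.continuousOn)
    fun l hl => by rw [abs_of_pos (hf.pos hl)]; exact hf.upper l hl

lemma abs_mul_le (hf : PowerSymbol a c C f) {ψ : ℝ → ℝ} {B ε : ℝ}
    (hB : ∀ l ∈ Set.Ioo 0 Real.pi, |ψ l| ≤ B * l ^ (-ε)) :
    ∀ l ∈ Set.Ioo 0 Real.pi, |f l * ψ l| ≤ (C * B) * l ^ (a - ε) := by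
  intro l hl
  rw [abs_mul, abs_of_pos (hf.pos hl), sub_eq_add_neg, Real.rpow_add hl.1]
  calc _ ≤ (C * l ^ a) * (B * l ^ (-ε)) :=
        mul_le_mul (hf.upper l hl) (hB l hl) (abs_nonneg _)
          (mul_nonneg hf.C_pos.le (Real.rpow_nonneg hl.1.le _))
    _ = _ := by ring

lemma integrable_mul (hf : PowerSymbol a c C f) {ψ : ℝ → ℝ} {B ε : ℝ} (hε : ε < 1 + a)
    (hψ : AEStronglyMeasurable ψ halfCircle)
    (hB : ∀ l ∈ Set.Ioo 0 Real.pi, |ψ l| ≤ B * l ^ (-ε)) :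
    Integrable (fun l => f l * ψ l) halfCircle :=
  integrable_of_le_rpow (r := a - ε) (by linarith)
    ((aestronglyMeasurable_halfCircle hf.continuousOn).mul hψ) (hf.abs_mul_le hB)

lemma exists_qForm_lower (hf : PowerSymbol a c C f) :
    ∃ c' > 0, ∀ n : ℕ, 0 < n → ∀ x : Fin n → ℝ,
      c' / n * ∑ k, x k ^ 2 ≤ qForm (toep n f) x := by
  have hpi := Real.pi_gt_three
  have hc' : 0 < c * Real.pi ^ (a - 1) := mul_pos hf.c_pos (Real.rpow_pos_of_pos Real.pi_pos _)
  refine ⟨c * Real.pi ^ (a - 1) * (2 * Real.pi - 2), mul_pos hc' (by linarith), ?_⟩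
  intro n hn x
  have hn' : (0 : ℝ) < n := by exact_mod_cast hn
  set δ : ℝ := 1 / n with hδ
  have hδ0 : 0 < δ := by positivity
  set I : ℝ → ℝ := (Set.Iio δ).indicator fun _ => 1 with hI
  have hIint : Integrable I halfCircle := (integrable_const (1 : ℝ)).indicator measurableSet_Iio
  have hx : 0 ≤ ∑ k, x k ^ 2 := Finset.sum_nonneg fun _ _ => sq_nonneg _
  have hmono := qForm_toep_mono (n := n) (g := fun l => (c * Real.pi ^ (a - 1) * δ) *
    (1 - I l)) (((integrable_const (1 : ℝ)).sub hIint).const_mul _) hf.integrable (by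
      intro l hl
      refine le_trans ?_ (hf.lower l hl)
      rw [mul_assoc, mul_assoc]
      refine mul_le_mul_of_nonneg_left ?_ hf.c_pos.le
      have h1 : δ * (1 - I l) ≤ l := by
        by_cases h : l < δ
        · simp [hI, h, hl.1.le]
        · simp only [hI, Set.indicator, Set.mem_Iio, h, if_false]; linarith
      have h2 : l ^ a = l ^ (a - 1) * l := by
        rw [← Real.rpow_add_one hl.1.ne']; congr 1; ring
      rw [h2]
      have h3 : Real.pi ^ (a - 1) ≤ l ^ (a - 1) :=
        Real.rpow_le_rpow_of_nonpos hl.1 hl.2.le (by linarith [hf.lt_one])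
      calc _ ≤ Real.pi ^ (a - 1) * l :=
            mul_le_mul_of_nonneg_left h1 (Real.rpow_nonneg Real.pi_pos.le _)
        _ ≤ _ := mul_le_mul_of_nonneg_right h3 hl.1.le) x
  rw [toep_const_mul, qForm_smul, toep_sub (integrable_const _) hIint, qForm_sub, toep_one,
    qForm_smul, qForm_one] at hmono
  have hIq : qForm (toep n I) x ≤ 2 * ∑ k, x k ^ 2 := by
    rw [qForm_toep hIint]
    have : ∫ l, I l * qForm (cosMat n l) x ∂halfCircle ≤
        ∫ l, I l * (n * ∑ k, x k ^ 2) ∂halfCircle := by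
      refine integral_mono (integrable_mul_of_continuous hIint (continuous_qForm_cosMat x))
        (hIint.mul_const _) fun l => ?_
      exact mul_le_mul_of_nonneg_left (qForm_cosMat_le l x)
        (Set.indicator_nonneg (fun _ _ => zero_le_one) _)
    rw [integral_mul_const, hI, integral_indicator measurableSet_Iio,
      Measure.restrict_restrict measurableSet_Iio, integral_const, smul_eq_mul, mul_one] at this
    have hvol : (volume.restrict (Set.Iio δ ∩ Set.Ioo 0 Real.pi)).real Set.univ ≤ δ := by
      rw [Measure.real, Measure.restrict_apply_univ]
      refine ENNReal.toReal_le_of_le_ofReal hδ0.le ?_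
      refine (measure_mono (t := Set.Ioo 0 δ) fun y hy => ⟨hy.2.1, hy.1⟩).trans ?_
      simp
    have h2 := mul_le_mul_of_nonneg_right hvol (mul_nonneg hn'.le hx)
    have h3 : δ * (n * ∑ k, x k ^ 2) = ∑ k, x k ^ 2 := by
      rw [hδ]; field_simp
    linarith
  refine le_trans ?_ hmono
  calc _ = (c * Real.pi ^ (a - 1) * δ) * (2 * Real.pi * ∑ k, x k ^ 2 - 2 * ∑ k, x k ^ 2) := by
        rw [hδ]; field_simp
    _ ≤ _ := by gcongr

lemma posDef_toep (hf : PowerSymbol a c C f) (n : ℕ) : (toep n f).PosDef := by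
  obtain ⟨c', hc', h⟩ := hf.exists_qForm_lower
  refine Matrix.PosDef.of_dotProduct_mulVec_pos (isHermitian_toep n f) fun x hx => ?_
  rw [star_trivial, ← qForm_eq_dotProduct]
  rcases Nat.eq_zero_or_pos n with rfl | hn
  · exact absurd (Subsingleton.elim x 0) hx
  · refine lt_of_lt_of_le ?_ (h n hn x)
    have hn' : (0 : ℝ) < n := by exact_mod_cast hn
    refine mul_pos (div_pos hc' hn') ?_
    obtain ⟨i, hi⟩ := Function.ne_iff.1 hx
    exact Finset.sum_pos' (fun _ _ => sq_nonneg _) ⟨i, Finset.mem_univ _, by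
      have : x i ≠ 0 := hi
      positivity⟩

/-- Symbols dominated by `f l * l ^ (-ε)` have quadratic forms dominated by that of `f`, up to a
small power of the dimension. -/
lemma exists_qForm_upper (hf : PowerSymbol a c C f) {ε : ℝ} (hε0 : 0 ≤ ε)
    (hε : ε ≤ (1 + a) / 2) :
    ∃ K > 0, ∀ n : ℕ, 0 < n → ∀ (g : ℝ → ℝ) (κ : ℝ), AEStronglyMeasurable g halfCircle → 0 ≤ κ →
      (∀ l ∈ Set.Ioo 0 Real.pi, |g l| ≤ κ * (f l * l ^ (-ε))) → ∀ x : Fin n → ℝ,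
      |qForm (toep n g) x| ≤ K * κ * (n : ℝ) ^ (4 / (1 + a) * ε) * qForm (toep n f) x := by
  obtain ⟨c', hc', hlow⟩ := hf.exists_qForm_lower
  have ha := hf.neg_one_lt
  have ha1 := hf.lt_one
  have hC := hf.C_pos
  set β := (1 + a) / 2 with hβ
  have hβ0 : 0 < β := by linarith
  set M := 4 / (1 + a) with hM
  have hM0 : 0 < M := by rw [hM]; apply div_pos <;> linarith
  have hMβ : M * β = 2 := by rw [hM, hβ]; field_simp [show 1 + a ≠ 0 by linarith]; norm_num
  set J : ℝ := ∫ l, l ^ (a - β) ∂halfCircle with hJ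
  have hJi := integrable_rpow_halfCircle (r := a - β) (by linarith)
  have hJ0 : 0 ≤ J := setIntegral_nonneg measurableSet_Ioo fun l hl => Real.rpow_nonneg hl.1.le _
  refine ⟨1 + 2 * C * J / c', by positivity, ?_⟩
  intro n hn g κ hg hκ hgb x
  have hn' : (0 : ℝ) < n := by exact_mod_cast hn
  set N : ℝ := (n : ℝ) with hN
  have hpw : ∀ l ∈ Set.Ioo 0 Real.pi,
      f l * l ^ (-ε) ≤ N ^ (M * ε) * f l + C * N ^ (-(M * (β - ε))) * l ^ (a - β) := by
    intro l hl
    have hfl := (hf.pos hl).le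
    have hl0 := hl.1
    rcases le_or_gt (N ^ (-M)) l with h | h
    · have h1 : l ^ (-ε) ≤ N ^ (M * ε) := by
        calc l ^ (-ε) ≤ (N ^ (-M)) ^ (-ε) :=
              Real.rpow_le_rpow_of_nonpos (by positivity) h (by linarith)
          _ = N ^ (M * ε) := by rw [← Real.rpow_mul hn'.le]; congr 1; ring
      have h2 : 0 ≤ C * N ^ (-(M * (β - ε))) * l ^ (a - β) := by positivity
      nlinarith [mul_le_mul_of_nonneg_left h1 hfl]
    · have h1 : l ^ (-ε) = l ^ (β - ε) * l ^ (-β) := by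
        rw [← Real.rpow_add hl0]; congr 1; ring
      have h2 : l ^ (β - ε) ≤ N ^ (-(M * (β - ε))) := by
        calc l ^ (β - ε) ≤ (N ^ (-M)) ^ (β - ε) :=
              Real.rpow_le_rpow hl0.le h.le (by linarith)
          _ = _ := by rw [← Real.rpow_mul hn'.le]; congr 1; ring
      have h3 : l ^ (a - β) = l ^ a * l ^ (-β) := by
        rw [← Real.rpow_add hl0]; congr 1
      have h4 : 0 ≤ N ^ (M * ε) * f l := by positivity
      calc f l * l ^ (-ε) ≤ (C * l ^ a) * (N ^ (-(M * (β - ε))) * l ^ (-β)) := by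
            rw [h1]
            refine mul_le_mul (hf.upper l hl) ?_ (by positivity) (by positivity)
            exact mul_le_mul_of_nonneg_right h2 (by positivity)
        _ = C * N ^ (-(M * (β - ε))) * l ^ (a - β) := by rw [h3]; ring
        _ ≤ _ := by linarith
  set G : ℝ → ℝ := fun l => κ * (N ^ (M * ε) * f l + C * N ^ (-(M * (β - ε))) * l ^ (a - β))
    with hG
  have hi1 := hf.integrable.const_mul (N ^ (M * ε))
  have hi2 := hJi.const_mul (C * N ^ (-(M * (β - ε))))
  have hGi : Integrable G halfCircle := (hi1.add hi2).const_mul κ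
  have hgG : ∀ l ∈ Set.Ioo 0 Real.pi, |g l| ≤ G l := fun l hl =>
    (hgb l hl).trans (mul_le_mul_of_nonneg_left (hpw l hl) hκ)
  have hgi : Integrable g halfCircle := by
    refine hGi.mono' hg ?_
    filter_upwards [ae_restrict_mem measurableSet_Ioo] with l hl using hgG l hl
  refine (abs_qForm_toep_le hgi hGi hgG x).trans ?_
  rw [hG, toep_const_mul, qForm_smul, toep_add hi1 hi2, qForm_add, toep_const_mul, qForm_smul,
    toep_const_mul, qForm_smul]
  have hx : 0 ≤ ∑ k, x k ^ 2 := Finset.sum_nonneg fun _ _ => sq_nonneg _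
  have hJq : qForm (toep n fun l => l ^ (a - β)) x ≤ 2 * (J * (N * ∑ k, x k ^ 2)) := by
    rw [qForm_toep hJi, hJ, ← integral_mul_const]
    refine mul_le_mul_of_nonneg_left ?_ zero_le_two
    refine setIntegral_mono_on (integrable_mul_of_continuous hJi (continuous_qForm_cosMat x))
      (hJi.mul_const _) measurableSet_Ioo fun l hl => ?_
    exact mul_le_mul_of_nonneg_left (qForm_cosMat_le l x) (Real.rpow_nonneg hl.1.le _)
  have hlow' : ∑ k, x k ^ 2 ≤ N / c' * qForm (toep n f) x := by
    have := hlow n hn x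
    rw [div_mul_eq_mul_div, div_le_iff₀ hn'] at this
    rw [div_mul_eq_mul_div, le_div_iff₀ hc']
    linarith
  have hpow : N ^ (-(M * (β - ε))) * (N * N) = N ^ (M * ε) := by
    rw [show N * N = N ^ (2 : ℝ) by rw [Real.rpow_two]; ring, ← Real.rpow_add hn']
    congr 1; linarith
  calc κ * (N ^ (M * ε) * qForm (toep n f) x + C * N ^ (-(M * (β - ε))) *
        qForm (toep n fun l => l ^ (a - β)) x)
      ≤ κ * (N ^ (M * ε) * qForm (toep n f) x + C * N ^ (-(M * (β - ε))) *
        (2 * (J * (N * (N / c' * qForm (toep n f) x))))) := by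
        gcongr
        refine hJq.trans ?_
        gcongr
    _ = κ * (N ^ (M * ε) * qForm (toep n f) x + 2 * C * J / c' *
          (N ^ (-(M * (β - ε))) * (N * N)) * qForm (toep n f) x) := by ring
    _ = _ := by rw [hpow]; ring

end PowerSymbol

def cosVec (n : ℕ) (l : ℝ) : Fin n → ℝ := fun k => Real.cos (((k : ℕ) : ℝ) * l)

def sinVec (n : ℕ) (l : ℝ) : Fin n → ℝ := fun k => Real.sin (((k : ℕ) : ℝ) * l)

lemma cosMat_eq_vecMulVec (n : ℕ) (l : ℝ) :
    cosMat n l = vecMulVec (cosVec n l) (cosVec n l) + vecMulVec (sinVec n l) (sinVec n l) := by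
  ext i j
  simp only [cosMat, Matrix.add_apply, vecMulVec_apply, cosVec, sinVec]
  rw [sub_mul, Real.cos_sub]

lemma trace_mul_cosMat {n : ℕ} (A : Matrix (Fin n) (Fin n) ℝ) (l : ℝ) :
    (A * cosMat n l).trace = qForm A (cosVec n l) + qForm A (sinVec n l) := by
  rw [cosMat_eq_vecMulVec, Matrix.mul_add, Matrix.trace_add, qForm_eq_trace, qForm_eq_trace,
    Matrix.trace_mul_comm A, Matrix.trace_mul_comm A]

lemma sum_sq_cosVec_add (n : ℕ) (l : ℝ) :
    ∑ k, cosVec n l k ^ 2 + ∑ k, sinVec n l k ^ 2 = n := by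
  rw [← Finset.sum_add_distrib]
  simp [cosVec, sinVec, Real.cos_sq_add_sin_sq]

/-! ### The Fejér kernel -/

lemma two_mul_sin_mul_sum_cos (n : ℕ) (t : ℝ) :
    2 * Real.sin (t / 2) * ∑ k : Fin n, Real.cos (((k : ℕ) : ℝ) * t) =
      Real.sin ((n - 1 / 2) * t) + Real.sin (t / 2) := by
  induction n with
  | zero =>
    rw [Nat.cast_zero, show ((0 : ℝ) - 1 / 2) * t = -(t / 2) by ring]
    simp
  | succ m ih =>
    rw [Fin.sum_univ_castSucc, mul_add]
    simp only [Fin.val_castSucc, Fin.val_last]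
    rw [ih]
    push_cast
    rw [show ((m : ℝ) + 1 - 1 / 2) * t = m * t + t / 2 by ring,
      show ((m : ℝ) - 1 / 2) * t = m * t - t / 2 by ring, Real.sin_add, Real.sin_sub]
    ring

lemma two_mul_sin_mul_sum_sin (n : ℕ) (t : ℝ) :
    2 * Real.sin (t / 2) * ∑ k : Fin n, Real.sin (((k : ℕ) : ℝ) * t) =
      Real.cos (t / 2) - Real.cos ((n - 1 / 2) * t) := by
  induction n with
  | zero =>
    rw [Nat.cast_zero, show ((0 : ℝ) - 1 / 2) * t = -(t / 2) by ring]
    simp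
  | succ m ih =>
    rw [Fin.sum_univ_castSucc, mul_add]
    simp only [Fin.val_castSucc, Fin.val_last]
    rw [ih]
    push_cast
    rw [show ((m : ℝ) + 1 - 1 / 2) * t = m * t + t / 2 by ring,
      show ((m : ℝ) - 1 / 2) * t = m * t - t / 2 by ring, Real.cos_add, Real.cos_sub]
    ring

lemma sin_sq_mul_qForm_cosMat_le (n : ℕ) (t : ℝ) :
    Real.sin (t / 2) ^ 2 * qForm (cosMat n t) (fun _ => 1) ≤ 1 := by
  rw [qForm_cosMat]
  simp only [one_mul]
  have h1 := two_mul_sin_mul_sum_cos n t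
  have h2 := two_mul_sin_mul_sum_sin n t
  set A := ∑ k : Fin n, Real.cos (((k : ℕ) : ℝ) * t)
  set B := ∑ k : Fin n, Real.sin (((k : ℕ) : ℝ) * t)
  have e : 4 * (Real.sin (t / 2) ^ 2 * (A ^ 2 + B ^ 2)) =
      (2 * Real.sin (t / 2) * A) ^ 2 + (2 * Real.sin (t / 2) * B) ^ 2 := by ring
  rw [h1, h2] at e
  nlinarith [Real.sin_sq_add_cos_sq ((n - 1 / 2) * t), Real.sin_sq_add_cos_sq (t / 2),
    sq_nonneg (Real.sin ((n - 1 / 2) * t) - Real.sin (t / 2)),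
    sq_nonneg (Real.cos ((n - 1 / 2) * t) + Real.cos (t / 2))]

/-- The (symmetrized) Fejér kernel. -/
def fejer (n : ℕ) (l m : ℝ) : ℝ := (cosMat n l * cosMat n m).trace / n

lemma fejer_eq (n : ℕ) (l m : ℝ) :
    fejer n l m = (qForm (cosMat n (l - m)) (fun _ => 1) +
      qForm (cosMat n (l + m)) (fun _ => 1)) / 2 / n := by
  unfold fejer
  congr 1
  simp only [Matrix.trace, Matrix.diag, Matrix.mul_apply, qForm, one_mul, mul_one]
  rw [← Finset.sum_add_distrib, Finset.sum_div]
  refine Finset.sum_congr rfl fun i _ => ?_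
  rw [← Finset.sum_add_distrib, Finset.sum_div]
  refine Finset.sum_congr rfl fun j _ => ?_
  simp only [cosMat]
  rw [mul_sub, mul_add, Real.cos_sub, Real.cos_add,
    show (((j : ℕ) : ℝ) - ((i : ℕ) : ℝ)) * m = -((((i : ℕ) : ℝ) - ((j : ℕ) : ℝ)) * m) by ring,
    Real.cos_neg]
  ring

lemma continuous_fejer (n : ℕ) (l : ℝ) : Continuous (fejer n l) :=
  (continuous_trace_mul_cosMat _).div_const _

lemma fejer_nonneg (n : ℕ) (l m : ℝ) : 0 ≤ fejer n l m := by
  rw [fejer_eq]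
  have := qForm_cosMat_nonneg (l - m) (fun _ : Fin n => 1)
  have := qForm_cosMat_nonneg (l + m) (fun _ : Fin n => 1)
  positivity

lemma fejer_le (n : ℕ) (l m : ℝ) : fejer n l m ≤ n := by
  rw [fejer_eq]
  have h1 := qForm_cosMat_le (l - m) (fun _ : Fin n => 1)
  have h2 := qForm_cosMat_le (l + m) (fun _ : Fin n => 1)
  simp only [one_pow, Finset.sum_const, Finset.card_univ, Fintype.card_fin, nsmul_eq_mul,
    mul_one] at h1 h2
  rcases Nat.eq_zero_or_pos n with rfl | hn
  · simp
  · have hn' : (0 : ℝ) < n := by exact_mod_cast hn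
    rw [div_le_iff₀ hn']; linarith

lemma abs_div_pi_le_sin {t : ℝ} (ht : |t| ≤ Real.pi) : t ^ 2 ≤ Real.pi ^ 2 * Real.sin (t / 2) ^ 2 := by
  have h := Real.mul_le_sin (x := |t| / 2) (by positivity) (by linarith)
  have e : Real.sin (t / 2) ^ 2 = Real.sin (|t| / 2) ^ 2 := by
    rcases abs_cases t with ⟨h, _⟩ | ⟨h, _⟩ <;> rw [h]
    rw [neg_div, Real.sin_neg, neg_sq]
  rw [e, ← sq_abs t, ← mul_pow]
  refine pow_le_pow_left₀ (abs_nonneg _) ?_ 2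
  have hp := Real.pi_pos
  calc |t| = Real.pi * (2 / Real.pi * (|t| / 2)) := by field_simp
    _ ≤ _ := mul_le_mul_of_nonneg_left h hp.le

lemma fejer_mul_sq_le {n : ℕ} (hn : 0 < n) {l m : ℝ} (hl : l ∈ Set.Ioo 0 Real.pi)
    (hm : m ∈ Set.Ioo 0 Real.pi) : fejer n l m * (l - m) ^ 2 ≤ Real.pi ^ 2 / n := by
  have hn' : (0 : ℝ) < n := by exact_mod_cast hn
  have h1 := sin_sq_mul_qForm_cosMat_le n (l - m)
  have h2 := sin_sq_mul_qForm_cosMat_le n (l + m)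
  have hs : Real.sin ((l - m) / 2) ^ 2 ≤ Real.sin ((l + m) / 2) ^ 2 := by
    have e : Real.sin ((l + m) / 2) ^ 2 - Real.sin ((l - m) / 2) ^ 2 =
        Real.sin l * Real.sin m := by
      rw [show l = l / 2 + l / 2 by ring, show m = m / 2 + m / 2 by ring]
      rw [Real.sin_add (l / 2) (l / 2), Real.sin_add (m / 2) (m / 2),
        show (l / 2 + l / 2 + (m / 2 + m / 2)) / 2 = l / 2 + m / 2 by ring,
        show (l / 2 + l / 2 - (m / 2 + m / 2)) / 2 = l / 2 - m / 2 by ring,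
        Real.sin_add, Real.sin_sub]
      ring
    have := mul_nonneg (Real.sin_nonneg_of_mem_Icc ⟨hl.1.le, hl.2.le⟩)
      (Real.sin_nonneg_of_mem_Icc ⟨hm.1.le, hm.2.le⟩)
    linarith
  have h3 : Real.sin ((l - m) / 2) ^ 2 * qForm (cosMat n (l + m)) (fun _ => 1) ≤ 1 :=
    (mul_le_mul_of_nonneg_right hs (qForm_cosMat_nonneg _ _)).trans h2
  have h4 := abs_div_pi_le_sin (t := l - m) (abs_le.2 ⟨by linarith [hl.1, hm.2],
    by linarith [hl.2, hm.1]⟩)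
  calc fejer n l m * (l - m) ^ 2 ≤ fejer n l m * (Real.pi ^ 2 * Real.sin ((l - m) / 2) ^ 2) :=
        mul_le_mul_of_nonneg_left h4 (fejer_nonneg _ _ _)
    _ = Real.pi ^ 2 * ((Real.sin ((l - m) / 2) ^ 2 * qForm (cosMat n (l - m)) (fun _ => 1) +
          Real.sin ((l - m) / 2) ^ 2 * qForm (cosMat n (l + m)) (fun _ => 1)) / 2) / n := by
        rw [fejer_eq]; ring
    _ ≤ Real.pi ^ 2 * 1 / n := by
        gcongr; linarith
    _ = _ := by rw [mul_one]

lemma fejer_mul_abs_le {n : ℕ} (hn : 0 < n) {l m : ℝ} (hl : l ∈ Set.Ioo 0 Real.pi)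
    (hm : m ∈ Set.Ioo 0 Real.pi) : fejer n l m * |l - m| ≤ Real.pi := by
  have hn' : (0 : ℝ) < n := by exact_mod_cast hn
  have h1 := fejer_mul_sq_le hn hl hm
  have h2 := fejer_le n l m
  refine abs_le_of_sq_le_sq' ?_ Real.pi_pos.le |>.2
  rw [mul_pow, sq_abs]
  calc fejer n l m ^ 2 * (l - m) ^ 2 = fejer n l m * (fejer n l m * (l - m) ^ 2) := by ring
    _ ≤ n * (Real.pi ^ 2 / n) := mul_le_mul h2 h1 (mul_nonneg (fejer_nonneg _ _ _) (sq_nonneg _))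
        hn'.le
    _ = _ := by field_simp

lemma trace_cosMat_mul_toep_div {n : ℕ} {h : ℝ → ℝ} (hh : Integrable h halfCircle) (l : ℝ) :
    (cosMat n l * toep n h).trace / n = 2 * ∫ m, h m * fejer n l m ∂halfCircle := by
  rw [trace_mul_toep hh, mul_div_assoc, ← integral_div]
  simp only [fejer, mul_div_assoc]

lemma integral_fejer {n : ℕ} (hn : 0 < n) (l : ℝ) : ∫ m, fejer n l m ∂halfCircle = Real.pi := by
  have hn' : (n : ℝ) ≠ 0 := by exact_mod_cast hn.ne'
  have h := trace_cosMat_mul_toep_div (n := n) (integrable_const (1 : ℝ)) l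
  rw [toep_one] at h
  have ht : (cosMat n l).trace = n := by simp [Matrix.trace, cosMat]
  simp only [Matrix.mul_smul, Matrix.mul_one, Matrix.trace_smul, ht, one_mul, smul_eq_mul] at h
  field_simp at h
  linarith

lemma integrable_fejer (n : ℕ) (l : ℝ) : Integrable (fejer n l) halfCircle := by
  have := integrable_mul_of_continuous (integrable_const (1 : ℝ)) (continuous_fejer n l)
  simpa using this

lemma tendsto_trace_cosMat_mul_toep {h : ℝ → ℝ} (hh : Integrable h halfCircle) {l : ℝ}
    (hl : l ∈ Set.Ioo 0 Real.pi) (hc : ContinuousAt h l) :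
    Tendsto (fun n : ℕ => (cosMat n l * toep n h).trace / n) atTop (𝓝 (2 * Real.pi * h l)) := by
  have hpi := Real.pi_pos
  rw [Metric.tendsto_atTop]
  intro ε hε
  obtain ⟨δ, hδ, hδh⟩ := Metric.continuousAt_iff.1 hc (ε / (4 * Real.pi)) (by positivity)
  set A := ∫ m, |h m - h l| ∂halfCircle with hA
  have hhl : Integrable (fun m => h m - h l) halfCircle := hh.sub (integrable_const _)
  have hlim : Tendsto (fun n : ℕ => 2 * (Real.pi ^ 2 / δ ^ 2 * A) / (n : ℝ)) atTop (𝓝 0) :=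
    tendsto_const_div_atTop_nhds_zero_nat _
  obtain ⟨N, hN⟩ := eventually_atTop.1 ((hlim.eventually_lt_const (half_pos hε)).and
    (eventually_gt_atTop 0))
  refine ⟨N, fun n hn => ?_⟩
  obtain ⟨h1, hn0⟩ := hN n hn
  have hn' : (0 : ℝ) < n := by exact_mod_cast hn0
  rw [trace_cosMat_mul_toep_div hh, Real.dist_eq]
  have e' : 2 * (∫ m, h m * fejer n l m ∂halfCircle) - 2 * Real.pi * h l =
      2 * ∫ m, (h m - h l) * fejer n l m ∂halfCircle := by
    simp only [sub_mul]
    rw [integral_sub (integrable_mul_of_continuous hh (continuous_fejer n l))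
      ((integrable_fejer n l).const_mul _), integral_const_mul, integral_fejer hn0]
    ring
  rw [e', abs_mul, abs_two]
  have hb : |∫ m, (h m - h l) * fejer n l m ∂halfCircle| ≤
      ∫ m, (ε / (4 * Real.pi) * fejer n l m + Real.pi ^ 2 / n / δ ^ 2 * |h m - h l|)
        ∂halfCircle := by
    rw [← Real.norm_eq_abs]
    refine norm_integral_le_of_norm_le
      (((integrable_fejer n l).const_mul _).add (hhl.abs.const_mul _)) ?_
    filter_upwards [ae_restrict_mem measurableSet_Ioo] with m hm
    have hf0 := fejer_nonneg n l m
    rw [Real.norm_eq_abs, abs_mul, abs_of_nonneg hf0]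
    by_cases hd : dist m l < δ
    · have := (hδh hd).le
      rw [Real.dist_eq] at this
      have h2 : 0 ≤ Real.pi ^ 2 / n / δ ^ 2 * |h m - h l| := by positivity
      nlinarith [mul_le_mul_of_nonneg_right this hf0]
    · rw [not_lt, Real.dist_eq] at hd
      have h2 := fejer_mul_sq_le hn0 hl hm
      have h3 : fejer n l m ≤ Real.pi ^ 2 / n / δ ^ 2 := by
        rw [le_div_iff₀ (by positivity)]
        refine le_trans (mul_le_mul_of_nonneg_left ?_ hf0) h2
        rw [← sq_abs (l - m), abs_sub_comm]
        exact pow_le_pow_left₀ hδ.le hd 2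
      have h4 : 0 ≤ ε / (4 * Real.pi) * fejer n l m := by positivity
      nlinarith [mul_le_mul_of_nonneg_left h3 (abs_nonneg (h m - h l))]
  rw [integral_add ((integrable_fejer n l).const_mul _) (hhl.abs.const_mul _), integral_const_mul,
    integral_const_mul, integral_fejer hn0, ← hA] at hb
  have e1 : ε / (4 * Real.pi) * Real.pi = ε / 4 := by field_simp
  have e2 : 2 * (Real.pi ^ 2 / n / δ ^ 2 * A) = 2 * (Real.pi ^ 2 / δ ^ 2 * A) / n := by ring
  linarith

lemma qForm_add_smul {n : ℕ} {M : Matrix (Fin n) (Fin n) ℝ} (hM : M.IsHermitian)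
    (x y : Fin n → ℝ) (t : ℝ) :
    qForm M (x + t • y) = qForm M x + 2 * t * (vecMulVec y x * M).trace + t ^ 2 * qForm M y := by
  have e1 : (vecMulVec y x * M).trace = ∑ i, ∑ j, x i * M i j * y j := by
    simp only [Matrix.trace, Matrix.diag, Matrix.mul_apply, Matrix.vecMulVec_apply]
    rw [Finset.sum_comm]
    exact Finset.sum_congr rfl fun i _ => Finset.sum_congr rfl fun j _ => by ring
  have e2 : (vecMulVec y x * M).trace = ∑ i, ∑ j, y i * M i j * x j := by
    simp only [Matrix.trace, Matrix.diag, Matrix.mul_apply, Matrix.vecMulVec_apply]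
    refine Finset.sum_congr rfl fun i _ => Finset.sum_congr rfl fun j _ => ?_
    have := congrFun (congrFun hM i) j
    rw [conjTranspose_apply, star_trivial] at this
    rw [this]; ring
  have : 2 * t * (vecMulVec y x * M).trace =
      t * (∑ i, ∑ j, x i * M i j * y j) + t * (∑ i, ∑ j, y i * M i j * x j) := by
    rw [← e1, ← e2]; ring
  rw [this]
  simp only [qForm, Finset.mul_sum, ← Finset.sum_add_distrib, Pi.add_apply, Pi.smul_apply,
    smul_eq_mul]
  refine Finset.sum_congr rfl fun i _ => Finset.sum_congr rfl fun j _ => ?_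
  ring

lemma trace_vecMulVec_mul {n : ℕ} (M : Matrix (Fin n) (Fin n) ℝ) (x y : Fin n → ℝ) :
    (vecMulVec y x * M).trace = x ⬝ᵥ M *ᵥ y := by
  rw [vecMulVec_mul, trace_vecMulVec, dotProduct_comm, ← dotProduct_mulVec]

section inverse
variable {n : ℕ} {S : Matrix (Fin n) (Fin n) ℝ}

lemma qForm_mulVec_self_inv (hS : S.PosDef) (x : Fin n → ℝ) :
    qForm S (S⁻¹ *ᵥ x) = qForm S⁻¹ x := by
  have hu : IsUnit S.det := isUnit_iff_ne_zero.2 hS.det_pos.ne'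
  rw [qForm_eq_dotProduct, qForm_eq_dotProduct, Matrix.mulVec_mulVec,
    Matrix.mul_nonsing_inv _ hu, Matrix.one_mulVec, dotProduct_comm]

lemma qForm_inv_lower (hS : S.PosDef) (x : Fin n → ℝ) (τ : ℝ) :
    2 * τ * ∑ k, x k ^ 2 - τ ^ 2 * qForm S x ≤ qForm S⁻¹ x := by
  have hu : IsUnit S.det := isUnit_iff_ne_zero.2 hS.det_pos.ne'
  have h : 0 ≤ qForm S (S⁻¹ *ᵥ x + (-τ) • x) := by
    rw [qForm_eq_dotProduct]
    exact hS.posSemidef.dotProduct_mulVec_nonneg _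
  rw [qForm_add_smul hS.isHermitian, qForm_mulVec_self_inv hS, trace_vecMulVec_mul,
    dotProduct_comm] at h
  have e : (S *ᵥ x) ⬝ᵥ (S⁻¹ *ᵥ x) = ∑ k, x k ^ 2 := by
    rw [dotProduct_mulVec, ← mulVec_transpose, ← Matrix.conjTranspose_eq_transpose_of_trivial,
      hS.isHermitian.inv.eq, Matrix.mulVec_mulVec, Matrix.nonsing_inv_mul _ hu,
      Matrix.one_mulVec]
    simp [dotProduct, sq]
  rw [e] at h
  linarith
end inverse

namespace PowerSymbol
variable {a c C : ℝ} {f : ℝ → ℝ}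

lemma inv (hf : PowerSymbol a c C f) : PowerSymbol (-a) C⁻¹ c⁻¹ fun l => (f l)⁻¹ where
  neg_one_lt := by linarith [hf.lt_one]
  lt_one := by linarith [hf.neg_one_lt]
  c_pos := inv_pos.2 hf.C_pos
  lower l hl := by
    rw [Real.rpow_neg hl.1.le, ← mul_inv]
    exact inv_anti₀ (hf.pos hl) (hf.upper l hl)
  upper l hl := by
    rw [Real.rpow_neg hl.1.le, ← mul_inv]
    exact inv_anti₀ (mul_pos hf.c_pos (Real.rpow_pos_of_pos hl.1 a)) (hf.lower l hl)
  continuousOn := hf.continuousOn.inv₀ fun l hl => (hf.pos hl).ne'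

lemma qForm_inv_upper (hf : PowerSymbol a c C f) {n : ℕ} (x : Fin n → ℝ) :
    4 * Real.pi ^ 2 * qForm (toep n f)⁻¹ x ≤ qForm (toep n fun l => (f l)⁻¹) x := by
  have hS := hf.posDef_toep n
  have hu : IsUnit (toep n f).det := isUnit_iff_ne_zero.2 hS.det_pos.ne'
  set y := (toep n f)⁻¹ *ᵥ x with hy
  set s : ℝ := 2 * Real.pi
  have e1 : (vecMulVec y x * toep n fun _ => 1).trace = 2 * Real.pi * qForm (toep n f)⁻¹ x := by
    rw [toep_one, Matrix.mul_smul, Matrix.mul_one, Matrix.trace_smul, trace_vecMulVec,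
      qForm_eq_dotProduct, dotProduct_comm, smul_eq_mul]
  have e2 := qForm_mulVec_self_inv hS x
  rw [← hy, qForm_toep hf.integrable] at e2
  rw [trace_mul_toep (integrable_const _)] at e1
  simp only [one_mul] at e1
  rw [qForm_toep hf.inv.integrable]
  have i1 := integrable_mul_of_continuous hf.inv.integrable (continuous_qForm_cosMat x)
  have i2 := integrable_mul_of_continuous (integrable_const (1 : ℝ))
    (continuous_trace_mul_cosMat (vecMulVec y x))
  simp only [one_mul] at i2
  have i3 := integrable_mul_of_continuous hf.integrable (continuous_qForm_cosMat y)
  have h : 0 ≤ ∫ l, ((f l)⁻¹ * qForm (cosMat n l) x - 2 * s *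
      (vecMulVec y x * cosMat n l).trace + s ^ 2 * (f l * qForm (cosMat n l) y))
      ∂halfCircle := by
    refine setIntegral_nonneg measurableSet_Ioo fun l hl => ?_
    have hfl := hf.pos hl
    have h0 := mul_nonneg (inv_pos.2 hfl).le
      (qForm_cosMat_nonneg l (x + (-(s * f l)) • y))
    rw [qForm_add_smul (isHermitian_cosMat n l)] at h0
    refine h0.trans_eq ?_
    field_simp
    ring
  have i12 : Integrable (fun l => (f l)⁻¹ * qForm (cosMat n l) x - 2 * s *
      (vecMulVec y x * cosMat n l).trace) halfCircle := i1.sub (i2.const_mul _)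
  rw [integral_add i12 (i3.const_mul _), integral_sub i1 (i2.const_mul _),
    integral_const_mul (2 * s), integral_const_mul (s ^ 2)] at h
  have e1' : ∫ l, (vecMulVec y x * cosMat n l).trace ∂halfCircle =
      Real.pi * qForm (toep n f)⁻¹ x := by linarith
  have e2' : ∫ l, f l * qForm (cosMat n l) y ∂halfCircle = qForm (toep n f)⁻¹ x / 2 := by linarith
  rw [e1', e2'] at h
  simp only [s] at h
  linarith

/-- The normalized trace of `T(f)⁻¹ M_l`. -/
def invTrace (f : ℝ → ℝ) (n : ℕ) (l : ℝ) : ℝ := ((toep n f)⁻¹ * cosMat n l).trace / n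

lemma continuous_invTrace (f : ℝ → ℝ) (n : ℕ) : Continuous (invTrace f n) :=
  (continuous_trace_mul_cosMat _).div_const _

lemma invTrace_nonneg (hf : PowerSymbol a c C f) (n : ℕ) (l : ℝ) : 0 ≤ invTrace f n l := by
  refine div_nonneg ?_ n.cast_nonneg
  rw [trace_mul_cosMat]
  have := qForm_inv_lower (hf.posDef_toep n) (cosVec n l) 0
  have := qForm_inv_lower (hf.posDef_toep n) (sinVec n l) 0
  simp only [mul_zero, zero_mul, ne_eq, OfNat.ofNat_ne_zero, not_false_eq_true, zero_pow,
    sub_zero] at *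
  linarith

lemma invTrace_lower (hf : PowerSymbol a c C f) {n : ℕ} (hn : 0 < n) (l τ : ℝ) :
    2 * τ - τ ^ 2 * ((cosMat n l * toep n f).trace / n) ≤ invTrace f n l := by
  have hn' : (0 : ℝ) < n := by exact_mod_cast hn
  rw [invTrace, Matrix.trace_mul_comm (cosMat n l), trace_mul_cosMat, trace_mul_cosMat,
    le_div_iff₀ hn']
  have h1 := qForm_inv_lower (hf.posDef_toep n) (cosVec n l) τ
  have h2 := qForm_inv_lower (hf.posDef_toep n) (sinVec n l) τ
  have h3 := sum_sq_cosVec_add n l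
  have e : (2 * τ - τ ^ 2 * ((qForm (toep n f) (cosVec n l) + qForm (toep n f) (sinVec n l)) / n))
      * n = 2 * τ * n - τ ^ 2 * (qForm (toep n f) (cosVec n l) + qForm (toep n f) (sinVec n l)) := by
    field_simp
  rw [e, ← h3]
  linarith

lemma invTrace_upper (hf : PowerSymbol a c C f) (n : ℕ) (l : ℝ) :
    4 * Real.pi ^ 2 * invTrace f n l ≤ (cosMat n l * toep n fun l => (f l)⁻¹).trace / n := by
  rw [invTrace, Matrix.trace_mul_comm (cosMat n l), trace_mul_cosMat, trace_mul_cosMat,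
    ← mul_div_assoc]
  refine div_le_div_of_nonneg_right ?_ n.cast_nonneg
  have h1 := hf.qForm_inv_upper (cosVec n l)
  have h2 := hf.qForm_inv_upper (sinVec n l)
  linarith

lemma continuousAt (hf : PowerSymbol a c C f) {l : ℝ} (hl : l ∈ Set.Ioo 0 Real.pi) :
    ContinuousAt f l := hf.continuousOn.continuousAt (isOpen_Ioo.mem_nhds hl)

lemma tendsto_invTrace (hf : PowerSymbol a c C f) {l : ℝ} (hl : l ∈ Set.Ioo 0 Real.pi) :
    Tendsto (fun n => invTrace f n l) atTop (𝓝 (1 / (2 * Real.pi * f l))) := by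
  have hfl := hf.pos hl
  have hpi := Real.pi_pos
  set τ := 1 / (2 * Real.pi * f l) with hτ
  have h1 := ((tendsto_trace_cosMat_mul_toep hf.integrable hl (hf.continuousAt hl)).const_mul
    (τ ^ 2)).const_sub (2 * τ)
  have h2 := (tendsto_trace_cosMat_mul_toep hf.inv.integrable hl (hf.inv.continuousAt hl)).const_mul
    (1 / (4 * Real.pi ^ 2))
  have e1 : 2 * τ - τ ^ 2 * (2 * Real.pi * f l) = τ := by
    rw [hτ]; field_simp; ring
  have e2 : 1 / (4 * Real.pi ^ 2) * (2 * Real.pi * (f l)⁻¹) = τ := by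
    rw [hτ]; field_simp; ring
  rw [e1] at h1
  rw [e2] at h2
  refine tendsto_of_tendsto_of_tendsto_of_le_of_le' h1 h2 ?_ ?_
  · filter_upwards [eventually_gt_atTop 0] with n hn using hf.invTrace_lower hn l τ
  · filter_upwards with n
    have := hf.invTrace_upper n l
    rw [one_div_mul_eq_div, le_div_iff₀ (by positivity)]
    linarith

lemma rpow_le_const_mul_rpow {l r s : ℝ} (hl : l ∈ Set.Ioo 0 Real.pi) (h : s ≤ r) :
    l ^ r ≤ Real.pi ^ (r - s) * l ^ s := by
  have e : l ^ r = l ^ (r - s) * l ^ s := by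
    rw [← Real.rpow_add hl.1]; congr 1; ring
  rw [e]
  exact mul_le_mul_of_nonneg_right (Real.rpow_le_rpow hl.1.le hl.2.le (by linarith))
    (Real.rpow_nonneg hl.1.le _)

lemma exists_mul_invTrace_le (hf : PowerSymbol a c C f) :
    ∃ D, 0 ≤ D ∧ ∀ n, 0 < n → ∀ l ∈ Set.Ioo 0 Real.pi,
      f l * invTrace f n l ≤ D * l ^ (-((1 + |a|) / 2)) := by
  have hpi := Real.pi_pos
  have hC := hf.C_pos
  have hc := hf.c_pos
  set ρ := (1 + |a|) / 2 with hρ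
  have ha1 : |a| < 1 := abs_lt.2 ⟨hf.neg_one_lt, hf.lt_one⟩
  have hρa : |a| < ρ := by rw [hρ]; linarith
  have hρ1 : ρ < 1 := by rw [hρ]; linarith
  have haρ : a < ρ := (le_abs_self a).trans_lt hρa
  have haρ' : 0 < a + ρ := by linarith [neg_abs_le a]
  have hρ0 : 0 < ρ := (abs_nonneg a).trans_lt hρa
  set J : ℝ := ∫ m, m ^ (-ρ) ∂halfCircle with hJ
  have hJi := integrable_rpow_halfCircle (r := -ρ) (by linarith)
  have hJ0 : 0 ≤ J := setIntegral_nonneg measurableSet_Ioo fun l hl => Real.rpow_nonneg hl.1.le _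
  set E : ℝ := 2 + Real.pi ^ ρ with hE
  have hE0 : 0 ≤ E := by positivity
  set D₁ : ℝ := Real.pi ^ ρ + Real.pi ^ ρ * 2 with hD₁
  refine ⟨2 * (C * c⁻¹ * (D₁ * Real.pi + 2 * Real.pi * Real.pi ^ (ρ - 1 - -ρ) * J)) /
    (4 * Real.pi ^ 2), by positivity, ?_⟩
  intro n hn l hl
  have hl0 := hl.1
  have hfl := hf.pos hl
  have key : ∀ m ∈ Set.Ioo 0 Real.pi, f l * ((f m)⁻¹ * fejer n l m) ≤
      C * c⁻¹ * (D₁ * l ^ (-ρ) * fejer n l m +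
        2 * Real.pi * Real.pi ^ (ρ - 1 - -ρ) * l ^ (-ρ) * m ^ (-ρ)) := by
    intro m hm
    have hm0 := hm.1
    have hF := fejer_nonneg n l m
    have h1 : f l * (f m)⁻¹ ≤ C * c⁻¹ * (l ^ a * m ^ (-a)) := by
      calc f l * (f m)⁻¹ ≤ (C * l ^ a) * (c⁻¹ * m ^ (-a)) :=
            mul_le_mul (hf.upper l hl) (hf.inv.upper m hm) (inv_pos.2 (hf.pos hm)).le
              (by positivity)
        _ = _ := by ring
    have h2 : l ^ a * m ^ (-a) * fejer n l m ≤ D₁ * l ^ (-ρ) * fejer n l m +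
        2 * Real.pi * Real.pi ^ (ρ - 1 - -ρ) * l ^ (-ρ) * m ^ (-ρ) := by
      rcases le_or_gt (l / 2) m with h | h
      · have h3 : l ^ a * m ^ (-a) ≤ D₁ * l ^ (-ρ) := by
          rcases le_or_gt 0 a with ha | ha
          · have h4 : m ^ (-a) ≤ (l / 2) ^ (-a) :=
              Real.rpow_le_rpow_of_nonpos (by positivity) h (by linarith)
            have h5 : (l / 2) ^ (-a) = l ^ (-a) * 2 ^ a := by
              rw [Real.div_rpow hl0.le zero_le_two, Real.rpow_neg zero_le_two, div_inv_eq_mul]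
            have h6 : l ^ a * l ^ (-a) = 1 := by
              rw [← Real.rpow_add hl0]; simp
            have h7 : (2 : ℝ) ^ a ≤ 2 := by
              calc (2 : ℝ) ^ a ≤ 2 ^ (1 : ℝ) :=
                    Real.rpow_le_rpow_of_exponent_le one_le_two hf.lt_one.le
                _ = 2 := by simp
            have h8 := rpow_le_const_mul_rpow (r := 0) (s := -ρ) hl (by linarith)
            rw [Real.rpow_zero, zero_sub, neg_neg] at h8
            calc l ^ a * m ^ (-a) ≤ l ^ a * (l ^ (-a) * 2 ^ a) := by
                  rw [← h5]; exact mul_le_mul_of_nonneg_left h4 (by positivity)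
              _ = 2 ^ a := by rw [← mul_assoc, h6, one_mul]
              _ ≤ 1 * 2 := by linarith
              _ ≤ Real.pi ^ ρ * l ^ (-ρ) * 2 := by gcongr
              _ ≤ D₁ * l ^ (-ρ) := by
                have : 0 ≤ Real.pi ^ ρ * l ^ (-ρ) := by positivity
                rw [hD₁]; linarith
          · have h4 := rpow_le_const_mul_rpow (r := a) (s := -ρ) hl (by linarith)
            have h5 : m ^ (-a) ≤ Real.pi ^ (-a) :=
              Real.rpow_le_rpow hm0.le hm.2.le (by linarith)
            calc l ^ a * m ^ (-a) ≤ (Real.pi ^ (a - -ρ) * l ^ (-ρ)) * Real.pi ^ (-a) :=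
                  mul_le_mul h4 h5 (by positivity) (by positivity)
              _ = (Real.pi ^ (a - -ρ) * Real.pi ^ (-a)) * l ^ (-ρ) := by ring
              _ = Real.pi ^ ρ * l ^ (-ρ) := by
                rw [← Real.rpow_add hpi]; congr 2; ring
              _ ≤ D₁ * l ^ (-ρ) := by
                have : 0 ≤ Real.pi ^ ρ * l ^ (-ρ) := by positivity
                rw [hD₁]; linarith
        have h4 : 0 ≤ 2 * Real.pi * Real.pi ^ (ρ - 1 - -ρ) * l ^ (-ρ) * m ^ (-ρ) := by positivity
        linarith [mul_le_mul_of_nonneg_right h3 hF]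
      · have h3 : fejer n l m ≤ 2 * Real.pi * l ^ (-1 : ℝ) := by
          have h4 := fejer_mul_abs_le hn hl hm
          have h5 : l / 2 ≤ |l - m| := (by linarith : l / 2 ≤ l - m).trans (le_abs_self _)
          have h6 := (mul_le_mul_of_nonneg_left h5 hF).trans h4
          rw [Real.rpow_neg_one, ← div_eq_mul_inv, le_div_iff₀ hl0]
          linarith
        have h4 : m ^ (-a) ≤ m ^ (-ρ) * l ^ (ρ - a) := by
          have e : m ^ (-a) = m ^ (-ρ) * m ^ (ρ - a) := by
            rw [← Real.rpow_add hm0]; congr 1; ring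
          rw [e]
          exact mul_le_mul_of_nonneg_left (Real.rpow_le_rpow hm0.le (by linarith) (by linarith))
            (by positivity)
        have h5 := rpow_le_const_mul_rpow (r := ρ - 1) (s := -ρ) hl
          (by rw [hρ]; linarith [abs_nonneg a])
        have h6 : 0 ≤ D₁ * l ^ (-ρ) * fejer n l m := by positivity
        calc l ^ a * m ^ (-a) * fejer n l m
            ≤ l ^ a * (m ^ (-ρ) * l ^ (ρ - a)) * (2 * Real.pi * l ^ (-1 : ℝ)) := by
              gcongr
          _ = 2 * Real.pi * (l ^ a * l ^ (ρ - a) * l ^ (-1 : ℝ)) * m ^ (-ρ) := by ring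
          _ = 2 * Real.pi * l ^ (ρ - 1) * m ^ (-ρ) := by
              rw [← Real.rpow_add hl0, ← Real.rpow_add hl0]; congr 3; ring
          _ ≤ 2 * Real.pi * (Real.pi ^ (ρ - 1 - -ρ) * l ^ (-ρ)) * m ^ (-ρ) := by gcongr
          _ ≤ _ := by linarith
    calc f l * ((f m)⁻¹ * fejer n l m) = f l * (f m)⁻¹ * fejer n l m := by ring
      _ ≤ C * c⁻¹ * (l ^ a * m ^ (-a)) * fejer n l m := mul_le_mul_of_nonneg_right h1 hF
      _ = C * c⁻¹ * (l ^ a * m ^ (-a) * fejer n l m) := by ring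
      _ ≤ _ := mul_le_mul_of_nonneg_left h2 (by positivity)
  have hu := hf.invTrace_upper n l
  rw [trace_cosMat_mul_toep_div hf.inv.integrable] at hu
  have i1 := integrable_mul_of_continuous hf.inv.integrable (continuous_fejer n l)
  have i2 := (integrable_fejer n l).const_mul (D₁ * l ^ (-ρ))
  have i3 := hJi.const_mul (2 * Real.pi * Real.pi ^ (ρ - 1 - -ρ) * l ^ (-ρ))
  have hint := setIntegral_mono_on (i1.const_mul (f l)) ((i2.add i3).const_mul (C * c⁻¹))
    measurableSet_Ioo key
  rw [integral_const_mul, integral_const_mul] at hint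
  have e : ∫ m, ((fun m => D₁ * l ^ (-ρ) * fejer n l m) +
      fun m => 2 * Real.pi * Real.pi ^ (ρ - 1 - -ρ) * l ^ (-ρ) * m ^ (-ρ)) m ∂halfCircle =
      (D₁ * Real.pi + 2 * Real.pi * Real.pi ^ (ρ - 1 - -ρ) * J) * l ^ (-ρ) := by
    rw [integral_add' i2 i3, integral_const_mul, integral_const_mul, integral_fejer hn]
    ring
  rw [e] at hint
  rw [div_mul_eq_mul_div, le_div_iff₀ (by positivity)]
  have := mul_le_mul_of_nonneg_left hu hfl.le
  linarith

lemma tendsto_trace_inv_mul_toep (hf : PowerSymbol a c C f) {ψ : ℝ → ℝ} {B ε : ℝ}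
    (hε : ε < (1 - |a|) / 2) (hψ : AEStronglyMeasurable ψ halfCircle)
    (hB : ∀ l ∈ Set.Ioo 0 Real.pi, |ψ l| ≤ B * l ^ (-ε)) :
    Tendsto (fun n : ℕ => ((toep n f)⁻¹ * toep n fun l => f l * ψ l).trace / n) atTop
      (𝓝 (1 / Real.pi * ∫ l, ψ l ∂halfCircle)) := by
  have hpi := Real.pi_pos
  have ha1 : |a| < 1 := abs_lt.2 ⟨hf.neg_one_lt, hf.lt_one⟩
  obtain ⟨D, hD0, hD⟩ := hf.exists_mul_invTrace_le
  have hi : Integrable (fun l => f l * ψ l) halfCircle :=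
    hf.integrable_mul (by linarith [neg_abs_le a, abs_nonneg a]) hψ hB
  have e : ∀ n : ℕ, ((toep n f)⁻¹ * toep n fun l => f l * ψ l).trace / n =
      2 * ∫ l, f l * ψ l * invTrace f n l ∂halfCircle := by
    intro n
    rw [trace_mul_toep hi, mul_div_assoc, ← integral_div]
    simp only [invTrace, mul_div_assoc]
  simp only [e]
  have e2 : 1 / Real.pi * ∫ l, ψ l ∂halfCircle =
      2 * ∫ l, ψ l * (1 / (2 * Real.pi)) ∂halfCircle := by
    rw [integral_mul_const]; field_simp
  rw [e2]
  refine Tendsto.const_mul _ ?_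
  have hr : -1 < -((1 + |a|) / 2) - ε := by linarith
  refine tendsto_integral_filter_of_dominated_convergence
    (fun l => D * B * l ^ (-((1 + |a|) / 2) - ε)) ?_ ?_
    ((integrable_rpow_halfCircle hr).const_mul _) ?_
  · exact Eventually.of_forall fun n =>
      hi.aestronglyMeasurable.mul (continuous_invTrace f n).aestronglyMeasurable
  · filter_upwards [eventually_gt_atTop 0] with n hn
    filter_upwards [ae_restrict_mem measurableSet_Ioo] with l hl
    have hfl := hf.pos hl
    have h0 := hf.invTrace_nonneg n l
    rw [Real.norm_eq_abs, abs_mul, abs_mul, abs_of_pos hfl, abs_of_nonneg h0, sub_eq_add_neg,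
      Real.rpow_add hl.1]
    calc f l * |ψ l| * invTrace f n l = (f l * invTrace f n l) * |ψ l| := by ring
      _ ≤ (D * l ^ (-((1 + |a|) / 2))) * (B * l ^ (-ε)) :=
        mul_le_mul (hD n hn l hl) (hB l hl) (abs_nonneg _)
          (mul_nonneg hD0 (Real.rpow_nonneg hl.1.le _))
      _ = _ := by ring
  · filter_upwards [ae_restrict_mem measurableSet_Ioo] with l hl
    have hfl := hf.pos hl
    have h := (hf.tendsto_invTrace hl).const_mul (f l * ψ l)
    have e3 : f l * ψ l * (1 / (2 * Real.pi * f l)) = ψ l * (1 / (2 * Real.pi)) := by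
      field_simp
    rwa [e3] at h

end PowerSymbol

section covInner
variable {n : ℕ} {S X Y : Matrix (Fin n) (Fin n) ℝ}

lemma covInner_toep {h : ℝ → ℝ} (hh : Integrable h halfCircle) :
    covInner S X (toep n h) = 2 * ∫ l, h l * covInner S X (cosMat n l) ∂halfCircle :=
  trace_mul_toep hh _

lemma continuous_covInner_cosMat (S X : Matrix (Fin n) (Fin n) ℝ) :
    Continuous fun l => covInner S X (cosMat n l) := continuous_trace_mul_cosMat _

lemma covInner_self_left (hS : S.PosDef) : covInner S S Y = (S⁻¹ * Y).trace := by
  have hu : IsUnit S.det := isUnit_iff_ne_zero.2 hS.det_pos.ne'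
  rw [covInner, Matrix.nonsing_inv_mul _ hu, Matrix.one_mul]

lemma covInner_cosMat_mono (hS : S.PosDef) (h : ∀ x, qForm X x ≤ qForm Y x) (l : ℝ) :
    covInner S X (cosMat n l) ≤ covInner S Y (cosMat n l) := by
  have e : ∀ (X : Matrix (Fin n) (Fin n) ℝ) x, qForm (S⁻¹ * X * S⁻¹) x = qForm X (S⁻¹ *ᵥ x) := by
    intro X x
    rw [qForm_mulVec, ← Matrix.conjTranspose_eq_transpose_of_trivial, hS.isHermitian.inv.eq]
  rw [covInner, covInner, trace_mul_cosMat, trace_mul_cosMat, e, e, e, e]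
  exact add_le_add (h _) (h _)

end covInner

namespace PowerSymbol
variable {a c C : ℝ} {f : ℝ → ℝ} {n : ℕ}

/-- The excess `tr (T(f)⁻¹ T(f q²)) - tr (T(f)⁻¹ T(f q) T(f)⁻¹ T(f q))`. -/
def traceDefect (f : ℝ → ℝ) (n : ℕ) (q : ℝ → ℝ) : ℝ :=
  ((toep n f)⁻¹ * toep n fun l => f l * q l ^ 2).trace -
    covInner (toep n f) (toep n fun l => f l * q l) (toep n fun l => f l * q l)

/-- The symbol `f (q - q m)²`. -/
def oscSymbol (f q : ℝ → ℝ) (m l : ℝ) : ℝ := f l * (q l - q m) ^ 2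

lemma oscSymbol_eq (f q : ℝ → ℝ) (m : ℝ) : oscSymbol f q m = fun l =>
    f l * q l ^ 2 + ((-2 * q m) * (f l * q l) + q m ^ 2 * f l) := by
  funext l; unfold oscSymbol; ring

lemma integrable_oscSymbol {q : ℝ → ℝ} (hf : Integrable f halfCircle)
    (h1 : Integrable (fun l => f l * q l) halfCircle)
    (h2 : Integrable (fun l => f l * q l ^ 2) halfCircle) (m : ℝ) :
    Integrable (oscSymbol f q m) halfCircle := by
  rw [oscSymbol_eq]
  exact h2.add ((h1.const_mul _).add (hf.const_mul _))

lemma toep_oscSymbol {q : ℝ → ℝ} (hf : Integrable f halfCircle)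
    (h1 : Integrable (fun l => f l * q l) halfCircle)
    (h2 : Integrable (fun l => f l * q l ^ 2) halfCircle) (m : ℝ) :
    toep n (oscSymbol f q m) = toep n (fun l => f l * q l ^ 2) +
      ((-2 * q m) • toep n (fun l => f l * q l) + q m ^ 2 • toep n f) := by
  have h3 : Integrable (fun l => (-2 * q m) * (f l * q l) + q m ^ 2 * f l) halfCircle :=
    (h1.const_mul _).add (hf.const_mul _)
  rw [oscSymbol_eq, toep_add h2 h3,
    toep_add (h1.const_mul _) (hf.const_mul _), toep_const_mul, toep_const_mul]

lemma traceDefect_eq (hf : PowerSymbol a c C f) {q : ℝ → ℝ}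
    (h1 : Integrable (fun l => f l * q l) halfCircle)
    (h2 : Integrable (fun l => f l * q l ^ 2) halfCircle) :
    Integrable (fun m => f m * covInner (toep n f) (toep n (oscSymbol f q m)) (cosMat n m))
      halfCircle ∧
    traceDefect f n q =
      ∫ m, f m * covInner (toep n f) (toep n (oscSymbol f q m)) (cosMat n m) ∂halfCircle := by
  have hS := hf.posDef_toep n
  set S := toep n f with hSdef
  set X := toep n (fun l => f l * q l) with hX
  set Y := toep n (fun l => f l * q l ^ 2) with hY
  have e : (fun m => f m * covInner S (toep n (oscSymbol f q m)) (cosMat n m)) =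
      fun m => f m * covInner S Y (cosMat n m) + ((-2) * (f m * q m * covInner S X (cosMat n m)) +
        f m * q m ^ 2 * covInner S S (cosMat n m)) := by
    funext m
    rw [toep_oscSymbol hf.integrable h1 h2, covInner_add_left, covInner_add_left,
      covInner_smul_left, covInner_smul_left]
    ring
  have i1 := integrable_mul_of_continuous hf.integrable (continuous_covInner_cosMat S Y)
  have i2 := (integrable_mul_of_continuous h1 (continuous_covInner_cosMat S X)).const_mul (-2)
  have i3 := integrable_mul_of_continuous h2 (continuous_covInner_cosMat S S)
  have i23 : Integrable (fun m => (-2) * (f m * q m * covInner S X (cosMat n m)) +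
        f m * q m ^ 2 * covInner S S (cosMat n m)) halfCircle := i2.add i3
  rw [e]
  refine ⟨i1.add i23, ?_⟩
  rw [integral_add i1 i23, integral_add i2 i3, integral_const_mul]
  have t1 : covInner S Y S = 2 * ∫ m, f m * covInner S Y (cosMat n m) ∂halfCircle :=
    covInner_toep hf.integrable
  have t2 : covInner S X X = 2 * ∫ m, f m * q m * covInner S X (cosMat n m) ∂halfCircle :=
    covInner_toep h1
  have t3 : covInner S S Y = 2 * ∫ m, f m * q m ^ 2 * covInner S S (cosMat n m) ∂halfCircle :=
    covInner_toep h2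
  have t4 : covInner S Y S = (S⁻¹ * Y).trace := by
    rw [covInner_comm, covInner_self_left hS]
  rw [covInner_self_left hS] at t3
  simp only [traceDefect, ← hSdef, ← hX, ← hY]
  linarith

lemma traceDefect_le_add (hf : PowerSymbol a c C f) {q q₁ q₂ : ℝ → ℝ} {α β : ℝ}
    (h1 : Integrable (fun l => f l * q l) halfCircle)
    (h2 : Integrable (fun l => f l * q l ^ 2) halfCircle)
    (h11 : Integrable (fun l => f l * q₁ l) halfCircle)
    (h12 : Integrable (fun l => f l * q₁ l ^ 2) halfCircle)
    (h21 : Integrable (fun l => f l * q₂ l) halfCircle)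
    (h22 : Integrable (fun l => f l * q₂ l ^ 2) halfCircle)
    (h : ∀ l ∈ Set.Ioo 0 Real.pi, ∀ m ∈ Set.Ioo 0 Real.pi,
      (q l - q m) ^ 2 ≤ α * (q₁ l - q₁ m) ^ 2 + β * (q₂ l - q₂ m) ^ 2) :
    traceDefect f n q ≤ α * traceDefect f n q₁ + β * traceDefect f n q₂ := by
  obtain ⟨i, e⟩ := hf.traceDefect_eq (n := n) h1 h2
  obtain ⟨i1, e1⟩ := hf.traceDefect_eq (n := n) h11 h12
  obtain ⟨i2, e2⟩ := hf.traceDefect_eq (n := n) h21 h22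
  rw [e, e1, e2, ← integral_const_mul, ← integral_const_mul, ← integral_add
    (i1.const_mul _) (i2.const_mul _)]
  refine setIntegral_mono_on i ((i1.const_mul _).add (i2.const_mul _)) measurableSet_Ioo
    fun m hm => ?_
  have j1 := integrable_oscSymbol hf.integrable h11 h12 m
  have j2 := integrable_oscSymbol hf.integrable h21 h22 m
  have hq : ∀ x, qForm (toep n (oscSymbol f q m)) x ≤
      qForm (α • toep n (oscSymbol f q₁ m) + β • toep n (oscSymbol f q₂ m)) x := by
    intro x
    rw [← toep_const_mul, ← toep_const_mul, ← toep_add (j1.const_mul _) (j2.const_mul _)]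
    refine qForm_toep_mono (integrable_oscSymbol hf.integrable h1 h2 m)
      ((j1.const_mul _).add (j2.const_mul _)) (fun l hl => ?_) x
    have := mul_le_mul_of_nonneg_left (h l hl m hm) (hf.pos hl).le
    unfold oscSymbol
    refine this.trans_eq ?_
    simp only [Pi.add_apply]
    ring
  have := mul_le_mul_of_nonneg_left (covInner_cosMat_mono (hf.posDef_toep n) hq m) (hf.pos hm).le
  rw [covInner_add_left, covInner_smul_left, covInner_smul_left] at this
  linarith

lemma traceDefect_zero (f : ℝ → ℝ) (n : ℕ) : traceDefect f n (fun _ => 0) = 0 := by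
  have : toep n (fun _ => (0 : ℝ)) = 0 := by ext i j; simp [toep]
  simp [traceDefect, this, covInner]

lemma traceDefect_nonneg (hf : PowerSymbol a c C f) {q : ℝ → ℝ}
    (h1 : Integrable (fun l => f l * q l) halfCircle)
    (h2 : Integrable (fun l => f l * q l ^ 2) halfCircle) : 0 ≤ traceDefect f n q := by
  have hz : Integrable (fun l => f l * (0 : ℝ)) halfCircle := by simp
  have hz' : Integrable (fun l => f l * (0 : ℝ) ^ 2) halfCircle := by simp
  have := hf.traceDefect_le_add (n := n) (q := fun _ => 0) (α := 1) (β := 0) hz hz' h1 h2 h1 h2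
    (fun l _ m _ => by nlinarith [sq_nonneg (q l - q m)])
  rw [traceDefect_zero] at this
  linarith

lemma traceDefect_le_trace (hf : PowerSymbol a c C f) (q : ℝ → ℝ) :
    traceDefect f n q ≤ ((toep n f)⁻¹ * toep n fun l => f l * q l ^ 2).trace := by
  have := covInner_self_nonneg (hf.posDef_toep n) (isHermitian_toep n fun l => f l * q l)
  unfold traceDefect
  linarith

/-! ### The defect of the cosine -/

section cosine

lemma toep_mul_cos_apply (hf : Integrable f halfCircle) {i i₁ i₂ : Fin n} (j : Fin n)
    (h₁ : (i₁ : ℕ) = i + 1) (h₂ : (i : ℕ) = i₂ + 1) :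
    toep n (fun l => f l * Real.cos l) i j = (toep n f i₁ j + toep n f i₂ j) / 2 := by
  simp only [toep]
  rw [← mul_add, ← integral_add (integrable_mul_of_continuous hf (continuous_cosMat_apply i₁ j))
    (integrable_mul_of_continuous hf (continuous_cosMat_apply i₂ j)), mul_div_assoc,
    ← integral_div]
  congr 1
  refine integral_congr_ae (ae_of_all _ fun l => ?_)
  simp only [cosMat, h₁, h₂]
  push_cast
  rw [show ((i₂ : ℕ) + 1 + 1 - (j : ℕ) : ℝ) * l = ((i₂ : ℕ) + 1 - (j : ℕ) : ℝ) * l + l by ring,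
    show ((i₂ : ℕ) - (j : ℕ) : ℝ) * l = ((i₂ : ℕ) + 1 - (j : ℕ) : ℝ) * l - l by ring,
    Real.cos_add, Real.cos_sub]
  ring

/-- The Schur-complement type matrix `T(f cos²) - T(f cos) T(f)⁻¹ T(f cos)`. -/
def cosSchur (f : ℝ → ℝ) (n : ℕ) : Matrix (Fin n) (Fin n) ℝ :=
  toep n (fun l => f l * Real.cos l * Real.cos l) -
    toep n (fun l => f l * Real.cos l) * (toep n f)⁻¹ * toep n (fun l => f l * Real.cos l)

lemma cosSchur_apply_eq_zero (hf : PowerSymbol a c C f) {i i₁ i₂ : Fin n} (j : Fin n)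
    (h₁ : (i₁ : ℕ) = i + 1) (h₂ : (i : ℕ) = i₂ + 1) : cosSchur f n i j = 0 := by
  have hS := hf.posDef_toep n
  have hu : IsUnit (toep n f).det := isUnit_iff_ne_zero.2 hS.det_pos.ne'
  have hfc := integrable_mul_of_continuous hf.integrable Real.continuous_cos
  have hrow : ∀ k, (toep n (fun l => f l * Real.cos l) * (toep n f)⁻¹) i k =
      ((1 : Matrix (Fin n) (Fin n) ℝ) i₁ k + (1 : Matrix (Fin n) (Fin n) ℝ) i₂ k) / 2 := by
    intro k
    rw [← Matrix.mul_nonsing_inv _ hu]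
    simp only [Matrix.mul_apply]
    rw [← Finset.sum_add_distrib, Finset.sum_div]
    refine Finset.sum_congr rfl fun j _ => ?_
    rw [toep_mul_cos_apply hf.integrable j h₁ h₂]
    ring
  rw [cosSchur, Matrix.sub_apply, Matrix.mul_apply, toep_mul_cos_apply hfc j h₁ h₂]
  simp only [hrow, div_mul_eq_mul_div, add_mul]
  rw [← Finset.sum_div, Finset.sum_add_distrib, ← Matrix.mul_apply, ← Matrix.mul_apply,
    Matrix.one_mul]
  ring

lemma isHermitian_cosSchur (f : ℝ → ℝ) (n : ℕ) : (cosSchur f n).IsHermitian := by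
  refine (isHermitian_toep n _).sub ?_
  have h1 := isHermitian_toep n fun l => f l * Real.cos l
  have := isHermitian_conjTranspose_mul_mul (toep n fun l => f l * Real.cos l)
    (isHermitian_toep n f).inv
  rwa [h1.eq] at this

lemma qForm_cosSchur (f : ℝ → ℝ) (n : ℕ) (x : Fin n → ℝ) :
    qForm (cosSchur f n) x = qForm (toep n fun l => f l * Real.cos l * Real.cos l) x -
      qForm (toep n f)⁻¹ ((toep n fun l => f l * Real.cos l) *ᵥ x) := by
  rw [cosSchur, qForm_sub, qForm_mulVec, ← Matrix.conjTranspose_eq_transpose_of_trivial,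
    (isHermitian_toep n fun l => f l * Real.cos l).eq]

lemma abs_qForm_cosSchur_le (hf : PowerSymbol a c C f) (x : Fin n → ℝ) :
    |qForm (cosSchur f n) x| ≤ 1 * qForm (toep n f) x := by
  have hS := hf.posDef_toep n
  have hu : IsUnit (toep n f).det := isUnit_iff_ne_zero.2 hS.det_pos.ne'
  have hfc := integrable_mul_of_continuous hf.integrable Real.continuous_cos
  have hfcc := integrable_mul_of_continuous hfc Real.continuous_cos
  have hup : qForm (cosSchur f n) x ≤ qForm (toep n f) x := by
    have h1 := qForm_inv_lower hS ((toep n fun l => f l * Real.cos l) *ᵥ x) 0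
    have h2 := qForm_toep_mono (n := n) hfcc hf.integrable (fun l hl => by
      have := hf.pos hl
      nlinarith [Real.cos_sq_le_one l]) x
    rw [qForm_cosSchur]
    simp only [mul_zero, zero_mul, ne_eq, OfNat.ofNat_ne_zero, not_false_eq_true, zero_pow,
      sub_zero] at h1
    linarith
  have hlow : 0 ≤ qForm (cosSchur f n) x := by
    rw [qForm_cosSchur]
    set y := (toep n f)⁻¹ *ᵥ ((toep n fun l => f l * Real.cos l) *ᵥ x) with hy
    have e2 := qForm_mulVec_self_inv hS ((toep n fun l => f l * Real.cos l) *ᵥ x)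
    rw [← hy] at e2
    have e1 : (vecMulVec y x * toep n fun l => f l * Real.cos l).trace =
        qForm (toep n f)⁻¹ ((toep n fun l => f l * Real.cos l) *ᵥ x) := by
      rw [trace_vecMulVec_mul, qForm_eq_dotProduct, ← hy, dotProduct_mulVec, ← mulVec_transpose,
        ← Matrix.conjTranspose_eq_transpose_of_trivial, (isHermitian_toep n _).eq]
    rw [qForm_toep hf.integrable] at e2
    rw [trace_mul_toep hfc] at e1
    rw [qForm_toep hfcc]
    have i1 := integrable_mul_of_continuous hfcc (continuous_qForm_cosMat x)
    have i2 := integrable_mul_of_continuous hfc (continuous_trace_mul_cosMat (vecMulVec y x))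
    have i3 := integrable_mul_of_continuous hf.integrable (continuous_qForm_cosMat y)
    have h : 0 ≤ ∫ l, (f l * Real.cos l * Real.cos l * qForm (cosMat n l) x - 2 *
        (f l * Real.cos l * (vecMulVec y x * cosMat n l).trace) + (f l * qForm (cosMat n l) y))
        ∂halfCircle := by
      refine setIntegral_nonneg measurableSet_Ioo fun l hl => ?_
      have h0 := mul_nonneg (hf.pos hl).le
        (qForm_cosMat_nonneg l (y + (-Real.cos l) • x))
      have hcomm : (vecMulVec x y * cosMat n l).trace = (vecMulVec y x * cosMat n l).trace := by
        rw [trace_vecMulVec_mul, trace_vecMulVec_mul, dotProduct_mulVec, ← mulVec_transpose,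
          ← Matrix.conjTranspose_eq_transpose_of_trivial, (isHermitian_cosMat n l).eq,
          dotProduct_comm]
      rw [qForm_add_smul (isHermitian_cosMat n l), hcomm] at h0
      linarith
    have i12 : Integrable (fun l => f l * Real.cos l * Real.cos l * qForm (cosMat n l) x - 2 *
        (f l * Real.cos l * (vecMulVec y x * cosMat n l).trace)) halfCircle :=
      i1.sub (i2.const_mul _)
    rw [integral_add i12 i3, integral_sub i1 (i2.const_mul _), integral_const_mul] at h
    linarith
  rw [abs_of_nonneg hlow, one_mul]
  exact hup

lemma trace_inv_mul_cosSchur_le (hf : PowerSymbol a c C f) :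
    ((toep n f)⁻¹ * cosSchur f n).trace ≤ 2 := by
  have hS := hf.posDef_toep n
  obtain ⟨L, e, hL, hSL, hXe, he⟩ :=
    exists_relative_diagonalization hS (isHermitian_cosSchur f n)
  have he := he 1 (hf.abs_qForm_cosSchur_le)
  have hu : IsUnit L.det := isUnit_iff_ne_zero.2 hL
  have hut : IsUnit Lᵀ.det := by simpa using hu
  have hrank : Fintype.card {i // e i ≠ 0} = (cosSchur f n).rank := by
    rw [hXe, Matrix.rank_mul_eq_left_of_isUnit_det _ _ hut,
      Matrix.rank_mul_eq_right_of_isUnit_det _ _ hu, Matrix.rank_diagonal]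
  set b : Fin n → ℝ := fun i => if (i : ℕ) = 0 ∨ (i : ℕ) + 1 = n then 1 else 0 with hb
  have hD : cosSchur f n = diagonal b * cosSchur f n := by
    ext i j
    rw [Matrix.diagonal_mul]
    by_cases h : (i : ℕ) = 0 ∨ (i : ℕ) + 1 = n
    · simp [hb, h]
    · rw [not_or] at h
      have hi := i.2
      have h1 : (i : ℕ) + 1 < n := by omega
      have h2 : (i : ℕ) - 1 < n := by omega
      rw [hf.cosSchur_apply_eq_zero j (i₁ := ⟨i + 1, h1⟩) (i₂ := ⟨i - 1, h2⟩) rfl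
        (by simp only []; omega), mul_zero]
  have hrank2 : (cosSchur f n).rank ≤ 2 := by
    rw [hD]
    refine (Matrix.rank_mul_le_left _ _).trans ?_
    rw [Matrix.rank_diagonal, Fintype.card_subtype]
    rcases Nat.eq_zero_or_pos n with rfl | hn
    · simp
    · refine (Finset.card_le_card (t := {⟨0, hn⟩, ⟨n - 1, by omega⟩}) ?_).trans
        Finset.card_le_two
      intro i hi
      simp only [hb, Finset.mem_filter, Finset.mem_univ, true_and, ne_eq, ite_eq_right_iff,
        one_ne_zero, imp_false, not_not] at hi
      simp only [Finset.mem_insert, Finset.mem_singleton, Fin.ext_iff]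
      omega
  have ht : ((toep n f)⁻¹ * cosSchur f n).trace = ∑ i, e i := by
    rw [← covInner_self_left hS]
    have : toep n f = L * 1 * Lᵀ := by rw [Matrix.mul_one, hSL]
    calc covInner (toep n f) (toep n f) (cosSchur f n)
        = covInner (L * Lᵀ) (L * 1 * Lᵀ) (L * diagonal e * Lᵀ) := by
          rw [← hXe, Matrix.mul_one, ← hSL]
      _ = _ := by rw [covInner_congr hL, Matrix.one_mul, Matrix.trace_diagonal]
  rw [ht]
  calc ∑ i, e i ≤ ∑ i, if e i ≠ 0 then (1 : ℝ) else 0 := by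
        refine Finset.sum_le_sum fun i _ => ?_
        split_ifs with h
        · exact (le_abs_self _).trans (he i)
        · exact (not_not.1 h).le
    _ = ((Fintype.card {i // e i ≠ 0} : ℕ) : ℝ) := by
        rw [Finset.sum_boole, Fintype.card_subtype]
    _ ≤ 2 := by rw [hrank]; exact_mod_cast hrank2

lemma traceDefect_cos_le (hf : PowerSymbol a c C f) : traceDefect f n Real.cos ≤ 2 := by
  refine le_trans (le_of_eq ?_) (hf.trace_inv_mul_cosSchur_le (n := n))
  have : (fun l => f l * Real.cos l ^ 2) = fun l => f l * Real.cos l * Real.cos l := by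
    funext l; ring
  rw [traceDefect, cosSchur, Matrix.mul_sub, Matrix.trace_sub, covInner, this]
  simp only [Matrix.mul_assoc]

end cosine
end PowerSymbol

lemma exists_polynomial_cos_near {φ : ℝ → ℝ} (hφ : MemLp φ 2 halfCircle) {η : ℝ} (hη : 0 < η) :
    ∃ p : Polynomial ℝ, ∫ l, (φ l - p.eval (Real.cos l)) ^ 2 ∂halfCircle ≤ η := by
  have hpi := Real.pi_pos
  obtain ⟨g, hg, hgL⟩ := MemLp.exists_boundedContinuous_integral_rpow_sub_le (p := 2)
    (by norm_num) (f := φ) (μ := halfCircle) (by simpa using hφ) (show 0 < η / 4 by positivity)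
  obtain ⟨p, hp⟩ := exists_polynomial_near_of_continuousOn (-1) 1 (fun y => g (Real.arccos y))
    (g.continuous.comp Real.continuous_arccos).continuousOn (Real.sqrt (η / (4 * Real.pi)))
    (Real.sqrt_pos.2 (by positivity))
  refine ⟨p, ?_⟩
  have hgL' : MemLp g 2 halfCircle := by simpa using hgL
  have hi : Integrable (fun l => (φ l - g l) ^ 2) halfCircle := (hφ.sub hgL').integrable_sq
  have hg' : ∫ l, (φ l - g l) ^ 2 ∂halfCircle ≤ η / 4 := by
    refine le_trans (le_of_eq ?_) hg
    refine integral_congr_ae (ae_of_all _ fun l => ?_)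
    simp
  have hpc : Continuous fun l => p.eval (Real.cos l) := p.continuous.comp Real.continuous_cos
  have hb : ∫ l, (φ l - p.eval (Real.cos l)) ^ 2 ∂halfCircle ≤
      ∫ l, (2 * (φ l - g l) ^ 2 + 2 * (η / (4 * Real.pi))) ∂halfCircle := by
    refine integral_mono_of_nonneg (ae_of_all _ fun l => sq_nonneg _)
      ((hi.const_mul _).add (integrable_const _)) ?_
    filter_upwards [ae_restrict_mem measurableSet_Ioo] with l hl
    have h1 := hp (Real.cos l) (Real.cos_mem_Icc l)
    rw [Real.arccos_cos hl.1.le hl.2.le] at h1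
    have h2 : (p.eval (Real.cos l) - g l) ^ 2 ≤ η / (4 * Real.pi) := by
      rw [← sq_abs, ← Real.sq_sqrt (show 0 ≤ η / (4 * Real.pi) by positivity)]
      exact pow_le_pow_left₀ (abs_nonneg _) h1.le 2
    nlinarith [sq_nonneg ((φ l - g l) + (p.eval (Real.cos l) - g l))]
  rw [integral_add (hi.const_mul _) (integrable_const _), integral_const_mul] at hb
  have e : ∫ _, 2 * (η / (4 * Real.pi)) ∂halfCircle = η / 2 := by
    rw [integral_const, Measure.real, Measure.restrict_apply_univ, Real.volume_Ioo,
      ENNReal.toReal_ofReal (by linarith), smul_eq_mul]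
    field_simp
    ring
  rw [e] at hb
  linarith

lemma exists_polynomial_lipschitz (p : Polynomial ℝ) :
    ∃ L : ℝ, 0 ≤ L ∧ ∀ x ∈ Set.Icc (-1 : ℝ) 1, ∀ y ∈ Set.Icc (-1 : ℝ) 1,
      (p.eval x - p.eval y) ^ 2 ≤ L * (x - y) ^ 2 := by
  obtain ⟨B, hB⟩ := (isCompact_Icc (a := (-1 : ℝ)) (b := 1)).exists_bound_of_continuousOn
    p.derivative.continuous.continuousOn
  refine ⟨B ^ 2, sq_nonneg _, fun x hx y hy => ?_⟩
  have := (convex_Icc (-1 : ℝ) 1).norm_image_sub_le_of_norm_hasDerivWithin_le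
    (fun z _ => (p.hasDerivAt z).hasDerivWithinAt) hB hy hx
  rw [← sq_abs (p.eval x - p.eval y), ← sq_abs (x - y), ← mul_pow]
  exact pow_le_pow_left₀ (abs_nonneg _) this 2

namespace PowerSymbol
variable {a c C : ℝ} {f : ℝ → ℝ}

lemma traceDefect_polynomial_le (hf : PowerSymbol a c C f) (p : Polynomial ℝ) :
    ∃ K : ℝ, ∀ n, traceDefect f n (fun l => p.eval (Real.cos l)) ≤ K := by
  obtain ⟨L, hL, h⟩ := exists_polynomial_lipschitz p
  have hpc : Continuous fun l => p.eval (Real.cos l) := p.continuous.comp Real.continuous_cos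
  have i1 := integrable_mul_of_continuous hf.integrable hpc
  have i2 := integrable_mul_of_continuous hf.integrable (hpc.pow 2)
  have i3 := integrable_mul_of_continuous hf.integrable Real.continuous_cos
  have i4 := integrable_mul_of_continuous hf.integrable (Real.continuous_cos.pow 2)
  refine ⟨L * 2, fun n => ?_⟩
  have h1 := hf.traceDefect_le_add (n := n) (q := fun l => p.eval (Real.cos l)) (α := L) (β := 0)
    i1 i2 i3 i4 i3 i4 (fun l _ m _ => by
      have := h _ (Real.cos_mem_Icc l) _ (Real.cos_mem_Icc m)
      linarith)
  have := mul_le_mul_of_nonneg_left (hf.traceDefect_cos_le (n := n)) hL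
  linarith

lemma abs_sq_le {ψ : ℝ → ℝ} {B ε : ℝ} (hB : ∀ l ∈ Set.Ioo 0 Real.pi, |ψ l| ≤ B * l ^ (-ε)) :
    ∀ l ∈ Set.Ioo 0 Real.pi, |ψ l ^ 2| ≤ B ^ 2 * l ^ (-(2 * ε)) := by
  intro l hl
  have e : l ^ (-(2 * ε)) = (l ^ (-ε)) ^ 2 := by
    rw [← Real.rpow_natCast, ← Real.rpow_mul hl.1.le]; congr 1; push_cast; ring
  rw [abs_pow, e, ← mul_pow]
  exact pow_le_pow_left₀ (abs_nonneg _) (hB l hl) 2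

lemma tendsto_traceDefect_div (hf : PowerSymbol a c C f) {φ : ℝ → ℝ} {B ε : ℝ} (hε0 : 0 ≤ ε)
    (hε : 2 * ε < (1 - |a|) / 2) (hφ : AEStronglyMeasurable φ halfCircle)
    (hB : ∀ l ∈ Set.Ioo 0 Real.pi, |φ l| ≤ B * l ^ (-ε)) :
    Tendsto (fun n : ℕ => traceDefect f n φ / n) atTop (𝓝 0) := by
  have hpi := Real.pi_pos
  have ha : ∀ δ, δ < (1 - |a|) / 2 → δ < 1 + a := fun δ hδ => by
    linarith [neg_abs_le a, abs_lt.2 ⟨hf.neg_one_lt, hf.lt_one⟩]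
  have hφ2 : MemLp φ 2 halfCircle := by
    rw [memLp_two_iff_integrable_sq hφ]
    exact integrable_of_le_rpow (r := -(2 * ε)) (by linarith [abs_nonneg a]) (hφ.pow 2)
      (abs_sq_le hB)
  have i1 := hf.integrable_mul (ha ε (by linarith)) hφ hB
  have i2 := hf.integrable_mul (ha _ hε) (hφ.pow 2) (abs_sq_le hB)
  rw [Metric.tendsto_atTop]
  intro η hη
  obtain ⟨p, hp⟩ := exists_polynomial_cos_near hφ2 (show 0 < Real.pi * (η / 8) by positivity)
  set q : ℝ → ℝ := fun l => p.eval (Real.cos l) with hq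
  obtain ⟨K, hK⟩ := hf.traceDefect_polynomial_le p
  have hqc : Continuous q := p.continuous.comp Real.continuous_cos
  obtain ⟨A, hA⟩ := (isCompact_Icc (a := (0 : ℝ)) (b := Real.pi)).exists_bound_of_continuousOn
    hqc.continuousOn
  set r : ℝ → ℝ := fun l => φ l - q l with hr
  have hrm : AEStronglyMeasurable r halfCircle := hφ.sub hqc.aestronglyMeasurable
  have hrB : ∀ l ∈ Set.Ioo 0 Real.pi, |r l| ≤ (B + A * Real.pi ^ ε) * l ^ (-ε) := by
    intro l hl
    have h1 := rpow_le_const_mul_rpow (r := 0) (s := -ε) hl (by linarith)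
    rw [Real.rpow_zero, zero_sub, neg_neg] at h1
    have h2 := hA l (Set.Ioo_subset_Icc_self hl)
    have hA0 : 0 ≤ A := (norm_nonneg _).trans h2
    calc |r l| ≤ |φ l| + |q l| := abs_sub _ _
      _ ≤ B * l ^ (-ε) + A * (Real.pi ^ ε * l ^ (-ε)) := by
        refine add_le_add (hB l hl) (h2.trans ?_)
        nlinarith
      _ = _ := by ring
  have j1 := integrable_mul_of_continuous hf.integrable hqc
  have j2 := integrable_mul_of_continuous hf.integrable (hqc.pow 2)
  have k1 := hf.integrable_mul (ha ε (by linarith)) hrm hrB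
  have k2 := hf.integrable_mul (ha _ hε) (hrm.pow 2) (abs_sq_le hrB)
  have hlim := hf.tendsto_trace_inv_mul_toep hε (hrm.pow 2) (abs_sq_le hrB)
  have hlt : 1 / Real.pi * ∫ l, r l ^ 2 ∂halfCircle < η / 4 := by
    have : 1 / Real.pi * ∫ l, r l ^ 2 ∂halfCircle ≤ 1 / Real.pi * (Real.pi * (η / 8)) :=
      mul_le_mul_of_nonneg_left hp (by positivity)
    have e : 1 / Real.pi * (Real.pi * (η / 8)) = η / 8 := by field_simp
    linarith
  have hlim2 : Tendsto (fun n : ℕ => 2 * K / (n : ℝ)) atTop (𝓝 0) :=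
    tendsto_const_div_atTop_nhds_zero_nat _
  obtain ⟨N, hN⟩ := eventually_atTop.1 ((hlim.eventually_lt_const hlt).and
    ((hlim2.eventually_lt_const (half_pos hη)).and (eventually_gt_atTop 0)))
  refine ⟨N, fun n hn => ?_⟩
  obtain ⟨h1, h2, hn0⟩ := hN n hn
  have hn' : (0 : ℝ) < n := by exact_mod_cast hn0
  rw [Real.dist_eq, sub_zero, abs_of_nonneg (div_nonneg (hf.traceDefect_nonneg i1 i2) hn'.le)]
  have h3 := hf.traceDefect_le_add (n := n) (α := 2) (β := 2) i1 i2 j1 j2 k1 k2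
    (fun l _ m _ => by
      simp only [hr]
      nlinarith [sq_nonneg ((q l - q m) - ((φ l - q l) - (φ m - q m)))])
  have h4 := hf.traceDefect_le_trace (n := n) r
  have h5 := hK n
  calc traceDefect f n φ / n
      ≤ (2 * K + 2 * ((toep n f)⁻¹ * toep n fun l => f l * r l ^ 2).trace) / n := by
        gcongr; linarith
    _ = 2 * K / n + 2 * (((toep n f)⁻¹ * toep n fun l => f l * r l ^ 2).trace / n) := by ring
    _ < η := by
        simp only [Pi.pow_apply] at h1
        linarith

lemma tendsto_covInner_toep (hf : PowerSymbol a c C f) {φ : ℝ → ℝ} {B ε : ℝ} (hε0 : 0 ≤ ε)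
    (hε : 2 * ε < (1 - |a|) / 2) (hφ : AEStronglyMeasurable φ halfCircle)
    (hB : ∀ l ∈ Set.Ioo 0 Real.pi, |φ l| ≤ B * l ^ (-ε)) :
    Tendsto (fun n : ℕ => covInner (toep n f) (toep n fun l => f l * φ l)
      (toep n fun l => f l * φ l) / n) atTop (𝓝 (1 / Real.pi * ∫ l, φ l ^ 2 ∂halfCircle)) := by
  have h1 := hf.tendsto_trace_inv_mul_toep hε (hφ.pow 2) (abs_sq_le hB)
  have h2 := h1.sub (hf.tendsto_traceDefect_div hε0 hε hφ hB)
  rw [sub_zero] at h2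
  refine h2.congr fun n => ?_
  simp only [traceDefect, Pi.pow_apply]
  ring

end PowerSymbol

/-- Tonelli's theorem for a nonnegative kernel on the quadrant whose sections are integrable. -/
lemma lintegral_ofReal_eq_of_sections {k : ℝ → ℝ → ℝ} {F G : ℝ → ℝ}
    (hk : Measurable (Function.uncurry k))
    (hk0 : ∀ x > 0, ∀ t > 0, 0 ≤ k x t)
    (hF : ∀ x > 0, IntegrableOn (k x) (Set.Ioi 0) ∧ ∫ t in Set.Ioi 0, k x t = F x)
    (hG : ∀ t > 0, IntegrableOn (fun x => k x t) (Set.Ioi 0) ∧ ∫ x in Set.Ioi 0, k x t = G t) :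
    ∫⁻ x in Set.Ioi 0, ENNReal.ofReal (F x) = ∫⁻ t in Set.Ioi 0, ENNReal.ofReal (G t) := by
  have h1 : ∫⁻ x in Set.Ioi (0 : ℝ), ENNReal.ofReal (F x) =
      ∫⁻ x in Set.Ioi (0 : ℝ), ∫⁻ t in Set.Ioi (0 : ℝ), ENNReal.ofReal (k x t) := by
    refine setLIntegral_congr_fun measurableSet_Ioi fun x hx => ?_
    rw [← (hF x hx).2]
    refine ofReal_integral_eq_lintegral_ofReal (hF x hx).1 ?_
    filter_upwards [ae_restrict_mem measurableSet_Ioi] with t ht using hk0 x hx t ht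
  have h2 : ∫⁻ t in Set.Ioi (0 : ℝ), ENNReal.ofReal (G t) =
      ∫⁻ t in Set.Ioi (0 : ℝ), ∫⁻ x in Set.Ioi (0 : ℝ), ENNReal.ofReal (k x t) := by
    refine setLIntegral_congr_fun measurableSet_Ioi fun t ht => ?_
    rw [← (hG t ht).2]
    refine ofReal_integral_eq_lintegral_ofReal (hG t ht).1 ?_
    filter_upwards [ae_restrict_mem measurableSet_Ioi] with x hx using hk0 x hx t ht
  rw [h1, h2]
  exact lintegral_lintegral_swap (ENNReal.measurable_ofReal.comp hk).aemeasurable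

lemma integral_one_sub_cos_mul_exp {t : ℝ} (ht : 0 < t) :
    IntegrableOn (fun x => (1 - Real.cos x) * Real.exp (-(x * t))) (Set.Ioi 0) ∧
      ∫ x in Set.Ioi 0, (1 - Real.cos x) * Real.exp (-(x * t)) = 1 / (t * (1 + t ^ 2)) := by
  set F : ℝ → ℝ := fun x => Real.exp (-(x * t)) *
    (-(1 / t) + (t * Real.cos x - Real.sin x) / (t ^ 2 + 1)) with hF
  have hd : ∀ x, HasDerivAt F ((1 - Real.cos x) * Real.exp (-(x * t))) x := by
    intro x
    have h1 : HasDerivAt (fun x => Real.exp (-(x * t))) (Real.exp (-(x * t)) * (-(1 * t))) x :=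
      (((hasDerivAt_id x).mul_const t).neg).exp
    have h2 : HasDerivAt (fun x => -(1 / t) + (t * Real.cos x - Real.sin x) / (t ^ 2 + 1))
        ((t * (-Real.sin x) - Real.cos x) / (t ^ 2 + 1)) x :=
      ((((Real.hasDerivAt_cos x).const_mul t).sub (Real.hasDerivAt_sin x)).div_const _).const_add _
    refine (h1.mul h2).congr_deriv ?_
    have : t ^ 2 + 1 ≠ 0 := by positivity
    field_simp
    ring
  have hlim : Tendsto F atTop (𝓝 0) := by
    have h1 : Tendsto (fun x => Real.exp (-(x * t))) atTop (𝓝 0) :=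
      Real.tendsto_exp_neg_atTop_nhds_zero.comp (tendsto_id.atTop_mul_const ht)
    refine squeeze_zero_norm (a := fun x => Real.exp (-(x * t)) * (1 / t + (t + 1))) ?_ ?_
    · intro x
      rw [hF, norm_mul, Real.norm_of_nonneg (Real.exp_pos _).le]
      refine mul_le_mul_of_nonneg_left ?_ (Real.exp_pos _).le
      refine (norm_add_le _ _).trans (add_le_add ?_ ?_)
      · rw [norm_neg, Real.norm_of_nonneg (by positivity)]
      · rw [norm_div, Real.norm_of_nonneg (show 0 ≤ t ^ 2 + 1 by positivity)]
        refine (div_le_self (norm_nonneg _) (by nlinarith)).trans ?_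
        refine (norm_sub_le _ _).trans (add_le_add ?_ (Real.abs_sin_le_one x))
        rw [norm_mul, Real.norm_of_nonneg ht.le]
        exact mul_le_of_le_one_right ht.le (Real.abs_cos_le_one x)
    · simpa using h1.mul_const (1 / t + (t + 1))
  have hc : ContinuousWithinAt F (Set.Ici 0) 0 := (hd 0).continuousAt.continuousWithinAt
  have hn : ∀ x ∈ Set.Ioi (0 : ℝ), 0 ≤ (1 - Real.cos x) * Real.exp (-(x * t)) := fun x _ =>
    mul_nonneg (by linarith [Real.cos_le_one x]) (Real.exp_pos _).le
  refine ⟨integrableOn_Ioi_deriv_of_nonneg hc (fun x _ => hd x) hn hlim, ?_⟩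
  rw [integral_Ioi_of_hasDerivAt_of_nonneg hc (fun x _ => hd x) hn hlim]
  have : t ^ 2 + 1 ≠ 0 := by positivity
  have : 1 + t ^ 2 ≠ 0 := by positivity
  simp only [hF, zero_mul, neg_zero, Real.exp_zero, Real.cos_zero, Real.sin_zero]
  field_simp
  ring

lemma integrableOn_of_lintegral_ofReal_eq {F : ℝ → ℝ} {c : ℝ} (hm : Measurable F)
    (h0 : ∀ x > 0, 0 ≤ F x) (hc : 0 ≤ c)
    (h : ∫⁻ x in Set.Ioi 0, ENNReal.ofReal (F x) = ENNReal.ofReal c) :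
    IntegrableOn F (Set.Ioi 0) ∧ ∫ x in Set.Ioi 0, F x = c := by
  have h0' : 0 ≤ᵐ[volume.restrict (Set.Ioi 0)] F := by
    filter_upwards [ae_restrict_mem measurableSet_Ioi] with x hx using h0 x hx
  refine ⟨⟨hm.aestronglyMeasurable, ?_⟩, ?_⟩
  · rw [hasFiniteIntegral_iff_ofReal h0', h]
    exact ENNReal.ofReal_lt_top
  · rw [integral_eq_lintegral_of_nonneg_ae h0' hm.aestronglyMeasurable, h,
      ENNReal.toReal_ofReal hc]

lemma integral_one_sub_cos_mul_rpow {s : ℝ} (hs : 0 < s) (hs2 : s < 2) :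
    IntegrableOn (fun x => (1 - Real.cos x) * x ^ (-1 - s)) (Set.Ioi 0) ∧
      ∫ x in Set.Ioi 0, (1 - Real.cos x) * x ^ (-1 - s) =
        Real.pi / (2 * Real.Gamma (s + 1) * Real.sin (Real.pi * s / 2)) := by
  have hg : 0 < Real.Gamma (s + 1) := Real.Gamma_pos_of_pos (by linarith)
  have hg2 : 0 < Real.Gamma (s / 2) := Real.Gamma_pos_of_pos (by linarith)
  have hg3 : 0 < Real.Gamma (1 - s / 2) := Real.Gamma_pos_of_pos (by linarith)
  have e1 : ∫⁻ x in Set.Ioi 0, ENNReal.ofReal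
        (Real.Gamma (s + 1) * ((1 - Real.cos x) * x ^ (-1 - s))) =
      ∫⁻ t in Set.Ioi 0, ENNReal.ofReal (t ^ (s - 1) * (1 / (1 + t ^ 2))) := by
    refine lintegral_ofReal_eq_of_sections
      (k := fun x t => (1 - Real.cos x) * (t ^ s * Real.exp (-(x * t)))) ?_ ?_ ?_ ?_
    · unfold Function.uncurry
      fun_prop
    · intro x hx t ht
      exact mul_nonneg (by linarith [Real.cos_le_one x]) (by positivity)
    · intro x hx
      have h := Real.integral_rpow_mul_exp_neg_mul_Ioi (a := s + 1) (by linarith) hx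
      rw [add_sub_cancel_right] at h
      constructor
      · refine Integrable.const_mul ?_ _
        refine Integrable.of_integral_ne_zero (ne_of_gt ?_)
        rw [h]
        have : 0 < x := hx
        positivity
      · rw [integral_const_mul, h, one_div, Real.inv_rpow (le_of_lt hx), ← Real.rpow_neg (le_of_lt hx)]
        rw [show -(s + 1) = -1 - s by ring]
        ring
    · intro t ht
      obtain ⟨h1, h2⟩ := integral_one_sub_cos_mul_exp ht
      have e : (fun x => (1 - Real.cos x) * (t ^ s * Real.exp (-(x * t)))) =
          fun x => t ^ s * ((1 - Real.cos x) * Real.exp (-(x * t))) := by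
        ext x; ring
      rw [e]
      refine ⟨h1.const_mul _, ?_⟩
      rw [integral_const_mul, h2, Real.rpow_sub_one (ne_of_gt ht)]
      have : 1 + t ^ 2 ≠ 0 := by positivity
      have : t ≠ 0 := ne_of_gt ht
      field_simp
  have e2 : ∫⁻ t in Set.Ioi 0, ENNReal.ofReal (t ^ (s - 1) * (1 / (1 + t ^ 2))) =
      ∫⁻ u in Set.Ioi 0, ENNReal.ofReal
        (Real.Gamma (s / 2) / 2 * (Real.exp (-u) * u ^ (1 - s / 2 - 1))) := by
    refine lintegral_ofReal_eq_of_sections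
      (k := fun t u => t ^ (s - 1) * Real.exp (-(1 + t ^ 2) * u)) ?_ ?_ ?_ ?_
    · unfold Function.uncurry
      fun_prop
    · intro x hx t ht
      exact mul_nonneg (Real.rpow_nonneg (le_of_lt hx) _) (Real.exp_pos _).le
    · intro t ht
      have hp : 0 < 1 + t ^ 2 := by positivity
      refine ⟨(exp_neg_integrableOn_Ioi 0 hp).const_mul _, ?_⟩
      rw [integral_const_mul, integral_exp_mul_Ioi (by linarith)]
      simp
      left
      rw [← neg_add, div_neg, neg_div, neg_neg, one_div, add_comm]
    · intro u hu
      have e : (fun t : ℝ => t ^ (s - 1) * Real.exp (-(1 + t ^ 2) * u)) =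
          fun t => Real.exp (-u) * (t ^ (s - 1) * Real.exp (-u * t ^ (2 : ℝ))) := by
        ext t
        rw [Real.rpow_two, show -(1 + t ^ 2) * u = -u + -u * t ^ 2 by ring, Real.exp_add]
        ring
      rw [e]
      have h := integral_rpow_mul_exp_neg_mul_rpow (p := 2) (q := s - 1) (b := u)
        (by norm_num) (by linarith) hu
      rw [sub_add_cancel] at h
      constructor
      · refine Integrable.const_mul ?_ _
        refine Integrable.of_integral_ne_zero (ne_of_gt ?_)
        rw [h]
        have : 0 < u := hu
        positivity
      · rw [integral_const_mul, h, show 1 - s / 2 - 1 = -s / 2 by ring]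
        ring
  have e3 : ∫⁻ u in Set.Ioi 0, ENNReal.ofReal
        (Real.Gamma (s / 2) / 2 * (Real.exp (-u) * u ^ (1 - s / 2 - 1))) =
      ENNReal.ofReal (Real.Gamma (s / 2) / 2 * Real.Gamma (1 - s / 2)) := by
    rw [Real.Gamma_eq_integral (show 0 < 1 - s / 2 by linarith), ← integral_const_mul]
    refine (ofReal_integral_eq_lintegral_ofReal ?_ ?_).symm
    · exact (Real.GammaIntegral_convergent (by linarith)).const_mul _
    · filter_upwards [ae_restrict_mem measurableSet_Ioi] with u hu
      have : 0 < u := hu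
      simp only [Pi.zero_apply]
      positivity
  have h := integrableOn_of_lintegral_ofReal_eq
    (F := fun x => Real.Gamma (s + 1) * ((1 - Real.cos x) * x ^ (-1 - s)))
    (by fun_prop) (fun x hx => mul_nonneg hg.le (mul_nonneg (by linarith [Real.cos_le_one x])
      (Real.rpow_nonneg (le_of_lt hx) _))) (by positivity) (e1.trans (e2.trans e3))
  obtain ⟨hi, he⟩ := h
  refine ⟨?_, ?_⟩
  · refine (hi.const_mul (Real.Gamma (s + 1))⁻¹).congr (ae_of_all _ fun x => ?_)
    simp only
    field_simp
  · rw [integral_const_mul] at he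
    have h4 := Real.Gamma_mul_Gamma_one_sub (s / 2)
    have hsin : 0 < Real.sin (Real.pi * s / 2) := by
      refine Real.sin_pos_of_pos_of_lt_pi (by positivity) ?_
      nlinarith [Real.pi_pos]
    rw [show Real.pi * (s / 2) = Real.pi * s / 2 by ring] at h4
    rw [eq_div_iff (by positivity)]
    have h5 : Real.Gamma (s / 2) * Real.Gamma (1 - s / 2) * Real.sin (Real.pi * s / 2) = Real.pi := by
      rw [h4]; field_simp
    linear_combination 2 * Real.sin (Real.pi * s / 2) * he + h5

/-- An even function integrates over `(-π, π)` to twice its integral over `(0, π)`. -/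
lemma intervalIntegral_eq_two_mul_halfCircle {g : ℝ → ℝ} (hg : ∀ x, g (-x) = g x) :
    ∫ l in (-Real.pi)..Real.pi, g l = 2 * ∫ l, g l ∂halfCircle := by
  have hga : ∀ x, g |x| = g x := fun x => by
    rcases abs_choice x with h | h <;> rw [h]
    exact hg x
  rw [intervalIntegral.integral_of_le (by linarith [Real.pi_pos]),
    integral_Ioc_eq_integral_Ioo, ← integral_indicator measurableSet_Ioo]
  have e : (Set.Ioo (-Real.pi) Real.pi).indicator g =
      fun x => (Set.Iio Real.pi).indicator g |x| := by
    ext x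
    simp only [Set.indicator, Set.mem_Ioo, Set.mem_Iio, hga, abs_lt]
  rw [e, integral_comp_abs, setIntegral_indicator measurableSet_Iio, Set.Ioi_inter_Iio]

lemma integrable_of_even {g : ℝ → ℝ} (hg : ∀ x, g (-x) = g x) (hi : IntegrableOn g (Set.Ioi 0)) :
    Integrable g := by
  have h1 : IntegrableOn g (Set.Iic 0) := by
    have m : MeasurableEmbedding fun x : ℝ => -x := (Homeomorph.neg ℝ).measurableEmbedding
    have e : (g ∘ fun x => -x) = g := funext fun x => hg x
    rw [← Measure.map_neg_eq_self (volume : Measure ℝ), m.integrableOn_map_iff, e]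
    simpa [integrableOn_Ici_iff_integrableOn_Ioi] using hi
  rw [← integrableOn_univ, ← Set.Iic_union_Ioi (a := (0 : ℝ))]
  exact h1.union hi

/-- The integral over the line is the integral over one period of the periodization. -/
lemma integral_eq_integral_periodization {w : ℝ → ℝ} (hw : Integrable w) :
    ∫ x, w x = ∫ x in (-Real.pi)..Real.pi, ∑' k : ℤ, w (x + 2 * (k : ℝ) * Real.pi) := by
  have hcell : ∀ (g : ℝ → ℝ) (k : ℤ),
      ∫ x in Set.Ioc (-Real.pi + k • (2 * Real.pi)) (-Real.pi + (k + 1) • (2 * Real.pi)), g x =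
        ∫ x in Set.Ioc (-Real.pi) Real.pi, g (x + 2 * (k : ℝ) * Real.pi) := by
    intro g k
    have hpi := Real.pi_pos
    rw [zsmul_eq_mul, zsmul_eq_mul, Int.cast_add, Int.cast_one,
      ← intervalIntegral.integral_of_le (by linarith), ← intervalIntegral.integral_of_le (by linarith),
      intervalIntegral.integral_comp_add_right (fun x => g x)]
    congr 1 <;> ring
  have hsum : ∀ g : ℝ → ℝ, Integrable g → HasSum (fun k : ℤ =>
      ∫ x in Set.Ioc (-Real.pi) Real.pi, g (x + 2 * (k : ℝ) * Real.pi)) (∫ x, g x) := by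
    intro g hg
    have h := hasSum_integral_iUnion (μ := volume) (f := g)
      (s := fun k : ℤ => Set.Ioc (-Real.pi + k • (2 * Real.pi)) (-Real.pi + (k + 1) • (2 * Real.pi)))
      (fun _ => measurableSet_Ioc) (Set.pairwise_disjoint_Ioc_add_zsmul _ _) hg.integrableOn
    rw [iUnion_Ioc_add_zsmul Real.two_pi_pos, setIntegral_univ] at h
    simpa only [hcell] using h
  have h2 := hasSum_integral_of_summable_integral_norm
    (μ := volume.restrict (Set.Ioc (-Real.pi) Real.pi))
    (F := fun (k : ℤ) x => w (x + 2 * (k : ℝ) * Real.pi))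
    (fun k => (hw.comp_add_right _).integrableOn) (hsum _ hw.norm).summable
  rw [intervalIntegral.integral_of_le (by linarith [Real.pi_pos])]
  exact (hsum w hw).unique h2

lemma integral_one_sub_cos_smul_mul_rpow {s : ℝ} (hs : 0 < s) (hs2 : s < 2) (t : ℝ) :
    IntegrableOn (fun x => (1 - Real.cos (t * x)) * x ^ (-1 - s)) (Set.Ioi 0) ∧
      ∫ x in Set.Ioi 0, (1 - Real.cos (t * x)) * x ^ (-1 - s) =
        |t| ^ s * (Real.pi / (2 * Real.Gamma (s + 1) * Real.sin (Real.pi * s / 2))) := by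
  rcases eq_or_ne t 0 with rfl | ht
  · simp [Real.zero_rpow hs.ne']
  have ht' : 0 < |t| := abs_pos.2 ht
  have e : Set.EqOn (fun x => (1 - Real.cos (t * x)) * x ^ (-1 - s)) (fun x => |t| ^ (1 + s) *
      ((1 - Real.cos (|t| * x)) * (|t| * x) ^ (-1 - s))) (Set.Ioi 0) := by
    intro x hx
    have hx : 0 < x := hx
    simp only
    rw [Real.mul_rpow ht'.le hx.le, ← Real.cos_abs (t * x), abs_mul, abs_of_pos hx]
    have : |t| ^ (1 + s) * |t| ^ (-1 - s) = 1 := by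
      rw [← Real.rpow_add ht']; simp
    linear_combination (-(1 - Real.cos (|t| * x)) * x ^ (-1 - s)) * this
  obtain ⟨h1, h2⟩ := integral_one_sub_cos_mul_rpow hs hs2
  constructor
  · refine IntegrableOn.congr_fun ?_ e.symm measurableSet_Ioi
    refine Integrable.const_mul ?_ _
    refine (integrableOn_Ioi_comp_mul_left_iff
      (fun x => (1 - Real.cos x) * x ^ (-1 - s)) 0 ht').2 ?_
    rwa [mul_zero]
  · rw [setIntegral_congr_fun measurableSet_Ioi e, integral_const_mul,
      integral_comp_mul_left_Ioi (fun x => (1 - Real.cos x) * x ^ (-1 - s)) 0 ht', mul_zero, h2,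
      Real.rpow_add ht', Real.rpow_one, smul_eq_mul]
    field_simp

lemma integral_cos_mul_one_sub_cos_mul_rpow {s : ℝ} (hs : 0 < s) (hs2 : s < 2) (t : ℝ) :
    IntegrableOn (fun x => Real.cos (t * x) * (1 - Real.cos x) * x ^ (-1 - s)) (Set.Ioi 0) ∧
      ∫ x in Set.Ioi 0, Real.cos (t * x) * (1 - Real.cos x) * x ^ (-1 - s) =
        (|t + 1| ^ s - 2 * |t| ^ s + |t - 1| ^ s) / 2 *
          (Real.pi / (2 * Real.Gamma (s + 1) * Real.sin (Real.pi * s / 2))) := by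
  obtain ⟨h1, e1⟩ := integral_one_sub_cos_smul_mul_rpow hs hs2 (t + 1)
  obtain ⟨h2, e2⟩ := integral_one_sub_cos_smul_mul_rpow hs hs2 t
  obtain ⟨h3, e3⟩ := integral_one_sub_cos_smul_mul_rpow hs hs2 (t - 1)
  have e : (fun x => Real.cos (t * x) * (1 - Real.cos x) * x ^ (-1 - s)) = fun x =>
      (1 / 2) * ((1 - Real.cos ((t + 1) * x)) * x ^ (-1 - s)) +
      (1 / 2) * ((1 - Real.cos ((t - 1) * x)) * x ^ (-1 - s)) -
      (1 - Real.cos (t * x)) * x ^ (-1 - s) := by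
    ext x
    rw [show (t + 1) * x = t * x + x by ring, show (t - 1) * x = t * x - x by ring,
      Real.cos_add, Real.cos_sub]
    ring
  have h13 : IntegrableOn (fun x => (1 / 2) * ((1 - Real.cos ((t + 1) * x)) * x ^ (-1 - s)) +
      (1 / 2) * ((1 - Real.cos ((t - 1) * x)) * x ^ (-1 - s))) (Set.Ioi 0) :=
    (h1.const_mul _).add (h3.const_mul _)
  rw [e]
  refine ⟨h13.sub h2, ?_⟩
  rw [integral_sub h13 h2, integral_add (h1.const_mul _) (h3.const_mul _), integral_const_mul,
    integral_const_mul, e1, e2, e3]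
  ring

lemma tsum_abs_add_rpow_neg (r x : ℝ) : ∑' k : ℤ, |-x + 2 * (k : ℝ) * Real.pi| ^ r =
    ∑' k : ℤ, |x + 2 * (k : ℝ) * Real.pi| ^ r := by
  rw [← (Equiv.neg ℤ).tsum_eq]
  refine tsum_congr fun k => ?_
  rw [← abs_neg]
  simp only [Equiv.neg_apply, Int.cast_neg]
  congr 2
  ring

/-- Spectral representation of the covariance of fractional Gaussian noise. -/
lemma fgnT_eq_toep {H : ℝ} (hH : H ∈ Set.Ioo (0 : ℝ) 1) (n : ℕ) : fgnT n H = toep n (fgnSpec H) := by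
  have hs : 0 < 2 * H := by linarith [hH.1]
  have hs2 : 2 * H < 2 := by linarith [hH.2]
  have hg : 0 < Real.Gamma (2 * H + 1) := Real.Gamma_pos_of_pos (by linarith)
  have hpi := Real.pi_pos
  have hsin : 0 < Real.sin (Real.pi * H) :=
    Real.sin_pos_of_pos_of_lt_pi (mul_pos hpi hH.1) (by nlinarith [hH.2])
  ext i j
  simp only [fgnT, toep, cosMat]
  set t : ℝ := ((i : ℕ) : ℝ) - ((j : ℕ) : ℝ) with ht
  obtain ⟨hi, he⟩ := integral_cos_mul_one_sub_cos_mul_rpow hs hs2 t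
  rw [show Real.pi * (2 * H) / 2 = Real.pi * H by ring] at he
  set w : ℝ → ℝ := fun x => Real.cos (t * x) * (1 - Real.cos x) * |x| ^ (-2 * H - 1) with hw
  have hwe : ∀ x, w (-x) = w x := fun x => by simp [hw]
  have hwi : IntegrableOn w (Set.Ioi 0) := by
    refine hi.congr_fun (fun x hx => ?_) measurableSet_Ioi
    have hx : 0 < x := hx
    simp only [hw, abs_of_pos hx, show -2 * H - 1 = -1 - 2 * H by ring]
  have h1 : ∫ x, w x = 2 * ∫ x in Set.Ioi 0, w x := by
    rw [← integral_comp_abs (f := w)]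
    congr 1
    ext x
    rcases abs_choice x with h | h <;> rw [h]
    exact (hwe x).symm
  have h2 : ∫ x in Set.Ioi 0, w x =
      ∫ x in Set.Ioi 0, Real.cos (t * x) * (1 - Real.cos x) * x ^ (-1 - 2 * H) := by
    refine setIntegral_congr_fun measurableSet_Ioi fun x hx => ?_
    have hx : 0 < x := hx
    simp only [hw, abs_of_pos hx, show -2 * H - 1 = -1 - 2 * H by ring]
  have hper : ∀ x (k : ℤ), w (x + 2 * (k : ℝ) * Real.pi) =
      Real.cos (t * x) * (1 - Real.cos x) * |x + 2 * (k : ℝ) * Real.pi| ^ (-2 * H - 1) := by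
    intro x k
    have c1 : Real.cos (x + 2 * (k : ℝ) * Real.pi) = Real.cos x := by
      rw [show x + 2 * (k : ℝ) * Real.pi = x + k * (2 * Real.pi) by ring]
      exact Real.cos_add_int_mul_two_pi x k
    have c2 : Real.cos (t * (x + 2 * (k : ℝ) * Real.pi)) = Real.cos (t * x) := by
      have := Real.cos_add_int_mul_two_pi (t * x) ((((i : ℕ) : ℤ) - ((j : ℕ) : ℤ)) * k)
      rw [← this]
      push_cast
      rw [← ht]
      congr 1
      ring
    simp only [hw, c1, c2]
  have h3 := integral_eq_integral_periodization (integrable_of_even hwe hwi)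
  simp only [hper, tsum_mul_left] at h3
  have hev : ∀ x, (fun x => Real.cos (t * x) * (1 - Real.cos x) *
      ∑' k : ℤ, |x + 2 * (k : ℝ) * Real.pi| ^ (-2 * H - 1)) (-x) =
      (fun x => Real.cos (t * x) * (1 - Real.cos x) *
      ∑' k : ℤ, |x + 2 * (k : ℝ) * Real.pi| ^ (-2 * H - 1)) x := by
    intro x
    simp only [mul_neg, Real.cos_neg]
    congr 1
    exact tsum_abs_add_rpow_neg _ x
  rw [intervalIntegral_eq_two_mul_halfCircle hev, h1, h2, he] at h3
  have h4 : ∫ l, fgnSpec H l * Real.cos (t * l) ∂halfCircle =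
      (Real.Gamma (2 * H + 1) * Real.sin (Real.pi * H) / Real.pi) *
      ∫ l, Real.cos (t * l) * (1 - Real.cos l) *
        ∑' k : ℤ, |l + 2 * (k : ℝ) * Real.pi| ^ (-2 * H - 1) ∂halfCircle := by
    rw [← integral_const_mul]
    refine integral_congr_ae (ae_of_all _ fun l => ?_)
    simp only [fgnSpec]
    field_simp
  rw [h4]
  have h5 := mul_left_cancel₀ two_ne_zero h3
  rw [← h5]
  have hsin' := hsin.ne'
  set S := Real.sin (Real.pi * H)
  field_simp

/-- The spectral density is an even function of the frequency. -/
lemma fgnSpec_neg (H l : ℝ) : fgnSpec H (-l) = fgnSpec H l := by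
  simp only [fgnSpec, Real.cos_neg, tsum_abs_add_rpow_neg]

lemma dlogSpec_neg (H l : ℝ) : dlogSpec H (-l) = dlogSpec H l := by
  simp only [dlogSpec, fgnSpec_neg]

/-- Cauchy estimates for the first-order Taylor expansion of a bounded holomorphic function. -/
lemma norm_deriv_le_and_norm_taylor_le {F : ℂ → ℂ} {c : ℂ} {r M : ℝ} (hr : 0 < r)
    (hd : DifferentiableOn ℂ F (Metric.ball c (3 * r)))
    (hM : ∀ z ∈ Metric.ball c (3 * r), ‖F z‖ ≤ M) :
    ‖deriv F c‖ ≤ M / r ∧ ∀ z ∈ Metric.ball c r,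
      ‖F z - F c - (z - c) * deriv F c‖ ≤ M / r ^ 2 * ‖z - c‖ ^ 2 := by
  have hsub : ∀ {z : ℂ} {ρ : ℝ}, z ∈ Metric.ball c ρ →
      Metric.closedBall z r ⊆ Metric.ball c (ρ + r) := by
    intro z ρ hz w hw
    rw [Metric.mem_ball] at *
    rw [Metric.mem_closedBall] at hw
    linarith [dist_triangle w z c]
  have hin : ∀ {z : ℂ} {ρ : ℝ}, ρ ≤ 3 * r → z ∈ Metric.ball c ρ → z ∈ Metric.ball c (3 * r) :=
    fun h hz => Metric.ball_subset_ball h hz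
  have h1 : ∀ z ∈ Metric.ball c (2 * r), ‖deriv F z‖ ≤ M / r := by
    intro z hz
    have hs := hsub hz
    rw [show 2 * r + r = 3 * r by ring] at hs
    exact Complex.norm_deriv_le_of_forall_mem_sphere_norm_le hr (hd.diffContOnCl_ball hs)
      fun w hw => hM w (hs (Metric.sphere_subset_closedBall hw))
  have hd' : DifferentiableOn ℂ (deriv F) (Metric.ball c (3 * r)) := hd.deriv Metric.isOpen_ball
  have h2 : ∀ z ∈ Metric.ball c r, ‖deriv (deriv F) z‖ ≤ M / r / r := by
    intro z hz
    have hs := hsub hz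
    rw [show r + r = 2 * r by ring] at hs
    exact Complex.norm_deriv_le_of_forall_mem_sphere_norm_le hr
      (hd'.diffContOnCl_ball (hs.trans (Metric.ball_subset_ball (by linarith))))
      fun w hw => h1 w (hs (Metric.sphere_subset_closedBall hw))
  have hda : ∀ z ∈ Metric.ball c r, DifferentiableAt ℂ F z := fun z hz =>
    hd.differentiableAt (Metric.isOpen_ball.mem_nhds (hin (by linarith) hz))
  have hda' : ∀ z ∈ Metric.ball c r, DifferentiableAt ℂ (deriv F) z := fun z hz =>
    hd'.differentiableAt (Metric.isOpen_ball.mem_nhds (hin (by linarith) hz))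
  have hc : c ∈ Metric.ball c r := Metric.mem_ball_self hr
  have hM0 : 0 ≤ M := (norm_nonneg _).trans (hM c (hin (by linarith) hc))
  have h3 : ∀ z ∈ Metric.ball c r, ‖deriv F z - deriv F c‖ ≤ M / r / r * ‖z - c‖ := fun z hz =>
    Convex.norm_image_sub_le_of_norm_deriv_le hda' h2 (convex_ball c r) hc hz
  refine ⟨h1 c (Metric.mem_ball_self (by linarith)), fun z hz => ?_⟩
  have hcb : Metric.closedBall c ‖z - c‖ ⊆ Metric.ball c r := by
    rw [mem_ball_iff_norm] at hz
    exact Metric.closedBall_subset_ball hz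
  have hg : ∀ w ∈ Metric.closedBall c ‖z - c‖,
      HasDerivAt (fun w => F w - (w - c) * deriv F c) (deriv F w - deriv F c) w := by
    intro w hw
    refine ((hda w (hcb hw)).hasDerivAt.fun_sub
      (((hasDerivAt_id' w).sub_const c).mul_const (deriv F c))).congr_deriv ?_
    rw [one_mul]
  have h4 := Convex.norm_image_sub_le_of_norm_deriv_le (𝕜 := ℂ)
    (f := fun w => F w - (w - c) * deriv F c) (s := Metric.closedBall c ‖z - c‖)
    (C := M / r / r * ‖z - c‖) (x := c) (y := z)
    (fun w hw => (hg w hw).differentiableAt) (fun w hw => by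
      rw [(hg w hw).deriv]
      refine (h3 w (hcb hw)).trans ?_
      rw [mem_closedBall_iff_norm] at hw
      exact mul_le_mul_of_nonneg_left hw (by positivity))
    (convex_closedBall _ _) (Metric.mem_closedBall_self (norm_nonneg _)) (by
      rw [mem_closedBall_iff_norm])
  refine le_trans (le_of_eq ?_) (h4.trans (le_of_eq ?_))
  · congr 1
    ring
  · field_simp

lemma le_abs_add_two_mul_int_mul_pi {l : ℝ} (hl : l ∈ Set.Ioo 0 Real.pi) (k : ℤ) :
    l * max 1 |(k : ℝ)| ≤ |l + 2 * (k : ℝ) * Real.pi| := by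
  have hpi := Real.pi_pos
  rcases eq_or_ne k 0 with rfl | hk
  · simp [le_abs_self]
  have h1 : (1 : ℝ) ≤ |(k : ℝ)| := by exact_mod_cast Int.one_le_abs hk
  rw [max_eq_right h1]
  have h2 : |2 * (k : ℝ) * Real.pi| ≤ |l + 2 * (k : ℝ) * Real.pi| + |l| := by
    have := abs_sub (l + 2 * (k : ℝ) * Real.pi) l
    rwa [add_sub_cancel_left] at this
  rw [abs_mul, abs_mul, abs_of_pos hpi, abs_of_pos hl.1, abs_two] at h2
  nlinarith [hl.1, hl.2]

lemma summable_max_one_abs_rpow {p : ℝ} (hp : 1 < p) :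
    Summable fun k : ℤ => (max 1 |(k : ℝ)|) ^ (-p) := by
  refine (summable_congr_cofinite ?_).1 (Real.summable_abs_int_rpow hp)
  rw [Filter.EventuallyEq, Filter.eventually_cofinite]
  refine (Set.finite_singleton (0 : ℤ)).subset fun k hk => ?_
  by_contra h
  refine hk ?_
  have h1 : (1 : ℝ) ≤ |(k : ℝ)| := by exact_mod_cast Int.one_le_abs h
  simp [max_eq_right h1]

lemma abs_add_two_mul_int_mul_pi_pos {l : ℝ} (hl : l ∈ Set.Ioo 0 Real.pi) (k : ℤ) :
    0 < |l + 2 * (k : ℝ) * Real.pi| :=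
  (mul_pos hl.1 (lt_max_of_lt_left one_pos)).trans_le (le_abs_add_two_mul_int_mul_pi hl k)

lemma abs_add_rpow_le {l p q : ℝ} (hl : l ∈ Set.Ioo 0 Real.pi) (hq : 0 ≤ q) (hqp : q ≤ p) (k : ℤ) :
    |l + 2 * (k : ℝ) * Real.pi| ^ (-p) ≤ l ^ (-p) * (max 1 |(k : ℝ)|) ^ (-q) := by
  have hm : (1 : ℝ) ≤ max 1 |(k : ℝ)| := le_max_left _ _
  calc |l + 2 * (k : ℝ) * Real.pi| ^ (-p) ≤ (l * max 1 |(k : ℝ)|) ^ (-p) :=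
        Real.rpow_le_rpow_of_nonpos (mul_pos hl.1 (by linarith))
          (le_abs_add_two_mul_int_mul_pi hl k) (by linarith)
    _ = l ^ (-p) * (max 1 |(k : ℝ)|) ^ (-p) := Real.mul_rpow hl.1.le (by linarith)
    _ ≤ _ := mul_le_mul_of_nonneg_left (Real.rpow_le_rpow_of_exponent_le hm (by linarith))
        (Real.rpow_nonneg hl.1.le _)

lemma summable_abs_add_rpow {l p : ℝ} (hl : l ∈ Set.Ioo 0 Real.pi) (hp : 1 < p) :
    Summable fun k : ℤ => |l + 2 * (k : ℝ) * Real.pi| ^ (-p) :=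
  Summable.of_nonneg_of_le (fun k => Real.rpow_nonneg (abs_nonneg _) _)
    (fun k => abs_add_rpow_le hl (by linarith) le_rfl k)
    ((summable_max_one_abs_rpow hp).mul_left _)

lemma rpow_le_tsum_abs_add_rpow {l p : ℝ} (hl : l ∈ Set.Ioo 0 Real.pi) (hp : 1 < p) :
    l ^ (-p) ≤ ∑' k : ℤ, |l + 2 * (k : ℝ) * Real.pi| ^ (-p) := by
  have h := (summable_abs_add_rpow hl hp).le_tsum 0 fun k _ => Real.rpow_nonneg (abs_nonneg _) _
  simpa [abs_of_pos hl.1] using h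

lemma tsum_abs_add_rpow_le {l p q : ℝ} (hl : l ∈ Set.Ioo 0 Real.pi) (hq : 1 < q) (hqp : q ≤ p) :
    ∑' k : ℤ, |l + 2 * (k : ℝ) * Real.pi| ^ (-p) ≤
      (∑' k : ℤ, (max 1 |(k : ℝ)|) ^ (-q)) * l ^ (-p) := by
  rw [mul_comm, ← tsum_mul_left]
  exact (summable_abs_add_rpow hl (by linarith)).tsum_le_tsum
    (fun k => abs_add_rpow_le hl (by linarith) hqp k) ((summable_max_one_abs_rpow hq).mul_left _)

lemma continuousOn_tsum_abs_add_rpow {p : ℝ} (hp : 1 < p) :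
    ContinuousOn (fun l => ∑' k : ℤ, |l + 2 * (k : ℝ) * Real.pi| ^ (-p)) (Set.Ioo 0 Real.pi) := by
  intro l₀ hl₀
  have hs : Set.Ioo (l₀ / 2) Real.pi ⊆ Set.Ioo 0 Real.pi := fun l hl =>
    ⟨by linarith [hl.1, hl₀.1], hl.2⟩
  have h : ContinuousOn (fun l => ∑' k : ℤ, |l + 2 * (k : ℝ) * Real.pi| ^ (-p))
      (Set.Ioo (l₀ / 2) Real.pi) := by
    refine continuousOn_tsum (u := fun k : ℤ => (l₀ / 2) ^ (-p) * (max 1 |(k : ℝ)|) ^ (-p)) ?_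
      ((summable_max_one_abs_rpow hp).mul_left _) ?_
    · intro k
      refine ContinuousOn.rpow_const (by fun_prop) fun l hl => Or.inl ?_
      exact (abs_add_two_mul_int_mul_pi_pos (hs hl) k).ne'
    · intro k l hl
      rw [Real.norm_of_nonneg (Real.rpow_nonneg (abs_nonneg _) _)]
      refine (abs_add_rpow_le (hs hl) (by linarith) le_rfl k).trans ?_
      refine mul_le_mul_of_nonneg_right ?_ (Real.rpow_nonneg (by positivity) _)
      exact Real.rpow_le_rpow_of_nonpos (by linarith [hl₀.1]) hl.1.le (by linarith)
  exact (h.continuousAt (Ioo_mem_nhds (by linarith [hl₀.1]) hl₀.2)).continuousWithinAt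

lemma convexOn_tsum_abs_add_rpow {l : ℝ} (hl : l ∈ Set.Ioo 0 Real.pi) :
    ConvexOn ℝ (Set.Ioi 0) fun h : ℝ => ∑' k : ℤ, |l + 2 * (k : ℝ) * Real.pi| ^ (-2 * h - 1) := by
  have hsum : ∀ h > (0 : ℝ), Summable fun k : ℤ => |l + 2 * (k : ℝ) * Real.pi| ^ (-2 * h - 1) := by
    intro h hh
    have := summable_abs_add_rpow hl (p := 2 * h + 1) (by linarith)
    rwa [show -(2 * h + 1) = -2 * h - 1 by ring] at this
  refine ⟨convex_Ioi 0, fun x hx y hy a b ha hb hab => ?_⟩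
  simp only [smul_eq_mul]
  rw [← tsum_mul_left, ← tsum_mul_left, ← ((hsum x hx).mul_left a).tsum_add ((hsum y hy).mul_left b)]
  have hxy : (0 : ℝ) < a * x + b * y := (convex_Ioi 0) hx hy ha hb hab
  refine (hsum _ hxy).tsum_le_tsum (fun k => ?_)
    (((hsum x hx).mul_left a).add ((hsum y hy).mul_left b))
  have h := (convexOn_rpow_left (abs_add_two_mul_int_mul_pi_pos hl k)).2
    (Set.mem_univ (-2 * x - 1)) (Set.mem_univ (-2 * y - 1)) ha hb hab
  simp only [smul_eq_mul] at h
  refine le_trans (le_of_eq ?_) h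
  congr 1
  linear_combination hab

/-- Analytic continuation of the spectral density in the Hurst parameter. -/
def fgnSpecC (z : ℂ) (l : ℝ) : ℂ :=
  (Complex.Gamma (2 * z + 1) * Complex.sin (Real.pi * z) / (2 * Real.pi)) *
    (2 * (1 - Real.cos l) : ℝ) * ∑' k : ℤ, ((|l + 2 * (k : ℝ) * Real.pi| : ℝ) : ℂ) ^ (-2 * z - 1)

lemma fgnSpecC_ofReal (h l : ℝ) : fgnSpecC h l = (fgnSpec h l : ℂ) := by
  simp only [fgnSpecC, fgnSpec]
  push_cast
  congr 1
  · congr 2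
    rw [← Complex.Gamma_ofReal]
    push_cast
    rfl
  · refine tsum_congr fun k => ?_
    rw [Complex.ofReal_cpow (abs_nonneg _)]
    push_cast
    rfl

lemma norm_abs_add_cpow {l : ℝ} (hl : l ∈ Set.Ioo 0 Real.pi) (z : ℂ) (k : ℤ) :
    ‖((|l + 2 * (k : ℝ) * Real.pi| : ℝ) : ℂ) ^ (-2 * z - 1)‖ =
      |l + 2 * (k : ℝ) * Real.pi| ^ (-(2 * z.re + 1)) := by
  rw [Complex.norm_cpow_eq_rpow_re_of_pos (abs_add_two_mul_int_mul_pi_pos hl k)]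
  congr 1
  simp
  ring

lemma norm_tsum_abs_add_cpow_le {l δ : ℝ} (hl : l ∈ Set.Ioo 0 Real.pi) (hδ : 0 < δ) {z : ℂ}
    (hz : δ ≤ z.re) :
    ‖∑' k : ℤ, ((|l + 2 * (k : ℝ) * Real.pi| : ℝ) : ℂ) ^ (-2 * z - 1)‖ ≤
      (∑' k : ℤ, (max 1 |(k : ℝ)|) ^ (-(2 * δ + 1))) * l ^ (-(2 * z.re + 1)) := by
  have hs := summable_abs_add_rpow hl (p := 2 * z.re + 1) (by linarith)
  refine (norm_tsum_le_tsum_norm ?_).trans ?_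
  · simpa only [norm_abs_add_cpow hl] using hs
  · simp only [norm_abs_add_cpow hl]
    exact tsum_abs_add_rpow_le hl (by linarith) (by linarith)

lemma differentiableOn_tsum_abs_add_cpow {l δ R : ℝ} (hl : l ∈ Set.Ioo 0 Real.pi) (hδ : 0 < δ) :
    DifferentiableOn ℂ (fun z : ℂ => ∑' k : ℤ, ((|l + 2 * (k : ℝ) * Real.pi| : ℝ) : ℂ) ^ (-2 * z - 1))
      {z : ℂ | δ < z.re ∧ z.re < R} := by
  refine Complex.differentiableOn_tsum_of_summable_norm
    (u := fun k : ℤ => Real.pi ^ (2 * R) * l ^ (-(2 * R + 1)) *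
      (max 1 |(k : ℝ)|) ^ (-(2 * δ + 1)))
    ((summable_max_one_abs_rpow (by linarith)).mul_left _) ?_ ?_ ?_
  · intro k
    have h0 : ((|l + 2 * (k : ℝ) * Real.pi| : ℝ) : ℂ) ≠ 0 :=
      Complex.ofReal_ne_zero.2 (abs_add_two_mul_int_mul_pi_pos hl k).ne'
    intro z _
    refine DifferentiableAt.differentiableWithinAt ?_
    exact DifferentiableAt.const_cpow (by fun_prop) (Or.inl h0)
  · exact (isOpen_lt continuous_const Complex.continuous_re).inter
      (isOpen_lt Complex.continuous_re continuous_const)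
  · intro k z hz
    rw [norm_abs_add_cpow hl]
    refine (abs_add_rpow_le hl (q := 2 * δ + 1) (by linarith) (by linarith [hz.1]) k).trans ?_
    refine mul_le_mul_of_nonneg_right ?_ (Real.rpow_nonneg (by positivity) _)
    refine (PowerSymbol.rpow_le_const_mul_rpow hl
      (show -(2 * R + 1) ≤ -(2 * z.re + 1) by linarith [hz.2])).trans ?_
    refine mul_le_mul_of_nonneg_right ?_ (Real.rpow_nonneg hl.1.le _)
    exact Real.rpow_le_rpow_of_exponent_le (by linarith [Real.pi_gt_three])
      (by linarith [hz.1, hz.2])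

lemma differentiableAt_fgnSpecC_const {z : ℂ} (hz : 0 < z.re) : DifferentiableAt ℂ
    (fun z => Complex.Gamma (2 * z + 1) * Complex.sin (Real.pi * z) / (2 * Real.pi)) z := by
  have h1 : DifferentiableAt ℂ Complex.Gamma (2 * z + 1) := by
    refine Complex.differentiableAt_Gamma _ fun m hm => ?_
    have := congrArg Complex.re hm
    simp at this
    have : (0 : ℝ) ≤ m := m.cast_nonneg
    linarith
  have h2 : DifferentiableAt ℂ (fun z : ℂ => Complex.Gamma (2 * z + 1)) z :=
    DifferentiableAt.comp (g := Complex.Gamma) z h1 (by fun_prop)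
  have h3 : DifferentiableAt ℂ (fun z : ℂ => Complex.sin (Real.pi * z)) z :=
    DifferentiableAt.csin (by fun_prop)
  exact (h2.mul h3).div_const _

lemma two_mul_one_sub_cos_le_sq (l : ℝ) : 2 * (1 - Real.cos l) ≤ l ^ 2 := by
  linarith [Real.one_sub_sq_div_two_le_cos (x := l)]

lemma exists_norm_fgnSpecC_le {H r : ℝ} (hr : 0 < r) (hH : 3 * r < H) :
    ∃ M > 0, ∀ l ∈ Set.Ioo 0 Real.pi, ∀ z ∈ Metric.ball (H : ℂ) (3 * r),
      ‖fgnSpecC z l‖ ≤ M * l ^ (1 - 2 * H - 6 * r) := by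
  have hre : ∀ z ∈ Metric.closedBall (H : ℂ) (3 * r), |z.re - H| ≤ 3 * r := by
    intro z hz
    rw [mem_closedBall_iff_norm] at hz
    refine le_trans ?_ hz
    simpa using Complex.abs_re_le_norm (z - H)
  obtain ⟨K, hK⟩ := (isCompact_closedBall (H : ℂ) (3 * r)).exists_bound_of_continuousOn
    (f := fun z => Complex.Gamma (2 * z + 1) * Complex.sin (Real.pi * z) / (2 * Real.pi))
    fun z hz => (differentiableAt_fgnSpecC_const
      (by linarith [(abs_le.1 (hre z hz)).1])).continuousAt.continuousWithinAt
  have hK0 : 0 ≤ K := (norm_nonneg _).trans (hK H (Metric.mem_closedBall_self (by linarith)))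
  set Z := ∑' k : ℤ, (max 1 |(k : ℝ)|) ^ (-(2 * (H - 3 * r) + 1)) with hZ
  have hZ0 : 0 ≤ Z := tsum_nonneg fun k => Real.rpow_nonneg (by positivity) _
  have hpi := Real.pi_pos
  refine ⟨K * (Z * Real.pi ^ (12 * r)) + 1, by positivity, fun l hl z hz => ?_⟩
  have hz' := hre z (Metric.ball_subset_closedBall hz)
  have hT := norm_tsum_abs_add_cpow_le hl (show 0 < H - 3 * r by linarith) (z := z)
    (by linarith [(abs_le.1 hz').1])
  have hlr : 0 < l ^ (1 - 2 * H - 6 * r) := Real.rpow_pos_of_pos hl.1 _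
  have hw : ‖((2 * (1 - Real.cos l) : ℝ) : ℂ)‖ ≤ l ^ 2 := by
    rw [Complex.norm_real, Real.norm_of_nonneg (by linarith [Real.cos_le_one l])]
    exact two_mul_one_sub_cos_le_sq l
  calc ‖fgnSpecC z l‖ ≤ K * l ^ 2 * (Z * l ^ (-(2 * z.re + 1))) := by
        rw [fgnSpecC, norm_mul, norm_mul]
        exact mul_le_mul (mul_le_mul (hK z (Metric.ball_subset_closedBall hz)) hw
          (norm_nonneg _) hK0) hT (norm_nonneg _) (by positivity)
    _ = K * (Z * l ^ (1 - 2 * z.re)) := by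
        rw [show 1 - 2 * z.re = 2 + -(2 * z.re + 1) by ring, Real.rpow_add hl.1, Real.rpow_two]
        ring
    _ ≤ K * (Z * (Real.pi ^ (12 * r) * l ^ (1 - 2 * H - 6 * r))) := by
        refine mul_le_mul_of_nonneg_left (mul_le_mul_of_nonneg_left ?_ hZ0) hK0
        refine (PowerSymbol.rpow_le_const_mul_rpow hl
          (show 1 - 2 * H - 6 * r ≤ 1 - 2 * z.re by linarith [(abs_le.1 hz').2])).trans ?_
        refine mul_le_mul_of_nonneg_right ?_ hlr.le
        exact Real.rpow_le_rpow_of_exponent_le (by linarith [Real.pi_gt_three])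
          (by linarith [(abs_le.1 hz').1])
    _ ≤ _ := by nlinarith

lemma differentiableOn_fgnSpecC {H r l : ℝ} (hH : 3 * r < H)
    (hl : l ∈ Set.Ioo 0 Real.pi) :
    DifferentiableOn ℂ (fun z => fgnSpecC z l) (Metric.ball (H : ℂ) (3 * r)) := by
  have hre : ∀ z ∈ Metric.ball (H : ℂ) (3 * r), |z.re - H| < 3 * r := by
    intro z hz
    rw [mem_ball_iff_norm] at hz
    refine lt_of_le_of_lt ?_ hz
    simpa using Complex.abs_re_le_norm (z - H)
  have hsub : Metric.ball (H : ℂ) (3 * r) ⊆ {z : ℂ | H - 3 * r < z.re ∧ z.re < H + 3 * r} := by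
    intro z hz
    have := abs_lt.1 (hre z hz)
    exact ⟨by linarith, by linarith⟩
  have h1 := (differentiableOn_tsum_abs_add_cpow hl (show 0 < H - 3 * r by linarith)).mono hsub
  have h2 : DifferentiableOn ℂ
      (fun z => Complex.Gamma (2 * z + 1) * Complex.sin (Real.pi * z) / (2 * Real.pi))
      (Metric.ball (H : ℂ) (3 * r)) := fun z hz =>
    (differentiableAt_fgnSpecC_const
      (by linarith [(abs_lt.1 (hre z hz)).1])).differentiableWithinAt
  exact (h2.mul_const _).mul h1

/-- Differentiability and second-order Taylor estimate in `H` of the spectral density. -/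
lemma exists_fgnSpec_taylor {H : ℝ} (hH : 0 < H) {ε : ℝ} (hε : 0 < ε) :
    ∃ B > 0, ∃ h₀ > 0, ∀ l ∈ Set.Ioo 0 Real.pi,
      DifferentiableAt ℝ (fun h => fgnSpec h l) H ∧
      |deriv (fun h => fgnSpec h l) H| ≤ B * l ^ (1 - 2 * H - ε) ∧
      ∀ h, |h| < h₀ → |fgnSpec (H + h) l - fgnSpec H l - h * deriv (fun h => fgnSpec h l) H| ≤
        B * h ^ 2 * l ^ (1 - 2 * H - ε) := by
  obtain ⟨r, hr, hr1⟩ := exists_between (show 0 < min (ε / 6) (H / 3) by positivity)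
  have hrε : 6 * r ≤ ε := by linarith [hr1.trans_le (min_le_left _ _)]
  have hrH : 3 * r < H := by linarith [hr1.trans_le (min_le_right _ _)]
  obtain ⟨M, hM, hb⟩ := exists_norm_fgnSpecC_le hr hrH
  have hpi := Real.pi_pos
  set P := Real.pi ^ (ε - 6 * r) with hP
  refine ⟨M * P / r + M * P / r ^ 2, by positivity, r, hr, fun l hl => ?_⟩
  have hd := differentiableOn_fgnSpecC hrH hl
  obtain ⟨h1, h2⟩ := norm_deriv_le_and_norm_taylor_le hr hd (hb l hl)
  have hl0 := Real.rpow_pos_of_pos hl.1 (1 - 2 * H - ε)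
  have hle : l ^ (1 - 2 * H - 6 * r) ≤ P * l ^ (1 - 2 * H - ε) := by
    refine (PowerSymbol.rpow_le_const_mul_rpow hl
      (show 1 - 2 * H - ε ≤ 1 - 2 * H - 6 * r by linarith)).trans (le_of_eq ?_)
    rw [hP]
    congr 2
    ring
  have hle' : M * l ^ (1 - 2 * H - 6 * r) ≤ M * P * l ^ (1 - 2 * H - ε) := by
    rw [mul_assoc]
    exact mul_le_mul_of_nonneg_left hle hM.le
  have hda : HasDerivAt (fun z => fgnSpecC z l) (deriv (fun z => fgnSpecC z l) H) H :=
    (hd.differentiableAt (Metric.isOpen_ball.mem_nhds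
      (Metric.mem_ball_self (by linarith)))).hasDerivAt
  have hreal := hda.real_of_complex
  simp only [fgnSpecC_ofReal, Complex.ofReal_re] at hreal
  rw [hreal.deriv]
  set D := deriv (fun z => fgnSpecC z l) H with hD
  have ha : 0 ≤ M * P / r * l ^ (1 - 2 * H - ε) := by positivity
  have hbb : 0 ≤ M * P / r ^ 2 * l ^ (1 - 2 * H - ε) := by positivity
  refine ⟨hreal.differentiableAt, ?_, fun h hh => ?_⟩
  · refine (Complex.abs_re_le_norm D).trans (h1.trans ?_)
    have : M * l ^ (1 - 2 * H - 6 * r) / r ≤ M * P / r * l ^ (1 - 2 * H - ε) := by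
      rw [div_mul_eq_mul_div]
      exact div_le_div_of_nonneg_right hle' hr.le
    linarith
  · have h3 := h2 ((H + h : ℝ) : ℂ) (by
      rw [mem_ball_iff_norm, ← Complex.ofReal_sub, Complex.norm_real]
      simpa using hh)
    have h4 := (Complex.abs_re_le_norm _).trans h3
    simp only [fgnSpecC_ofReal] at h4
    rw [← Complex.ofReal_sub, ← Complex.ofReal_sub, Complex.sub_re, Complex.ofReal_re,
      Complex.re_ofReal_mul, Complex.norm_real, add_sub_cancel_left, Real.norm_eq_abs, sq_abs] at h4
    refine h4.trans ?_
    have h5 : M * l ^ (1 - 2 * H - 6 * r) / r ^ 2 ≤ M * P / r ^ 2 * l ^ (1 - 2 * H - ε) := by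
      rw [div_mul_eq_mul_div]
      exact div_le_div_of_nonneg_right hle' (by positivity)
    nlinarith [mul_le_mul_of_nonneg_right h5 (sq_nonneg h), mul_nonneg ha (sq_nonneg h)]

/-- The normalizing constant of the spectral density. -/
def fgnConst (H : ℝ) : ℝ := Real.Gamma (2 * H + 1) * Real.sin (Real.pi * H) / (2 * Real.pi)

lemma fgnConst_pos {H : ℝ} (hH : H ∈ Set.Ioo (0 : ℝ) 1) : 0 < fgnConst H := by
  have hpi := Real.pi_pos
  have hg : 0 < Real.Gamma (2 * H + 1) := Real.Gamma_pos_of_pos (by linarith [hH.1])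
  have hsin : 0 < Real.sin (Real.pi * H) :=
    Real.sin_pos_of_pos_of_lt_pi (mul_pos hpi hH.1) (by nlinarith [hH.2])
  unfold fgnConst
  positivity

lemma differentiableAt_fgnConst {H : ℝ} (hH : 0 < H) : DifferentiableAt ℝ fgnConst H := by
  have h1 : DifferentiableAt ℝ Real.Gamma (2 * H + 1) := by
    refine Real.differentiableAt_Gamma fun m => ?_
    have : (0 : ℝ) ≤ m := m.cast_nonneg
    linarith
  have h2 : DifferentiableAt ℝ (fun h : ℝ => Real.Gamma (2 * h + 1)) H :=
    DifferentiableAt.comp (g := Real.Gamma) H h1 (by fun_prop)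
  exact (h2.mul (by fun_prop)).div_const _

lemma fgnSpec_eq (H l : ℝ) : fgnSpec H l = fgnConst H * (2 * (1 - Real.cos l)) *
    ∑' k : ℤ, |l + 2 * (k : ℝ) * Real.pi| ^ (-(2 * H + 1)) := by
  rw [fgnSpec, fgnConst, show -2 * H - 1 = -(2 * H + 1) by ring]

lemma sq_le_two_mul_one_sub_cos {l : ℝ} (hl : l ∈ Set.Ioo 0 Real.pi) :
    4 / Real.pi ^ 2 * l ^ 2 ≤ 2 * (1 - Real.cos l) := by
  have := Real.cos_le_one_sub_mul_cos_sq (x := l) (by rw [abs_of_pos hl.1]; exact hl.2.le)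
  have e : 4 / Real.pi ^ 2 * l ^ 2 = 2 * (2 / Real.pi ^ 2 * l ^ 2) := by ring
  linarith

lemma continuousOn_fgnSpec {H : ℝ} (hH : 0 < H) : ContinuousOn (fgnSpec H) (Set.Ioo 0 Real.pi) := by
  have h := continuousOn_tsum_abs_add_rpow (p := 2 * H + 1) (by linarith)
  have h2 : ContinuousOn (fun l => fgnConst H * (2 * (1 - Real.cos l))) (Set.Ioo 0 Real.pi) := by
    fun_prop
  exact (h2.mul h).congr fun l _ => fgnSpec_eq H l

/-- The spectral density behaves like `l ^ (1 - 2H)`. -/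
lemma exists_powerSymbol_fgnSpec {H : ℝ} (hH : H ∈ Set.Ioo (0 : ℝ) 1) :
    ∃ c C, PowerSymbol (1 - 2 * H) c C (fgnSpec H) := by
  have hK := fgnConst_pos hH
  have hpi := Real.pi_pos
  have hp : 1 < 2 * H + 1 := by linarith [hH.1]
  set Z := ∑' k : ℤ, (max 1 |(k : ℝ)|) ^ (-(2 * H + 1)) with hZ
  have hpow : ∀ l ∈ Set.Ioo 0 Real.pi, l ^ (1 - 2 * H) = l ^ 2 * l ^ (-(2 * H + 1)) := by
    intro l hl
    rw [← Real.rpow_two, ← Real.rpow_add hl.1]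
    congr 1
    ring
  refine ⟨fgnConst H * (4 / Real.pi ^ 2), fgnConst H * Z, by linarith [hH.2], by linarith [hH.1],
    by positivity, fun l hl => ?_, fun l hl => ?_, continuousOn_fgnSpec hH.1⟩
  · have h1 := rpow_le_tsum_abs_add_rpow hl hp
    have h2 := sq_le_two_mul_one_sub_cos hl
    have h3 : 0 ≤ l ^ (-(2 * H + 1)) := Real.rpow_nonneg hl.1.le _
    rw [fgnSpec_eq, hpow l hl, mul_assoc, mul_assoc, ← mul_assoc (4 / Real.pi ^ 2)]
    refine mul_le_mul_of_nonneg_left ?_ hK.le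
    exact mul_le_mul h2 h1 h3 (by linarith [Real.cos_le_one l])
  · have h1 := tsum_abs_add_rpow_le hl hp le_rfl
    have h2 := two_mul_one_sub_cos_le_sq l
    rw [fgnSpec_eq, hpow l hl, mul_assoc (fgnConst H), mul_assoc (fgnConst H)]
    refine mul_le_mul_of_nonneg_left ?_ hK.le
    calc _ ≤ l ^ 2 * (Z * l ^ (-(2 * H + 1))) := mul_le_mul h2 h1
          (tsum_nonneg fun k => Real.rpow_nonneg (abs_nonneg _) _) (by positivity)
      _ = _ := by ring

/-- Bounds on the logarithmic derivative of the spectral density and on the relative second-order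
Taylor remainder. -/
lemma exists_dlogSpec_bounds {H : ℝ} (hH : H ∈ Set.Ioo (0 : ℝ) 1) {ε : ℝ} (hε : 0 < ε) :
    ∃ B > 0, ∃ h₀ > 0, ∀ l ∈ Set.Ioo 0 Real.pi,
      HasDerivAt (fun h => fgnSpec h l) (fgnSpec H l * dlogSpec H l) H ∧
      |dlogSpec H l| ≤ B * l ^ (-ε) ∧
      ∀ h, |h| < h₀ → |fgnSpec (H + h) l - fgnSpec H l - h * (fgnSpec H l * dlogSpec H l)| ≤
        B * h ^ 2 * (fgnSpec H l * l ^ (-ε)) := by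
  obtain ⟨c, C, hf⟩ := exists_powerSymbol_fgnSpec hH
  obtain ⟨B, hB, h₀, hh₀, hb⟩ := exists_fgnSpec_taylor hH.1 hε
  have hc := hf.c_pos
  refine ⟨B / c, by positivity, h₀, hh₀, fun l hl => ?_⟩
  obtain ⟨hd, h1, h2⟩ := hb l hl
  have hpos := hf.pos hl
  have hlog : dlogSpec H l = deriv (fun h => fgnSpec h l) H / fgnSpec H l :=
    (hd.hasDerivAt.log hpos.ne').deriv
  have hD : fgnSpec H l * dlogSpec H l = deriv (fun h => fgnSpec h l) H := by
    rw [hlog]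
    field_simp
  have hle : l ^ (1 - 2 * H - ε) ≤ fgnSpec H l * l ^ (-ε) / c := by
    rw [sub_eq_add_neg (1 - 2 * H), Real.rpow_add hl.1, le_div_iff₀ hc]
    have := mul_le_mul_of_nonneg_right (hf.lower l hl) (Real.rpow_nonneg hl.1.le (-ε))
    linarith
  rw [hD]
  refine ⟨hd.hasDerivAt, ?_, fun h hh => ?_⟩
  · rw [hlog, abs_div, abs_of_pos hpos, div_le_iff₀ hpos]
    refine h1.trans ((mul_le_mul_of_nonneg_left hle hB.le).trans (le_of_eq ?_))
    field_simp
  · refine (h2 h hh).trans ((mul_le_mul_of_nonneg_left hle (by positivity)).trans (le_of_eq ?_))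
    field_simp

lemma aestronglyMeasurable_dlogSpec {H : ℝ} (hH : H ∈ Set.Ioo (0 : ℝ) 1) :
    AEStronglyMeasurable (dlogSpec H) halfCircle := by
  obtain ⟨c, C, hf⟩ := exists_powerSymbol_fgnSpec hH
  obtain ⟨B, -, h₀, -, hb⟩ := exists_dlogSpec_bounds hH one_pos
  have hfm := aestronglyMeasurable_halfCircle hf.continuousOn
  refine aestronglyMeasurable_of_tendsto_ae atTop
    (f := fun (n : ℕ) l => ((1 / ((n : ℝ) + 1))⁻¹ *
      (fgnSpec (H + 1 / ((n : ℝ) + 1)) l - fgnSpec H l)) / fgnSpec H l) (fun n => ?_) ?_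
  · have h1 := aestronglyMeasurable_halfCircle
      (continuousOn_fgnSpec (H := H + 1 / ((n : ℝ) + 1))
        (add_pos hH.1 Nat.one_div_pos_of_nat))
    exact (((h1.sub hfm).const_mul _).aemeasurable.div hfm.aemeasurable).aestronglyMeasurable
  · filter_upwards [ae_restrict_mem measurableSet_Ioo] with l hl
    have hpos := hf.pos hl
    have ht : Tendsto (fun n : ℕ => 1 / ((n : ℝ) + 1)) atTop (𝓝[≠] 0) :=
      tendsto_nhdsWithin_iff.2 ⟨tendsto_one_div_add_atTop_nhds_zero_nat,
        Eventually.of_forall fun n => Nat.one_div_pos_of_nat.ne'⟩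
    have h2 := ((hb l hl).1.tendsto_slope_zero.comp ht).div_const (fgnSpec H l)
    rw [mul_div_cancel_left₀ _ hpos.ne'] at h2
    exact h2

/-- The logarithmic derivative of the spectral density blows up at the origin. -/
lemma exists_lt_dlogSpec {H : ℝ} (hH : H ∈ Set.Ioo (0 : ℝ) 1) (m : ℝ) :
    ∃ δ > 0, δ ≤ Real.pi ∧ ∀ l ∈ Set.Ioo 0 δ, m < dlogSpec H l := by
  obtain ⟨c, C, hf⟩ := exists_powerSymbol_fgnSpec hH
  obtain ⟨B, -, h₀, -, hb⟩ := exists_dlogSpec_bounds hH one_pos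
  have hK := fgnConst_pos hH
  have hpi := Real.pi_pos
  set K' := deriv fgnConst H with hK'
  set q := m - K' / fgnConst H with hq
  obtain ⟨η, hη, hη1⟩ := exists_between
    (show 0 < min H (1 / (2 * (|q| + 1))) from lt_min hH.1 (by positivity))
  have hηH : η < H := hη1.trans_le (min_le_left _ _)
  have hηq : |q| + 1 < 1 / (2 * η) := by
    have h := hη1.trans_le (min_le_right _ _)
    rw [lt_div_iff₀ (by positivity)] at h ⊢
    linarith
  set Z := ∑' k : ℤ, (max 1 |(k : ℝ)|) ^ (-(2 * (H - η) + 1)) with hZ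
  have hlim : Tendsto (fun l : ℝ => Z * l ^ (2 * η)) (𝓝[>] 0) (𝓝 0) := by
    have h : ContinuousAt (fun l : ℝ => Z * l ^ (2 * η)) 0 :=
      (Real.continuousAt_rpow_const _ _ (Or.inr (by linarith))).const_mul Z
    have h' := h.tendsto
    rw [Real.zero_rpow (by linarith), mul_zero] at h'
    exact h'.mono_left nhdsWithin_le_nhds
  obtain ⟨δ, hδ, hδl⟩ := mem_nhdsGT_iff_exists_Ioo_subset.1
    (hlim.eventually (gt_mem_nhds (show (0 : ℝ) < 1 / 2 by norm_num)))
  refine ⟨min δ Real.pi, lt_min hδ hpi, min_le_right _ _, fun l hl' => ?_⟩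
  have hl : l ∈ Set.Ioo 0 Real.pi := ⟨hl'.1, hl'.2.trans_le (min_le_right _ _)⟩
  have hsmall : Z * l ^ (2 * η) < 1 / 2 := hδl ⟨hl'.1, hl'.2.trans_le (min_le_left _ _)⟩
  set S : ℝ → ℝ := fun h => ∑' k : ℤ, |l + 2 * (k : ℝ) * Real.pi| ^ (-2 * h - 1) with hS
  have hSe : ∀ h, S h = ∑' k : ℤ, |l + 2 * (k : ℝ) * Real.pi| ^ (-(2 * h + 1)) := fun h => by
    simp only [hS, show -2 * h - 1 = -(2 * h + 1) by ring]
  set w := 2 * (1 - Real.cos l) with hw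
  have hw0 : 0 < w := lt_of_lt_of_le (by have := hl.1; positivity) (sq_le_two_mul_one_sub_cos hl)
  have hfS : ∀ h, fgnSpec h l = fgnConst h * w * S h := fun h => by rw [fgnSpec_eq, hSe]
  have hS0 : 0 < S H := by
    rw [hSe]
    exact (Real.rpow_pos_of_pos hl.1 _).trans_le
      (rpow_le_tsum_abs_add_rpow hl (by linarith [hH.1]))
  have hdK : HasDerivAt fgnConst K' H := (differentiableAt_fgnConst hH.1).hasDerivAt
  have hSd : HasDerivAt S ((dlogSpec H l - K' / fgnConst H) * S H) H := by
    have h1 := ((hb l hl).1.div hdK hK.ne').div_const w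
    have h2 : S =ᶠ[𝓝 H] fun h => (fgnSpec h l / fgnConst h) / w := by
      filter_upwards [Ioo_mem_nhds hH.1 hH.2] with h hh
      have := (fgnConst_pos hh).ne'
      rw [hfS]
      field_simp
    refine (h1.congr_of_eventuallyEq h2).congr_deriv ?_
    rw [hfS]
    field_simp
  have hslope := (convexOn_tsum_abs_add_rpow hl).slope_le_of_hasDerivAt
    (x := H - η) (y := H) (by simpa using hηH) hH.1 (by linarith) hSd
  rw [slope_def_field, sub_sub_cancel] at hslope
  change (S H - S (H - η)) / η ≤ _ at hslope
  have hratio : S (H - η) ≤ 1 / 2 * S H := by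
    have h1 := tsum_abs_add_rpow_le hl (p := 2 * (H - η) + 1) (by linarith) le_rfl
    have h2 := rpow_le_tsum_abs_add_rpow hl (p := 2 * H + 1) (by linarith [hH.1])
    rw [← hSe, ← hZ] at h1
    rw [← hSe] at h2
    have h3 : l ^ (-(2 * (H - η) + 1)) = l ^ (2 * η) * l ^ (-(2 * H + 1)) := by
      rw [← Real.rpow_add hl.1]
      congr 1
      ring
    rw [h3, ← mul_assoc] at h1
    refine h1.trans ((mul_le_mul_of_nonneg_right hsmall.le (Real.rpow_nonneg hl.1.le _)).trans ?_)
    linarith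
  have h5 : 1 / (2 * η) * S H ≤ (dlogSpec H l - K' / fgnConst H) * S H := by
    refine le_trans ?_ hslope
    rw [le_div_iff₀ hη]
    have : 1 / (2 * η) * S H * η = 1 / 2 * S H := by field_simp
    linarith
  have h6 := le_of_mul_le_mul_right h5 hS0
  linarith [le_abs_self q]

lemma jH_eq (H : ℝ) : jH H = -(1 / Real.pi * ∫ l, dlogSpec H l ∂halfCircle) := by
  rw [jH, intervalIntegral_eq_two_mul_halfCircle (dlogSpec_neg H)]
  field_simp

lemma eH_eq (H : ℝ) : eH H = 1 / Real.pi * (∫ l, dlogSpec H l ^ 2 ∂halfCircle) / 2 := by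
  rw [eH, intervalIntegral_eq_two_mul_halfCircle fun x => by rw [dlogSpec_neg]]
  field_simp
  norm_num

lemma memLp_dlogSpec {H : ℝ} (hH : H ∈ Set.Ioo (0 : ℝ) 1) : MemLp (dlogSpec H) 2 halfCircle := by
  obtain ⟨B, -, h₀, -, hb⟩ := exists_dlogSpec_bounds hH (ε := 1 / 4) (by norm_num)
  have hm := aestronglyMeasurable_dlogSpec hH
  refine (memLp_two_iff_integrable_sq hm).2 (integrable_of_le_rpow (B := B ^ 2) (r := -(1 / 2))
    (by norm_num) (hm.pow 2) fun l hl => ?_)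
  rw [abs_pow]
  refine (pow_le_pow_left₀ (abs_nonneg _) (hb l hl).2.1 2).trans (le_of_eq ?_)
  rw [mul_pow, ← Real.rpow_mul_natCast hl.1.le]
  norm_num

/-- The logarithmic derivative of the spectral density is not almost everywhere constant. -/
lemma integral_dlogSpec_sub_sq_pos {H : ℝ} (hH : H ∈ Set.Ioo (0 : ℝ) 1) (m : ℝ) :
    0 < ∫ l, (dlogSpec H l - m) ^ 2 ∂halfCircle := by
  obtain ⟨δ, hδ, hδπ, hb⟩ := exists_lt_dlogSpec hH (m + 1)
  have hi : Integrable (fun l => (dlogSpec H l - m) ^ 2) halfCircle :=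
    ((memLp_dlogSpec hH).sub (memLp_const m)).integrable_sq
  have hsub : Set.Ioo 0 δ ⊆ Set.Ioo 0 Real.pi := Set.Ioo_subset_Ioo_right hδπ
  calc (0 : ℝ) < δ := hδ
    _ = ∫ _ in Set.Ioo 0 δ, (1 : ℝ) := by simp [hδ.le]
    _ ≤ ∫ l in Set.Ioo 0 δ, (dlogSpec H l - m) ^ 2 := by
      refine setIntegral_mono_on (by simp) (IntegrableOn.mono_set hi hsub) measurableSet_Ioo
        fun l hl => ?_
      nlinarith [hb l hl]
    _ ≤ _ := setIntegral_mono_set hi (ae_of_all _ fun l => sq_nonneg _) hsub.eventuallyLE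

lemma jH_sq_lt {H : ℝ} (hH : H ∈ Set.Ioo (0 : ℝ) 1) : jH H ^ 2 < 2 * eH H := by
  have hpi := Real.pi_pos
  have hφ := memLp_dlogSpec hH
  have hi : Integrable (dlogSpec H) halfCircle := hφ.integrable (by norm_num)
  set m := 1 / Real.pi * ∫ l, dlogSpec H l ∂halfCircle with hm
  have h := integral_dlogSpec_sub_sq_pos hH m
  have hi' : Integrable (fun l => 2 * m * dlogSpec H l - m ^ 2) halfCircle :=
    (hi.const_mul _).sub (integrable_const _)
  have e : ∫ l, (dlogSpec H l - m) ^ 2 ∂halfCircle =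
      ∫ l, dlogSpec H l ^ 2 ∂halfCircle - Real.pi * m ^ 2 := by
    calc _ = ∫ l, (dlogSpec H l ^ 2 - (2 * m * dlogSpec H l - m ^ 2)) ∂halfCircle :=
          integral_congr_ae (ae_of_all _ fun l => by ring)
      _ = _ := by
        rw [integral_sub hφ.integrable_sq hi',
          integral_sub (hi.const_mul _) (integrable_const _), integral_const_mul, integral_const,
          Measure.real, Measure.restrict_apply_univ, Real.volume_Ioo,
          ENNReal.toReal_ofReal (by linarith), smul_eq_mul,
          show ∫ l, dlogSpec H l ∂halfCircle = Real.pi * m by rw [hm]; field_simp]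
        ring
  rw [e] at h
  rw [jH_eq, eH_eq, ← hm, neg_sq, mul_div_cancel₀ _ two_ne_zero, one_div, ← div_eq_inv_mul,
    lt_div_iff₀ hpi]
  linarith

lemma det_fisher_ne_zero {H σ : ℝ} (hH : H ∈ Set.Ioo (0 : ℝ) 1) (hσ : 0 < σ) :
    (!![eH H, -jH H / σ; -jH H / σ, 2 / σ ^ 2] : Matrix (Fin 2) (Fin 2) ℝ).det ≠ 0 := by
  have h := jH_sq_lt hH
  have e : eH H * (2 / σ ^ 2) - -jH H / σ * (-jH H / σ) = (2 * eH H - jH H ^ 2) / σ ^ 2 := by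
    field_simp
  rw [Matrix.det_fin_two_of, e]
  exact (div_pos (by linarith) (by positivity)).ne'

lemma PowerSymbol.const_mul {a c C : ℝ} {f : ℝ → ℝ} (hf : PowerSymbol a c C f) {s : ℝ}
    (hs : 0 < s) : PowerSymbol a (s * c) (s * C) fun l => s * f l where
  neg_one_lt := hf.neg_one_lt
  lt_one := hf.lt_one
  c_pos := mul_pos hs hf.c_pos
  lower l hl := by rw [mul_assoc]; exact mul_le_mul_of_nonneg_left (hf.lower l hl) hs.le
  upper l hl := by rw [mul_assoc]; exact mul_le_mul_of_nonneg_left (hf.upper l hl) hs.le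
  continuousOn := continuousOn_const.mul hf.continuousOn

lemma tendsto_rpow_div_sqrt {m : ℝ} (hm : m < 1 / 2) :
    Tendsto (fun n : ℕ => (n : ℝ) ^ m / Real.sqrt n) atTop (𝓝 0) := by
  have h := (tendsto_rpow_neg_atTop (y := 1 / 2 - m) (by linarith)).comp
    tendsto_natCast_atTop_atTop
  refine h.congr' ?_
  filter_upwards [eventually_gt_atTop 0] with n hn
  have hn' : (0 : ℝ) < n := by exact_mod_cast hn
  rw [Function.comp, neg_sub, Real.rpow_sub hn', Real.sqrt_eq_rpow]

lemma fgnP_one_eq {H : ℝ} (hH : H ∈ Set.Ioo (0 : ℝ) 1) (n : ℕ) (σ : ℝ) :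
    fgnP n 1 H σ = gaussianPi n (toep n fun l => σ ^ 2 * fgnSpec H l) := by
  rw [fgnP, Real.one_rpow, mul_one, fgnT_eq_toep hH, toep_const_mul]

/-- Score matrices: the derivatives of the covariance matrix `σ² T_n(H)` in `H` and `σ`. -/
def scoreMat (H σ : ℝ) (n : ℕ) : Fin 2 → Matrix (Fin n) (Fin n) ℝ :=
  ![toep n fun l => σ ^ 2 * fgnSpec H l * dlogSpec H l,
    (2 / σ) • toep n fun l => σ ^ 2 * fgnSpec H l]

lemma tendsto_covInner_scoreMat {H σ : ℝ} (hH : H ∈ Set.Ioo (0 : ℝ) 1) (hσ : 0 < σ)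
    (j k : Fin 2) :
    Tendsto (fun n => covInner (toep n fun l => σ ^ 2 * fgnSpec H l) (scoreMat H σ n j)
        (scoreMat H σ n k) / (2 * n)) atTop
      (𝓝 (!![eH H, -jH H / σ; -jH H / σ, 2 / σ ^ 2] j k)) := by
  obtain ⟨c, C, hf₀⟩ := exists_powerSymbol_fgnSpec hH
  have hf := hf₀.const_mul (pow_pos hσ 2)
  have ha : 0 < 1 - |1 - 2 * H| := by
    linarith [abs_lt.2 ⟨hf₀.neg_one_lt, hf₀.lt_one⟩]
  obtain ⟨B, -, h₀, -, hb⟩ := exists_dlogSpec_bounds hH (ε := (1 - |1 - 2 * H|) / 8)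
    (by linarith)
  have hm := aestronglyMeasurable_dlogSpec hH
  have h00 := (hf.tendsto_covInner_toep (by linarith) (by linarith) hm
    fun l hl => (hb l hl).2.1).div_const 2
  have h01 := (hf.tendsto_trace_inv_mul_toep (by linarith) hm
    fun l hl => (hb l hl).2.1).div_const σ
  have e01 : ∀ n : ℕ, covInner (toep n fun l => σ ^ 2 * fgnSpec H l) (scoreMat H σ n 1)
      (scoreMat H σ n 0) / (2 * n) = ((toep n fun l => σ ^ 2 * fgnSpec H l)⁻¹ *
        toep n fun l => σ ^ 2 * fgnSpec H l * dlogSpec H l).trace / n / σ := by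
    intro n
    simp only [scoreMat, Matrix.cons_val_zero, Matrix.cons_val_one]
    rw [covInner_smul_left, covInner_self_left (hf.posDef_toep n)]
    field_simp
  rw [show 1 / Real.pi * ∫ l, dlogSpec H l ∂halfCircle = -jH H by rw [jH_eq, neg_neg]] at h01
  fin_cases j <;> fin_cases k
  · change Tendsto _ _ (𝓝 (eH H))
    rw [eH_eq]
    refine h00.congr fun n => ?_
    rw [div_div, mul_comm (n : ℝ)]
    rfl
  · refine h01.congr fun n => ?_
    rw [covInner_comm]
    exact (e01 n).symm
  · exact h01.congr fun n => (e01 n).symm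
  · refine tendsto_const_nhds.congr' ?_
    filter_upwards [eventually_gt_atTop 0] with n hn
    have hn' : (n : ℝ) ≠ 0 := by exact_mod_cast hn.ne'
    have hS := hf.posDef_toep n
    change 2 / σ ^ 2 = covInner _ ((2 / σ) • toep n _) ((2 / σ) • toep n _) / (2 * n)
    rw [covInner_smul_left, covInner_smul_right, covInner_self_left hS,
      Matrix.nonsing_inv_mul _ (isUnit_iff_ne_zero.2 hS.det_pos.ne'), Matrix.trace_one,
      Fintype.card_fin]
    field_simp

/-- Second-order expansion of the spectral density of `(H, σ)`. -/
lemma abs_taylor_sq_mul_le {σ t h f f' φ B w p : ℝ} (hf : 0 ≤ f)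
    (hT : |f' - f - h * (f * φ)| ≤ B * h ^ 2 * (f * w)) (hφ : |φ| ≤ B * w) (hp : 1 ≤ p * w) :
    |(σ + t) ^ 2 * f' - σ ^ 2 * f - (h * (σ ^ 2 * f * φ) + t * (2 * σ * f))| ≤
      ((σ + t) ^ 2 * B * h ^ 2 + t ^ 2 * p + |2 * σ * t + t ^ 2| * |h| * B) * (f * w) := by
  have e : (σ + t) ^ 2 * f' - σ ^ 2 * f - (h * (σ ^ 2 * f * φ) + t * (2 * σ * f)) =
      (σ + t) ^ 2 * (f' - f - h * (f * φ)) + t ^ 2 * f + (2 * σ * t + t ^ 2) * h * (f * φ) := by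
    ring
  have h1 : |(σ + t) ^ 2 * (f' - f - h * (f * φ))| ≤ (σ + t) ^ 2 * (B * h ^ 2 * (f * w)) := by
    rw [abs_mul, abs_of_nonneg (sq_nonneg (σ + t))]
    exact mul_le_mul_of_nonneg_left hT (sq_nonneg _)
  have h2 : |t ^ 2 * f| ≤ t ^ 2 * (f * (p * w)) := by
    rw [abs_of_nonneg (by positivity)]
    exact mul_le_mul_of_nonneg_left (le_mul_of_one_le_right hf hp) (sq_nonneg _)
  have h3 : |(2 * σ * t + t ^ 2) * h * (f * φ)| ≤
      |2 * σ * t + t ^ 2| * |h| * (f * (B * w)) := by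
    rw [abs_mul, abs_mul, abs_mul f, abs_of_nonneg hf]
    exact mul_le_mul_of_nonneg_left (mul_le_mul_of_nonneg_left hφ hf) (by positivity)
  rw [e]
  refine (abs_add_le _ _).trans ((add_le_add (abs_add_le _ _) le_rfl).trans ?_)
  refine (add_le_add (add_le_add h1 h2) h3).trans (le_of_eq ?_)
  ring

/-- The same expansion along a shrinking perturbation, with a bound of second order. -/
lemma abs_taylor_sq_mul_le_sq {σ s u v f f' φ B w p : ℝ} (hσ : 0 ≤ σ) (hs : 0 ≤ s) (hs1 : s ≤ 1)
    (hf : 0 ≤ f) (hB : 0 ≤ B) (hw : 0 ≤ w)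
    (hT : |f' - f - s * u * (f * φ)| ≤ B * (s * u) ^ 2 * (f * w)) (hφ : |φ| ≤ B * w)
    (hp : 1 ≤ p * w) :
    |(σ + s * v) ^ 2 * f' - σ ^ 2 * f - (s * u * (σ ^ 2 * f * φ) + s * v * (2 * σ * f))| ≤
      s ^ 2 * ((σ + |v|) ^ 2 * B * u ^ 2 + v ^ 2 * p + (2 * σ * |v| + v ^ 2) * |u| * B) *
        (f * w) := by
  refine (abs_taylor_sq_mul_le hf hT hφ hp).trans
    (mul_le_mul_of_nonneg_right ?_ (mul_nonneg hf hw))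
  have hsv : |s * v| ≤ |v| := by
    rw [abs_mul, abs_of_nonneg hs]
    exact mul_le_of_le_one_left (abs_nonneg _) hs1
  have h1 : (σ + s * v) ^ 2 ≤ (σ + |v|) ^ 2 := by
    rw [sq_le_sq, abs_of_nonneg (add_nonneg hσ (abs_nonneg v))]
    refine (abs_add_le _ _).trans ?_
    rw [abs_of_nonneg hσ]
    linarith
  have h2 : |2 * σ * (s * v) + (s * v) ^ 2| ≤ s * (2 * σ * |v| + v ^ 2) := by
    refine (abs_add_le _ _).trans ?_
    rw [abs_mul, abs_mul s, abs_of_nonneg hs, abs_of_nonneg (mul_nonneg zero_le_two hσ),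
      abs_of_nonneg (sq_nonneg (s * v))]
    nlinarith [mul_le_mul_of_nonneg_right (mul_le_of_le_one_left hs hs1) (sq_nonneg v)]
  have h3 := mul_le_mul_of_nonneg_right h1 (mul_nonneg hB (sq_nonneg (s * u)))
  have h4 := mul_le_mul_of_nonneg_right h2 (mul_nonneg (abs_nonneg (s * u)) hB)
  rw [abs_mul s, abs_of_nonneg hs] at h4 ⊢
  nlinarith

lemma exists_remainder_bound {H σ : ℝ} (hH : H ∈ Set.Ioo (0 : ℝ) 1) (hσ : 0 < σ) (u v : ℝ)
    {ε : ℝ} (hε : 0 < ε) (hε' : ε ≤ (1 + (1 - 2 * H)) / 2) :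
    ∃ K : ℝ, ∀ᶠ n : ℕ in atTop, ∀ x,
      |qForm ((toep n fun l => (σ + (Real.sqrt n)⁻¹ * v) ^ 2 *
          fgnSpec (H + (Real.sqrt n)⁻¹ * u) l) - (toep n fun l => σ ^ 2 * fgnSpec H l) -
        (Real.sqrt n)⁻¹ • (u • scoreMat H σ n 0 + v • scoreMat H σ n 1)) x| ≤
      K * (n : ℝ)⁻¹ * (n : ℝ) ^ (4 / (1 + (1 - 2 * H)) * ε) *
        qForm (toep n fun l => σ ^ 2 * fgnSpec H l) x := by
  obtain ⟨c, C, hf₀⟩ := exists_powerSymbol_fgnSpec hH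
  have hf := hf₀.const_mul (pow_pos hσ 2)
  obtain ⟨B, hB, h₀, hh₀, hb⟩ := exists_dlogSpec_bounds hH hε
  obtain ⟨K, -, hK⟩ := hf.exists_qForm_upper hε.le hε'
  have hm := aestronglyMeasurable_dlogSpec hH
  set Q := (σ + |v|) ^ 2 * B * u ^ 2 + v ^ 2 * Real.pi ^ ε +
    (2 * σ * |v| + v ^ 2) * |u| * B with hQ
  have hQ0 : 0 ≤ Q := by positivity
  refine ⟨K * (Q / σ ^ 2), ?_⟩
  have hlim : Tendsto (fun n : ℕ => (Real.sqrt n)⁻¹ * u) atTop (𝓝 0) := by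
    have h := tendsto_inv_atTop_zero.comp
      (Real.tendsto_sqrt_atTop.comp tendsto_natCast_atTop_atTop)
    simpa using h.mul_const u
  have hlimH : Tendsto (fun n : ℕ => H + (Real.sqrt n)⁻¹ * u) atTop (𝓝 H) := by
    simpa using hlim.const_add H
  have hi : Integrable (fun l => σ ^ 2 * fgnSpec H l * dlogSpec H l) halfCircle :=
    hf.integrable_mul (by linarith [hH.2]) hm fun l hl => (hb l hl).2.1
  filter_upwards [eventually_gt_atTop 0, hlimH.eventually (Ioo_mem_nhds hH.1 hH.2),
    hlim.eventually (Metric.ball_mem_nhds 0 hh₀)] with n hn hnH hnh x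
  rw [dist_zero_right, Real.norm_eq_abs] at hnh
  have hn1 : (1 : ℝ) ≤ n := by exact_mod_cast hn
  have hs0 : 0 ≤ (Real.sqrt n)⁻¹ := inv_nonneg.2 (Real.sqrt_nonneg _)
  have hs1 : (Real.sqrt n)⁻¹ ≤ 1 := inv_le_one_of_one_le₀ (Real.one_le_sqrt.2 hn1)
  have hsq : (Real.sqrt n)⁻¹ ^ 2 = (n : ℝ)⁻¹ := by
    rw [inv_pow, Real.sq_sqrt (by linarith)]
  set s := (Real.sqrt n)⁻¹ with hs
  obtain ⟨c', C', hf'⟩ := exists_powerSymbol_fgnSpec hnH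
  have hi' : Integrable (fun l => (σ + s * v) ^ 2 * fgnSpec (H + s * u) l) halfCircle :=
    hf'.integrable.const_mul _
  have hi1 : Integrable (fun l => (σ + s * v) ^ 2 * fgnSpec (H + s * u) l -
      σ ^ 2 * fgnSpec H l) halfCircle := hi'.sub hf.integrable
  have hi2 : Integrable (fun l => s * u * (σ ^ 2 * fgnSpec H l * dlogSpec H l) +
      s * v * (2 * σ * fgnSpec H l)) halfCircle :=
    (hi.const_mul _).add ((hf₀.integrable.const_mul _).const_mul _)
  have hmat : (toep n fun l => (σ + s * v) ^ 2 * fgnSpec (H + s * u) l) -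
      (toep n fun l => σ ^ 2 * fgnSpec H l) -
        s • (u • scoreMat H σ n 0 + v • scoreMat H σ n 1) =
      toep n fun l => (σ + s * v) ^ 2 * fgnSpec (H + s * u) l - σ ^ 2 * fgnSpec H l -
        (s * u * (σ ^ 2 * fgnSpec H l * dlogSpec H l) + s * v * (2 * σ * fgnSpec H l)) := by
    rw [toep_sub hi1 hi2, toep_sub hi' hf.integrable,
      toep_add (hi.const_mul _) ((hf₀.integrable.const_mul _).const_mul _),
      toep_const_mul (s * u), toep_const_mul (s * v), toep_const_mul (2 * σ), toep_const_mul (σ ^ 2)]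
    simp only [scoreMat, Matrix.cons_val_zero, Matrix.cons_val_one, smul_add, smul_smul]
    rw [toep_const_mul (σ ^ 2), smul_smul]
    rw [show s * (v * (2 / σ)) * σ ^ 2 = s * v * (2 * σ) by field_simp]
  rw [hmat]
  have h := hK n hn _ (Q / σ ^ 2 * (n : ℝ)⁻¹) (hi1.sub hi2).1
    (by positivity) (fun l hl => ?_) x
  · refine h.trans (le_of_eq ?_)
    ring
  · obtain ⟨-, h1, h2⟩ := hb l hl
    have hp := PowerSymbol.rpow_le_const_mul_rpow (r := 0) (s := -ε) hl (by linarith)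
    rw [Real.rpow_zero, zero_sub, neg_neg] at hp
    refine (abs_taylor_sq_mul_le_sq hσ.le hs0 hs1 (hf₀.pos hl).le hB.le
      (Real.rpow_nonneg hl.1.le _) (h2 _ hnh) h1 hp).trans (le_of_eq ?_)
    rw [hsq, ← hQ]
    field_simp

/-- **LAN for fractional Gaussian noise with fixed sampling step `Δ = 1`.** The family
`{P^n_{(H,σ)}}` is LAN at every `(H,σ) ∈ (0,1)×(0,∞)` with rate matrix `(1/√n)·I₂` and
Fisher matrix `[[e_H, -j_H/σ], [-j_H/σ, 2/σ²]]`. -/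
theorem lan_fgn_fixed_step (H σ : ℝ) (hH : H ∈ Set.Ioo (0 : ℝ) 1) (hσ : 0 < σ) :
    IsLAN (fun n (θ : Fin 2 → ℝ) => fgnP n 1 (θ 0) (θ 1)) ![H, σ]
      (fun n => (Real.sqrt n)⁻¹ • (1 : Matrix (Fin 2) (Fin 2) ℝ))
      !![eH H, -jH H / σ; -jH H / σ, 2 / σ ^ 2] := by
  refine ⟨?_, det_fisher_ne_zero hH hσ, ?_⟩
  · filter_upwards [eventually_gt_atTop 0] with n hn
    have hn' : (0 : ℝ) < n := by exact_mod_cast hn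
    rw [Matrix.det_smul, Matrix.det_one, mul_one]
    exact pow_ne_zero _ (inv_ne_zero (Real.sqrt_pos.2 hn').ne')
  obtain ⟨c, C, hf₀⟩ := exists_powerSymbol_fgnSpec hH
  have hf := hf₀.const_mul (pow_pos hσ 2)
  have ha : 0 < 1 - H := by linarith [hH.2]
  set ε := (1 - H) / 8 with hε
  have hε0 : 0 < ε := by positivity
  have hε1 : ε ≤ (1 + (1 - 2 * H)) / 2 := by linarith
  set m := 4 / (1 + (1 - 2 * H)) * ε with hm
  have hm4 : m = 1 / 4 := by
    rw [hm, hε, show 1 + (1 - 2 * H) = 2 * (1 - H) by ring]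
    field_simp
    norm_num
  have hm2 : m < 1 / 2 := by rw [hm4]; norm_num
  obtain ⟨B, hB, h₀, -, hb⟩ := exists_dlogSpec_bounds hH hε0
  obtain ⟨K, hK0, hK⟩ := hf.exists_qForm_upper hε0.le hε1
  have hq0 : ∀ n x, 0 ≤ qForm (toep n fun l => σ ^ 2 * fgnSpec H l) x := fun n x => by
    rw [qForm_eq_dotProduct]
    simpa using (hf.posDef_toep n).posSemidef.dotProduct_mulVec_nonneg x
  refine lanExpansion_gaussianPi
    (S := fun n => toep n fun l => σ ^ 2 * fgnSpec H l) (G := scoreMat H σ)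
    (S' := fun n u => toep n fun l => (σ + (Real.sqrt n)⁻¹ * u 1) ^ 2 *
      fgnSpec (H + (Real.sqrt n)⁻¹ * u 0) l)
    (κ := fun n => (K * B + 2 / σ) * (n : ℝ) ^ m)
    hf.posDef_toep (fun n j => ?_) (fun n u => isHermitian_toep _ _)
    (fun n => fgnP_one_eq hH n σ) (fun u => ?_) ?_ ?_ (tendsto_covInner_scoreMat hH hσ)
    (fun u => ?_)
  · fin_cases j
    · exact isHermitian_toep _ _
    · change ((2 / σ) • toep n _).IsHermitian
      rw [← toep_const_mul]
      exact isHermitian_toep _ _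
  · have hlim : Tendsto (fun n : ℕ => H + (Real.sqrt n)⁻¹ * u 0) atTop (𝓝 H) := by
      have h := tendsto_inv_atTop_zero.comp
        (Real.tendsto_sqrt_atTop.comp tendsto_natCast_atTop_atTop)
      simpa using (h.mul_const (u 0)).const_add H
    filter_upwards [hlim.eventually (Ioo_mem_nhds hH.1 hH.2)] with n hn
    rw [← fgnP_one_eq hn]
    simp [Matrix.smul_mulVec]
  · have h := (tendsto_rpow_div_sqrt hm2).const_mul (K * B + 2 / σ)
    rw [mul_zero] at h
    exact h.congr fun n => by ring
  · filter_upwards [eventually_gt_atTop 0] with n hn j x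
    have hn1 : (1 : ℝ) ≤ (n : ℝ) ^ m := Real.one_le_rpow (by exact_mod_cast hn)
      (by rw [hm4]; norm_num)
    have hq := hq0 n x
    fin_cases j
    · have h := hK n hn (fun l => σ ^ 2 * fgnSpec H l * dlogSpec H l) B
        ((aestronglyMeasurable_halfCircle hf.continuousOn).mul (aestronglyMeasurable_dlogSpec hH))
        hB.le (fun l hl => by
          rw [abs_mul, abs_of_pos (hf.pos hl), mul_left_comm]
          exact mul_le_mul_of_nonneg_left (hb l hl).2.1 (hf.pos hl).le) x
      refine h.trans (mul_le_mul_of_nonneg_right (mul_le_mul_of_nonneg_right ?_ ?_) hq)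
      · linarith [show 0 < 2 / σ by positivity]
      · linarith
    · change |qForm ((2 / σ) • toep n _) x| ≤ _
      rw [qForm_smul, abs_mul, abs_of_nonneg hq, abs_of_pos (by positivity : 0 < 2 / σ)]
      refine mul_le_mul_of_nonneg_right ?_ hq
      have h1 : 0 ≤ K * B * (n : ℝ) ^ m := by positivity
      have h2 : 2 / σ * 1 ≤ 2 / σ * (n : ℝ) ^ m :=
        mul_le_mul_of_nonneg_left hn1 (by positivity)
      linarith
  · obtain ⟨K', hK'⟩ := exists_remainder_bound hH hσ (u 0) (u 1) hε0 hε1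
    refine ⟨fun n => K' * (n : ℝ)⁻¹ * (n : ℝ) ^ m, ?_, ?_⟩
    · have h := (tendsto_rpow_div_sqrt hm2).const_mul K'
      rw [mul_zero] at h
      refine h.congr' ?_
      filter_upwards [eventually_gt_atTop 0] with n hn
      have hn' : (0 : ℝ) < n := by exact_mod_cast hn
      have hs := Real.sqrt_pos.2 hn'
      nth_rewrite 4 [← Real.mul_self_sqrt hn'.le]
      field_simp
    · simpa only [Fin.sum_univ_two] using hK'
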